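/- (Counterexample to Payne's nodal line conjecture) There exists a bounded, connected, non-simply connected open set Ω ⊆ ℝ² together with a nonzero function u ∈ C²(Ω) ∩ C(cl Ω) satisfying −Δu = λ_2(Ω)·u in Ω and u = 0 on ∂Ω, such that the closure of the nodal set {x ∈ Ω : u(x) = 0} is contained in Ω; that is, the nodal line of a second Dirichlet eigenfunction is closed and does not touch the boundary of Ω. -/

import Mathlib

open MeasureTheory Real

/-- The k-th Dirichlet eigenvalue of the Laplacian on `Ω ⊆ ℝⁿ`, defined variationally as
the infimum, over all `k`-dimensional subspaces `E` of the space of smooth compactly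
supported functions with support in `Ω`, of the supremum of the Rayleigh quotient
`(∫_Ω ‖∇u‖²) / (∫_Ω u²)` over nonzero `u ∈ E`. -/
noncomputable def dirichletEig {n : ℕ} (Ω : Set (EuclideanSpace ℝ (Fin n))) (k : ℕ) : ℝ :=
  sInf { r : ℝ | ∃ E : Submodule ℝ (EuclideanSpace ℝ (Fin n) → ℝ),
    Module.finrank ℝ E = k ∧
    (∀ u ∈ E, ContDiff ℝ (⊤ : ℕ∞) u ∧ HasCompactSupport u ∧ tsupport u ⊆ Ω) ∧
    r = sSup { q : ℝ | ∃ u ∈ E, u ≠ (0 : EuclideanSpace ℝ (Fin n) → ℝ) ∧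
        q = (∫ x in Ω, ‖gradient u x‖ ^ 2) / (∫ x in Ω, (u x) ^ 2) } }

/-- The Laplacian of `u : ℝⁿ → ℝ`: the sum of the second partial derivatives. -/
noncomputable def lap {n : ℕ} (u : EuclideanSpace ℝ (Fin n) → ℝ)
    (x : EuclideanSpace ℝ (Fin n)) : ℝ :=
  ∑ i : Fin n, fderiv ℝ (fun y => fderiv ℝ u y (EuclideanSpace.single i 1)) x
      (EuclideanSpace.single i 1)

namespace Payne

open Filter Topology

/-- The exponential generating function of a sequence. -/
noncomputable def egf (γ : ℕ → ℝ) (s : ℝ) : ℝ := ∑' k : ℕ, γ k * (s ^ k / k.factorial)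

lemma egf_summable {γ : ℕ → ℝ} {C : ℝ} (h : ∀ k, |γ k| ≤ C) (s : ℝ) :
    Summable fun k : ℕ => γ k * (s ^ k / k.factorial) := by
  refine Summable.of_norm_bounded ((Real.summable_pow_div_factorial |s|).mul_left C) fun k => ?_
  rw [norm_mul, norm_div, norm_pow, Real.norm_eq_abs, Real.norm_eq_abs, Real.norm_natCast]
  exact mul_le_mul_of_nonneg_right (h k) (by positivity)

lemma hasDerivAt_egf {γ : ℕ → ℝ} {C : ℝ} (h : ∀ k, |γ k| ≤ C) (s : ℝ) :
    HasDerivAt (egf γ) (egf (fun k => γ (k + 1)) s) s := by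
  have key : HasDerivAt (egf γ)
      (∑' k : ℕ, γ k * (k * s ^ (k - 1) / k.factorial)) s := by
    have hC : 0 ≤ C := (abs_nonneg _).trans (h 0)
    set M := |s| + 1 with hM
    have hM0 : 0 ≤ M := by positivity
    have hu : Summable fun k : ℕ => C * (k * M ^ (k - 1) / k.factorial) := by
      refine Summable.mul_left _ ?_
      rw [← summable_nat_add_iff 1]
      refine (Real.summable_pow_div_factorial M).congr fun k => ?_
      simp only [Nat.add_sub_cancel, Nat.factorial_succ]
      push_cast
      have : ((k : ℝ) + 1) ≠ 0 := by positivity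
      have : (k.factorial : ℝ) ≠ 0 := by positivity
      field_simp
    refine hasDerivAt_tsum_of_isPreconnected (t := Metric.ball 0 M)
      (g := fun k s => γ k * (s ^ k / k.factorial)) hu
      Metric.isOpen_ball (convex_ball 0 M).isPreconnected
      (fun k y _ => ((hasDerivAt_pow k y).div_const _).const_mul _) (fun k y hy => ?_)
      (y₀ := 0) (by simp [hM]; positivity) (egf_summable h 0) (by simp [hM])
    have hy' : |y| ≤ M := by simpa using (le_of_lt (by simpa using hy : |y| < M))
    rw [norm_mul, norm_div, norm_mul, norm_pow, Real.norm_eq_abs, Real.norm_eq_abs,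
      Real.norm_natCast, Nat.abs_cast, Real.norm_eq_abs]
    gcongr
    exact h k
  convert key using 1
  have hs : Summable fun k : ℕ => γ k * (k * s ^ (k - 1) / k.factorial) := by
    rw [← summable_nat_add_iff 1]
    refine (egf_summable (γ := fun k => γ (k + 1)) (fun k => h (k + 1)) s).congr fun k => ?_
    simp only [Nat.add_sub_cancel, Nat.factorial_succ]
    push_cast
    have : ((k : ℝ) + 1) ≠ 0 := by positivity
    field_simp
  rw [hs.tsum_eq_zero_add]
  simp only [egf, Nat.add_sub_cancel, Nat.factorial_succ, Nat.cast_zero, zero_mul, zero_div,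
    mul_zero, zero_add]
  refine tsum_congr fun k => ?_
  push_cast
  have : ((k : ℝ) + 1) ≠ 0 := by positivity
  field_simp

lemma contDiff_egf {γ : ℕ → ℝ} {C : ℝ} (h : ∀ k, |γ k| ≤ C) :
    ContDiff ℝ (⊤ : ℕ∞) (egf γ) := by
  rw [contDiff_infty]
  intro n
  induction n generalizing γ with
  | zero =>
    exact contDiff_zero.2 (continuous_iff_continuousAt.2 fun s => (hasDerivAt_egf h s).continuousAt)
  | succ n ih =>
    have hd : deriv (egf γ) = egf (fun k => γ (k + 1)) :=
      funext fun s => (hasDerivAt_egf h s).deriv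
    push_cast
    rw [contDiff_succ_iff_deriv]
    refine ⟨fun s => (hasDerivAt_egf h s).differentiableAt, by simp, ?_⟩
    rw [hd]
    exact ih fun k => h (k + 1)

lemma egf_zero (γ : ℕ → ℝ) : egf γ 0 = γ 0 := by
  unfold egf
  rw [tsum_eq_single 0 (fun k hk => by simp [hk])]
  simp

lemma mul_egf_shift {γ : ℕ → ℝ} {C : ℝ} (h : ∀ k, |γ k| ≤ C) (s : ℝ) :
    HasSum (fun k : ℕ => (k * γ k) * (s ^ k / k.factorial)) (s * egf (fun k => γ (k + 1)) s) := by
  have h1 := (egf_summable (γ := fun k => γ (k + 1)) (fun k => h (k + 1)) s).hasSum.mul_left s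
  rw [← hasSum_nat_add_iff' 1]
  simp only [Finset.range_one, Finset.sum_singleton, Nat.cast_zero, zero_mul, sub_zero]
  refine h1.congr_fun ?_
  intro k
  simp only [Nat.factorial_succ]
  push_cast
  have : ((k : ℝ) + 1) ≠ 0 := by positivity
  field_simp
  ring

lemma mul_egf_shift_two_add {γ : ℕ → ℝ} {C : ℝ} (h : ∀ k, |γ k| ≤ C) (s : ℝ) :
    HasSum (fun k : ℕ => ((k + 1) * γ (k + 1)) * (s ^ k / k.factorial))
      (s * egf (fun k => γ (k + 1 + 1)) s + egf (fun k => γ (k + 1)) s) := by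
  have h' : ∀ k, |γ (k + 1)| ≤ C := fun k => h (k + 1)
  refine ((mul_egf_shift (γ := fun k => γ (k + 1)) h' s).add (egf_summable h' s).hasSum).congr_fun ?_
  intro k
  ring

/-- Coefficients of the regular radial solution of the Helmholtz equation. -/
noncomputable def alpha (k : ℕ) : ℝ := (-1 / 4) ^ k / k.factorial

/-- Coefficients of the regular part of the logarithmic radial solution. -/
noncomputable def beta : ℕ → ℝ
  | 0 => 0
  | k + 1 => -(beta k / 4 + alpha (k + 1)) / (k + 1)

lemma abs_alpha_le (k : ℕ) : |alpha k| ≤ 1 := by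
  rw [alpha, abs_div, abs_pow, Nat.abs_cast]
  have h1 : |(-1 / 4 : ℝ)| ^ k ≤ 1 := pow_le_one₀ (abs_nonneg _) (by norm_num [abs_div])
  have h2 : (1 : ℝ) ≤ k.factorial := by exact_mod_cast Nat.succ_le_of_lt k.factorial_pos
  rw [div_le_one (by linarith)]
  linarith

lemma abs_beta_le (k : ℕ) : |beta k| ≤ 2 := by
  induction k with
  | zero => simp [beta]
  | succ k ih =>
    rw [beta, abs_div, abs_neg]
    have h1 : (1 : ℝ) ≤ |(k : ℝ) + 1| := by
      rw [abs_of_nonneg (by positivity)]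
      linarith [Nat.cast_nonneg (α := ℝ) k]
    rw [div_le_iff₀ (by linarith)]
    have h2 := abs_add_le (beta k / 4) (alpha (k + 1))
    have h3 := abs_alpha_le (k + 1)
    rw [abs_div, abs_of_pos (by norm_num : (0 : ℝ) < 4)] at h2
    linarith

lemma alpha_succ (k : ℕ) : 4 * ((k + 1) * alpha (k + 1)) + alpha k = 0 := by
  have : ((k : ℝ) + 1) ≠ 0 := by positivity
  have : (k.factorial : ℝ) ≠ 0 := by positivity
  simp only [alpha, Nat.factorial_succ, pow_succ]
  push_cast
  field_simp
  ring

lemma beta_succ (k : ℕ) :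
    4 * ((k + 1) * beta (k + 1)) + beta k + 4 * alpha (k + 1) = 0 := by
  have : ((k : ℝ) + 1) ≠ 0 := by positivity
  rw [beta]
  field_simp
  ring

/-- The regular radial solution, as a function of the squared radius. -/
noncomputable def fa : ℝ → ℝ := egf alpha
/-- The derivative of `fa`. -/
noncomputable def fa1 : ℝ → ℝ := egf fun k => alpha (k + 1)
/-- The regular part of the logarithmic solution, as a function of the squared radius. -/
noncomputable def fb : ℝ → ℝ := egf beta
/-- The derivative of `fb`. -/
noncomputable def fb1 : ℝ → ℝ := egf fun k => beta (k + 1)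

lemma contDiff_fa : ContDiff ℝ (⊤ : ℕ∞) fa := contDiff_egf abs_alpha_le
lemma contDiff_fa1 : ContDiff ℝ (⊤ : ℕ∞) fa1 := contDiff_egf fun k => abs_alpha_le (k + 1)
lemma contDiff_fb : ContDiff ℝ (⊤ : ℕ∞) fb := contDiff_egf abs_beta_le
lemma contDiff_fb1 : ContDiff ℝ (⊤ : ℕ∞) fb1 := contDiff_egf fun k => abs_beta_le (k + 1)

lemma fa_zero : fa 0 = 1 := by simp [fa, egf_zero, alpha]

lemma hasDerivAt_fa (s : ℝ) : HasDerivAt fa (fa1 s) s := hasDerivAt_egf abs_alpha_le s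
lemma hasDerivAt_fb (s : ℝ) : HasDerivAt fb (fb1 s) s := hasDerivAt_egf abs_beta_le s

lemma hasDerivAt_mul_fa1 (s : ℝ) : HasDerivAt (fun s => s * fa1 s) (-fa s / 4) s := by
  have h1 := (hasDerivAt_id s).mul (hasDerivAt_egf (γ := fun k => alpha (k + 1))
    (fun k => abs_alpha_le (k + 1)) s)
  refine h1.congr_deriv ?_
  have h2 := ((mul_egf_shift_two_add abs_alpha_le s).mul_left 4).add
    (egf_summable abs_alpha_le s).hasSum
  have h3 : HasSum (fun _ : ℕ => (0 : ℝ)) _ := h2.congr_fun fun k => by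
    linear_combination (-(s ^ k / k.factorial)) * alpha_succ k
  have h4 := h3.unique hasSum_zero
  change 4 * (s * egf (fun k => alpha (k + 1 + 1)) s + fa1 s) + fa s = 0 at h4
  simp only [id, one_mul]
  change fa1 s + _ = _
  linarith

lemma hasDerivAt_mul_fb1 (s : ℝ) :
    HasDerivAt (fun s => s * fb1 s) (-fb s / 4 - fa1 s) s := by
  have h1 := (hasDerivAt_id s).mul (hasDerivAt_egf (γ := fun k => beta (k + 1))
    (fun k => abs_beta_le (k + 1)) s)
  refine h1.congr_deriv ?_
  have h2 := (((mul_egf_shift_two_add abs_beta_le s).mul_left 4).add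
    (egf_summable abs_beta_le s).hasSum).add
    ((egf_summable (γ := fun k => alpha (k + 1)) (fun k => abs_alpha_le (k + 1)) s).hasSum.mul_left 4)
  have h3 : HasSum (fun _ : ℕ => (0 : ℝ)) _ := h2.congr_fun fun k => by
    linear_combination (-(s ^ k / k.factorial)) * beta_succ k
  have h4 := h3.unique hasSum_zero
  change 4 * (s * egf (fun k => beta (k + 1 + 1)) s + fb1 s) + fb s + 4 * fa1 s = 0 at h4
  simp only [id, one_mul]
  change fb1 s + _ = _
  linarith

/-- The logarithmic radial solution, as a function of the squared radius. -/
noncomputable def ph (s : ℝ) : ℝ := Real.log s / 2 * fa s + fb s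
/-- The derivative of `ph`. -/
noncomputable def ph1 (s : ℝ) : ℝ := fa s / (2 * s) + Real.log s / 2 * fa1 s + fb1 s

lemma hasDerivAt_ph {s : ℝ} (hs : s ≠ 0) : HasDerivAt ph (ph1 s) s := by
  refine ((((Real.hasDerivAt_log hs).div_const 2).mul (hasDerivAt_fa s)).add
    (hasDerivAt_fb s)).congr_deriv ?_
  rw [ph1]
  field_simp

lemma hasDerivAt_mul_ph1 {s : ℝ} (hs : s ≠ 0) :
    HasDerivAt (fun s => s * ph1 s) (-ph s / 4) s := by
  have h1 := (((hasDerivAt_fa s).div_const 2).add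
    (((Real.hasDerivAt_log hs).div_const 2).mul (hasDerivAt_mul_fa1 s))).add (hasDerivAt_mul_fb1 s)
  have h2 : (fun s => s * ph1 s) =ᶠ[𝓝 s]
      (fun s => fa s / 2) + ((fun s => Real.log s / 2) * fun s => s * fa1 s) +
        fun s => s * fb1 s := by
    filter_upwards [isOpen_ne.mem_nhds hs] with x hx
    have hx' : x ≠ 0 := hx
    simp only [ph1, Pi.add_apply, Pi.mul_apply]
    field_simp
  refine (h1.congr_of_eventuallyEq h2).congr_deriv ?_
  rw [ph]
  field_simp
  ring

lemma contDiffAt_ph {s : ℝ} (hs : s ≠ 0) : ContDiffAt ℝ (⊤ : ℕ∞) ph s :=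
  (((contDiffAt_id.log hs).div_const 2).mul contDiff_fa.contDiffAt).add contDiff_fb.contDiffAt

end Payne

namespace Payne

open Filter Topology Set

/-- The regular radial solution. -/
noncomputable def jj (r : ℝ) : ℝ := fa (r ^ 2)
/-- The logarithmic radial derivative `r * jj' r`. -/
noncomputable def XJ (r : ℝ) : ℝ := 2 * (r ^ 2 * fa1 (r ^ 2))
/-- The logarithmic radial solution. -/
noncomputable def gg (r : ℝ) : ℝ := ph (r ^ 2)
/-- The logarithmic radial derivative `r * gg' r`. -/
noncomputable def XG (r : ℝ) : ℝ := 2 * (r ^ 2 * ph1 (r ^ 2))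

lemma hasDerivAt_sq (r : ℝ) : HasDerivAt (fun r : ℝ => r ^ 2) (2 * r) r := by
  simpa using hasDerivAt_pow 2 r

lemma hasDerivAt_jj (r : ℝ) : HasDerivAt jj (XJ r / r) r := by
  refine ((hasDerivAt_fa (r ^ 2)).comp r (hasDerivAt_sq r)).congr_deriv ?_
  rcases eq_or_ne r 0 with rfl | hr
  · simp
  · rw [XJ]
    field_simp

lemma hasDerivAt_XJ (r : ℝ) : HasDerivAt XJ (-r * jj r) r := by
  refine (((hasDerivAt_mul_fa1 (r ^ 2)).comp r (hasDerivAt_sq r)).const_mul 2).congr_deriv ?_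
  rw [jj]
  ring

lemma hasDerivAt_gg {r : ℝ} (hr : r ≠ 0) : HasDerivAt gg (XG r / r) r := by
  have h : r ^ 2 ≠ 0 := pow_ne_zero 2 hr
  refine (HasDerivAt.comp (h := fun r : ℝ => r ^ 2) (h₂ := ph) r (hasDerivAt_ph h) (hasDerivAt_sq r)).congr_deriv ?_
  rw [XG]
  field_simp

lemma hasDerivAt_XG {r : ℝ} (hr : r ≠ 0) : HasDerivAt XG (-r * gg r) r := by
  have h : r ^ 2 ≠ 0 := pow_ne_zero 2 hr
  refine ((HasDerivAt.comp (h := fun r : ℝ => r ^ 2) (h₂ := fun s => s * ph1 s) r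
    (hasDerivAt_mul_ph1 h) (hasDerivAt_sq r)).const_mul 2).congr_deriv ?_
  rw [gg]
  ring

lemma jj_zero : jj 0 = 1 := by simp [jj, fa_zero]
lemma XJ_zero : XJ 0 = 0 := by simp [XJ]

lemma continuous_jj : Continuous jj :=
  continuous_iff_continuousAt.2 fun r => (hasDerivAt_jj r).continuousAt
lemma continuous_XJ : Continuous XJ :=
  continuous_iff_continuousAt.2 fun r => (hasDerivAt_XJ r).continuousAt

/-- A function which is continuous on `[a, b)`-type intervals and has zero derivative is constant. -/
lemma eq_of_deriv_zero {f : ℝ → ℝ} {a b : ℝ} (hab : a ≤ b) (hc : ContinuousOn f (Icc a b))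
    (hd : ∀ x ∈ Ioo a b, HasDerivAt f 0 x) : f b = f a := by
  rcases hab.eq_or_lt with rfl | hlt
  · rfl
  obtain ⟨c, _, hc'⟩ := exists_hasDerivAt_eq_slope f (fun _ => 0) hlt hc hd
  have : b - a ≠ 0 := by linarith
  field_simp at hc'
  linarith

/-- The Wronskian identity. -/
lemma wronskian {r : ℝ} (hr : 0 < r) : jj r * XG r - gg r * XJ r = 1 := by
  set w : ℝ → ℝ := fun r => jj r ^ 2 + jj r * (2 * (r ^ 2 * fb1 (r ^ 2))) - fb (r ^ 2) * XJ r
    with hw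
  have e : ∀ x : ℝ, x ≠ 0 → jj x * XG x - gg x * XJ x = w x := by
    intro x hx
    simp only [hw, XG, gg, ph, ph1, XJ, jj]
    field_simp
    ring
  have hcw : Continuous w := by
    have h1 := contDiff_fb1.continuous
    have h2 := contDiff_fb.continuous
    have h3 := continuous_jj
    have h4 := continuous_XJ
    fun_prop
  have h0 : w r = w 0 := by
    refine eq_of_deriv_zero hr.le hcw.continuousOn fun x hx => ?_
    have hx0 : x ≠ 0 := hx.1.ne'
    have hd := ((hasDerivAt_jj x).mul (hasDerivAt_XG hx0)).sub
      ((hasDerivAt_gg hx0).mul (hasDerivAt_XJ x))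
    refine (hd.congr_of_eventuallyEq ?_).congr_deriv ?_
    · filter_upwards [isOpen_ne.mem_nhds hx0] with y hy
      exact (e y hy).symm
    · field_simp
      ring
  rw [e r hr.ne', h0]
  simp [hw, jj_zero, XJ_zero]

/-- A radial solution cannot stay positive on a half-line. -/
lemma exists_nonpos {p X : ℝ → ℝ} {r₀ : ℝ} (hr₀ : 0 < r₀)
    (hp : ∀ r, r₀ ≤ r → HasDerivAt p (X r / r) r)
    (hX : ∀ r, r₀ ≤ r → HasDerivAt X (-r * p r) r) : ∃ r, r₀ < r ∧ p r ≤ 0 := by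
  by_contra! hpos
  have hXanti : AntitoneOn X (Ici (r₀ + 1)) := by
    refine antitoneOn_of_deriv_nonpos (convex_Ici _) (fun x hx => ?_) (fun x hx => ?_)
      fun x hx => ?_
    · exact (hX x (by linarith [mem_Ici.1 hx])).continuousAt.continuousWithinAt
    · rw [interior_Ici] at hx
      exact (hX x (by linarith [mem_Ioi.1 hx])).differentiableAt.differentiableWithinAt
    · rw [interior_Ici] at hx
      have hx' : r₀ + 1 < x := hx
      rw [(hX x (by linarith)).deriv]
      nlinarith [hpos x (by linarith)]
  by_cases hneg : ∃ r, r₀ + 1 ≤ r ∧ X r < 0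
  · obtain ⟨r₂, hr₂, hX₂⟩ := hneg
    have hr₂0 : 0 < r₂ := by linarith
    have hanti : AntitoneOn (fun r => p r - X r₂ * Real.log r) (Ici r₂) := by
      have hd : ∀ x, r₂ ≤ x → HasDerivAt (fun r => p r - X r₂ * Real.log r)
          (X x / x - X r₂ * x⁻¹) x := fun x hx =>
        (hp x (by linarith)).sub ((Real.hasDerivAt_log (by linarith)).const_mul _)
      refine antitoneOn_of_deriv_nonpos (convex_Ici _) (fun x hx => ?_) (fun x hx => ?_)
        fun x hx => ?_
      · exact (hd x hx).continuousAt.continuousWithinAt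
      · rw [interior_Ici] at hx
        exact (hd x (le_of_lt hx)).differentiableAt.differentiableWithinAt
      · rw [interior_Ici] at hx
        have hx' : r₂ < x := hx
        rw [(hd x hx'.le).deriv, div_eq_mul_inv, ← sub_mul]
        have h1 := hXanti (mem_Ici.2 hr₂) (mem_Ici.2 (by linarith : r₀ + 1 ≤ x)) hx'.le
        have h2 : 0 < x⁻¹ := inv_pos.2 (by linarith)
        nlinarith
    have hlog := Real.tendsto_log_atTop
    obtain ⟨r, hr1, hr2⟩ := ((hlog.eventually_ge_atTop
      (Real.log r₂ + p r₂ / (-X r₂))).and (eventually_ge_atTop r₂)).exists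
    have h3 := hanti (mem_Ici.2 le_rfl) (mem_Ici.2 hr2) hr2
    have h4 := hpos r (by linarith)
    simp only at h3
    have h5 : (-X r₂) * (p r₂ / (-X r₂)) = p r₂ :=
      mul_div_cancel₀ _ (by linarith : -X r₂ ≠ 0)
    nlinarith
  · push Not at hneg
    have hmono : MonotoneOn p (Ici (r₀ + 1)) := by
      refine monotoneOn_of_deriv_nonneg (convex_Ici _) (fun x hx => ?_) (fun x hx => ?_)
        fun x hx => ?_
      · exact (hp x (by linarith [mem_Ici.1 hx])).continuousAt.continuousWithinAt
      · rw [interior_Ici] at hx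
        exact (hp x (by linarith [mem_Ioi.1 hx])).differentiableAt.differentiableWithinAt
      · rw [interior_Ici] at hx
        have hx' : r₀ + 1 < x := hx
        rw [(hp x (by linarith)).deriv]
        exact div_nonneg (hneg x hx'.le) (by linarith)
    set c := p (r₀ + 1) with hc
    have hc0 : 0 < c := hpos _ (by linarith)
    have hanti : AntitoneOn (fun r => X r + c * r) (Ici (r₀ + 1)) := by
      have hd : ∀ x, r₀ + 1 ≤ x → HasDerivAt (fun r => X r + c * r) (-x * p x + c * 1) x :=
        fun x hx => (hX x (by linarith)).add ((hasDerivAt_id x).const_mul c)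
      refine antitoneOn_of_deriv_nonpos (convex_Ici _) (fun x hx => ?_) (fun x hx => ?_)
        fun x hx => ?_
      · exact (hd x hx).continuousAt.continuousWithinAt
      · rw [interior_Ici] at hx
        exact (hd x (le_of_lt hx)).differentiableAt.differentiableWithinAt
      · rw [interior_Ici] at hx
        have hx' : r₀ + 1 < x := hx
        rw [(hd x hx'.le).deriv]
        have := hmono (mem_Ici.2 le_rfl) (mem_Ici.2 hx'.le) hx'.le
        nlinarith
    set r := r₀ + 1 + (|X (r₀ + 1)| + 1) / c with hr
    have h6 : 0 < (|X (r₀ + 1)| + 1) / c := by positivity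
    have h3 := hanti (mem_Ici.2 le_rfl) (mem_Ici.2 (by linarith : r₀ + 1 ≤ r)) (by linarith)
    have h4 := hneg r (by linarith)
    simp only at h3
    have h5 : c * ((|X (r₀ + 1)| + 1) / c) = |X (r₀ + 1)| + 1 := by field_simp
    have h7 : c * r = c * (r₀ + 1) + (|X (r₀ + 1)| + 1) := by rw [hr, mul_add, h5]
    have := le_abs_self (X (r₀ + 1))
    linarith

/-- A continuous function positive just after `a` and nonpositive somewhere has a first zero. -/
lemma exists_first_zero {p : ℝ → ℝ} {a b : ℝ} (hab : a < b) (hc : ContinuousOn p (Icc a b))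
    (ha : ∀ᶠ r in 𝓝[>] a, 0 < p r) (hb : p b ≤ 0) :
    ∃ c, a < c ∧ c ≤ b ∧ p c = 0 ∧ ∀ r ∈ Ioo a c, 0 < p r := by
  obtain ⟨a', haa', ha'⟩ := (mem_nhdsGT_iff_exists_Ioo_subset).1 ha
  have haa' : a < a' := haa'
  set m := (a + min a' b) / 2 with hm
  have hm0 : a < min a' b := lt_min haa' hab
  have hma' : m < a' := by linarith [min_le_left a' b]
  have hmb : m < b := by linarith [min_le_right a' b]
  have ham : a < m := by linarith
  set Z := {r | r ∈ Icc m b ∧ p r ≤ 0} with hZ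
  have hZc : IsCompact Z := by
    have h : IsClosed Z := by
      have : Z = Icc m b ∩ p ⁻¹' Iic 0 := rfl
      rw [this]
      exact (hc.mono (Icc_subset_Icc ham.le le_rfl)).preimage_isClosed_of_isClosed isClosed_Icc
        isClosed_Iic
    exact isCompact_Icc.of_isClosed_subset h fun r hr => hr.1
  obtain ⟨c, hcZ, hcmin⟩ := hZc.exists_isLeast ⟨b, ⟨hmb.le, le_rfl⟩, hb⟩
  have hpm : 0 < p m := ha' ⟨ham, hma'⟩
  have hmc : m < c := lt_of_le_of_ne hcZ.1.1 (by rintro h; rw [← h] at hcZ; linarith [hcZ.2])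
  have hpos : ∀ r ∈ Ioo a c, 0 < p r := by
    intro r hr
    by_cases hrm : r < a'
    · exact ha' ⟨hr.1, hrm⟩
    · by_contra hneg
      have : c ≤ r := hcmin ⟨⟨by linarith, by linarith [hr.2, hcZ.1.2]⟩, by linarith⟩
      linarith [hr.2]
  refine ⟨c, by linarith, hcZ.1.2, le_antisymm hcZ.2 ?_, hpos⟩
  have hcc : ContinuousWithinAt p (Icc a b) c := hc c ⟨by linarith, hcZ.1.2⟩
  have h1 : Tendsto p (𝓝[Ioo m c] c) (𝓝 (p c)) :=
    hcc.mono_left (nhdsWithin_mono _ fun x hx => ⟨by linarith [hx.1], by linarith [hx.2, hcZ.1.2]⟩)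
  have : (𝓝[Ioo m c] c).NeBot := right_nhdsWithin_Ioo_neBot hmc
  refine ge_of_tendsto h1 ?_
  filter_upwards [self_mem_nhdsWithin] with x hx
  exact (hpos x ⟨by linarith [hx.1], hx.2⟩).le

/-- The first positive zero of `jj`. -/
lemma exists_rho : ∃ ρ, 0 < ρ ∧ jj ρ = 0 ∧ XJ ρ < 0 ∧ ∀ r ∈ Ico 0 ρ, 0 < jj r := by
  obtain ⟨b, hb1, hb⟩ := exists_nonpos one_pos (fun r _ => hasDerivAt_jj r)
    (fun r _ => hasDerivAt_XJ r)
  have h0 : ∀ᶠ r in 𝓝[>] (0 : ℝ), 0 < jj r := by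
    refine nhdsWithin_le_nhds (continuous_jj.continuousAt.eventually (lt_mem_nhds ?_))
    rw [jj_zero]
    exact one_pos
  obtain ⟨c, hc0, hcb, hc, hpos⟩ := exists_first_zero (by linarith : (0 : ℝ) < b)
    continuous_jj.continuousOn h0 hb
  refine ⟨c, hc0, hc, ?_, fun r hr => ?_⟩
  · have := exists_hasDerivAt_eq_slope XJ (fun r => -r * jj r) hc0 continuous_XJ.continuousOn
      fun x _ => hasDerivAt_XJ x
    obtain ⟨x, hx, he⟩ := this
    rw [XJ_zero, sub_zero, sub_zero, eq_div_iff hc0.ne'] at he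
    rw [← he]
    have := mul_pos (mul_pos hx.1 (hpos x hx)) hc0
    linarith
  · rcases hr.1.eq_or_lt with h | h
    · rw [← h, jj_zero]
      exact one_pos
    · exact hpos r ⟨h, hr.2⟩

/-- The radial solution vanishing on the circle of radius `R`. -/
noncomputable def Phi (R r : ℝ) : ℝ := jj R * gg r - gg R * jj r
/-- The logarithmic radial derivative of `Phi`. -/
noncomputable def XPhi (R r : ℝ) : ℝ := jj R * XG r - gg R * XJ r

lemma hasDerivAt_Phi (R : ℝ) {r : ℝ} (hr : r ≠ 0) : HasDerivAt (Phi R) (XPhi R r / r) r := by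
  refine (((hasDerivAt_gg hr).const_mul _).sub ((hasDerivAt_jj r).const_mul _)).congr_deriv ?_
  rw [XPhi]
  ring

lemma hasDerivAt_XPhi (R : ℝ) {r : ℝ} (hr : r ≠ 0) : HasDerivAt (XPhi R) (-r * Phi R r) r := by
  refine (((hasDerivAt_XG hr).const_mul _).sub ((hasDerivAt_XJ r).const_mul _)).congr_deriv ?_
  rw [Phi]
  ring

lemma Phi_self (R : ℝ) : Phi R R = 0 := by rw [Phi]; ring
lemma XPhi_self {R : ℝ} (hR : 0 < R) : XPhi R R = 1 := by
  rw [XPhi]; linarith [wronskian hR]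

/-- The Wronskian of `Phi` and `jj`. -/
lemma XPhi_mul_jj_sub (R : ℝ) {r : ℝ} (hr : 0 < r) :
    XPhi R r * jj r - Phi R r * XJ r = jj R := by
  rw [XPhi, Phi]
  linear_combination jj R * wronskian hr

/-- If the derivative at a zero is positive, the function is positive to the right. -/
lemma eventually_pos_right {p : ℝ → ℝ} {p' a : ℝ} (hd : HasDerivAt p p' a) (h0 : p a = 0)
    (hp : 0 < p') : ∀ᶠ r in 𝓝[>] a, 0 < p r := by
  have h1 := (hasDerivAt_iff_tendsto_slope.1 hd).eventually (lt_mem_nhds hp)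
  have h2 : 𝓝[>] a ≤ 𝓝[≠] a := nhdsWithin_mono _ fun x hx => ne_of_gt hx
  filter_upwards [h2 h1, self_mem_nhdsWithin] with r hr har
  have har : a < r := har
  rw [slope_def_field, h0, sub_zero] at hr
  exact (div_pos_iff_of_pos_right (by linarith)).1 hr

/-- The next zero of `Phi R`. -/
lemma exists_R2 {R : ℝ} (hR : 0 < R) (hj : jj R < 0) :
    ∃ c, R < c ∧ Phi R c = 0 ∧ XPhi R c < 0 ∧ 0 < jj c ∧ ∀ r ∈ Ioo R c, 0 < Phi R r := by
  have hne : ∀ r, R ≤ r → r ≠ 0 := fun r hr => by linarith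
  obtain ⟨b, hb1, hb⟩ := exists_nonpos hR (fun r hr => hasDerivAt_Phi R (hne r hr))
    (fun r hr => hasDerivAt_XPhi R (hne r hr))
  have h0 : ∀ᶠ r in 𝓝[>] R, 0 < Phi R r :=
    eventually_pos_right (hasDerivAt_Phi R hR.ne') (Phi_self R) (by rw [XPhi_self hR]; positivity)
  obtain ⟨c, hc0, hcb, hc, hpos⟩ := exists_first_zero hb1
    (fun r hr => (hasDerivAt_Phi R (hne r hr.1)).continuousAt.continuousWithinAt) h0 hb
  have hc1 : 0 < c := hR.trans hc0
  have hw := XPhi_mul_jj_sub R hc1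
  rw [hc, zero_mul, sub_zero] at hw
  have hXle : XPhi R c ≤ 0 := by
    by_contra h
    push Not at h
    have h2 := eventually_pos_right (p := fun r => -Phi R (-r)) (a := -c)
      (p' := XPhi R c / c) ?_ (by simp [hc]) (by positivity)
    · have h3 : ∀ᶠ r in 𝓝[>] (-c), r < -R :=
        nhdsWithin_le_nhds (gt_mem_nhds (by linarith))
      obtain ⟨r, hr1, hr2, hr3⟩ := (h2.and (h3.and self_mem_nhdsWithin)).exists
      have hr3 : -c < r := hr3
      linarith [hpos (-r) ⟨by linarith, by linarith⟩]
    · have hd := hasDerivAt_Phi R hc1.ne'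
      rw [← neg_neg c] at hd
      have := (hd.comp (-c) (hasDerivAt_neg (-c))).neg
      rw [neg_neg] at this
      exact this.congr_deriv (by ring)
  have hXne : XPhi R c ≠ 0 := by
    intro h
    rw [h, zero_mul] at hw
    linarith
  have hX : XPhi R c < 0 := lt_of_le_of_ne hXle hXne
  refine ⟨c, hc0, hc, hX, ?_, hpos⟩
  by_contra h
  push Not at h
  nlinarith

end Payne

namespace Payne

open Filter Topology Set

/-- `ω` is a subsolution on `[a, b]` of the Riccati equation with angular parameter `κ`. -/
def Ricc (κ : ℝ) (ω : ℝ → ℝ) (a b : ℝ) : Prop :=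
  ContinuousOn ω (Icc a b) ∧ ∃ ω' : ℝ → ℝ, ∀ r ∈ Ioo a b,
    HasDerivAt ω (ω' r) r ∧ r * ω' r + ω r ^ 2 + r ^ 2 ≤ κ

/-- Logarithmic derivatives of positive supersolutions are Riccati subsolutions. -/
lemma ricc_of_pos {κ a b : ℝ} {p X X' : ℝ → ℝ}
    (hpc : ContinuousOn p (Icc a b)) (hXc : ContinuousOn X (Icc a b))
    (hp : ∀ r ∈ Icc a b, 0 < p r)
    (hd : ∀ r ∈ Ioo a b, r ≠ 0 ∧ HasDerivAt p (X r / r) r ∧ HasDerivAt X (X' r) r ∧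
      r * X' r ≤ (κ - r ^ 2) * p r) : Ricc κ (fun r => X r / p r) a b := by
  refine ⟨hXc.div hpc fun r hr => (hp r hr).ne', fun r => (X' r * p r - X r * (X r / r)) / p r ^ 2,
    fun r hr => ?_⟩
  obtain ⟨h0, h1, h2, h3⟩ := hd r hr
  have hpr := hp r ⟨hr.1.le, hr.2.le⟩
  refine ⟨h2.div h1 hpr.ne', ?_⟩
  have e : r * ((X' r * p r - X r * (X r / r)) / p r ^ 2) + (X r / p r) ^ 2 + r ^ 2
      = r * X' r / p r + r ^ 2 := by
    field_simp
    ring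
  rw [e]
  have := (div_le_iff₀ hpr).2 h3
  linarith

/-- A nonnegative function can be made positive by adding a small multiple of a function which is
positive on its zero set. -/
lemma exists_eta {K : Set ℝ} (hK : IsCompact K) {p f : ℝ → ℝ} (hp : ContinuousOn p K)
    (hf : ContinuousOn f K) (h0 : ∀ r ∈ K, 0 ≤ p r) (h1 : ∀ r ∈ K, p r = 0 → 0 < f r) :
    ∃ η₀ > 0, ∀ η, 0 < η → η ≤ η₀ → ∀ r ∈ K, 0 < p r + η * f r := by
  set Z := K ∩ f ⁻¹' Iic 0 with hZ
  have hZc : IsCompact Z := by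
    refine hK.of_isClosed_subset (hf.preimage_isClosed_of_isClosed hK.isClosed isClosed_Iic)
      inter_subset_left
  have hZp : ∃ m > 0, ∀ r ∈ Z, m ≤ p r := by
    rcases Z.eq_empty_or_nonempty with h | h
    · exact ⟨1, one_pos, by simp [h]⟩
    · obtain ⟨x, hx, hmin⟩ := hZc.exists_isMinOn h (hp.mono inter_subset_left)
      refine ⟨p x, (h0 x hx.1).lt_of_ne fun h => ?_, fun r hr => hmin hr⟩
      have h3 : f x ≤ 0 := hx.2
      linarith [h1 x hx.1 h.symm]
  obtain ⟨m, hm, hmZ⟩ := hZp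
  obtain ⟨J, hJ⟩ := hK.exists_bound_of_continuousOn hf
  have hJ1 : 0 < |J| + 1 := by positivity
  refine ⟨m / (|J| + 1), by positivity, fun η hη hη' r hr => ?_⟩
  by_cases hfr : f r ≤ 0
  · have h2 := hmZ r ⟨hr, hfr⟩
    have h3 := (abs_le.1 (hJ r hr)).1
    have h4 : η * (|J| + 1) ≤ m := by
      rwa [le_div_iff₀ hJ1] at hη'
    have h5 : -|J| ≤ f r := by linarith [le_abs_self J]
    nlinarith
  · push Not at hfr
    have := h0 r hr
    positivity

/-- The radii and the Riccati subsolutions used in the construction. -/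
structure Data (κ : ℝ) where
  (r1 s R r2 R3 b0 : ℝ)
  r1_pos : 0 < r1
  r1_lt : r1 < s
  s_lt : s < R
  R_lt : R < r2
  r2_lt : r2 < R3
  b0_pos : 0 < b0
  jj_r1 : 0 < jj r1
  jj_neg : ∀ r ∈ Icc s r2, jj r < 0
  Phi_pos : ∀ r ∈ Ioc R r2, 0 < Phi R r
  Phi_R3 : Phi R R3 < 0
  (wA wB wC wD zA zC : ℝ → ℝ)
  ricc_wA : Ricc 0 wA 0 r1
  ricc_wB : Ricc 0 wB r1 R
  ricc_wC : Ricc 0 wC R r2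
  ricc_wD : Ricc 0 wD r2 R3
  ricc_zA : Ricc κ zA 0 R
  ricc_zC : Ricc κ zC R R3
  wA_zero : wA 0 = 0
  zA_zero : zA 0 = 0
  le_wB : ∀ r ∈ Icc r1 R, -b0 ≤ wB r
  le_zA : ∀ r ∈ Icc r1 R, -b0 ≤ zA r
  wC_le : ∀ r ∈ Icc R r2, wC r ≤ b0
  zC_le : ∀ r ∈ Icc R r2, zC r ≤ b0

lemma continuousOn_Phi {R : ℝ} {I : Set ℝ} (hI : ∀ r ∈ I, 0 < r) : ContinuousOn (Phi R) I :=
  fun r hr => (hasDerivAt_Phi R (hI r hr).ne').continuousAt.continuousWithinAt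

lemma continuousOn_XPhi {R : ℝ} {I : Set ℝ} (hI : ∀ r ∈ I, 0 < r) : ContinuousOn (XPhi R) I :=
  fun r hr => (hasDerivAt_XPhi R (hI r hr).ne').continuousAt.continuousWithinAt

lemma exists_inner_radii {κ : ℝ} (hκ : 0 < κ) : ∃ c r1 s R r2 : ℝ, 0 < r1 ∧ r1 < s ∧ s < R ∧ R < r2 ∧
    (∀ r ∈ Icc 0 r1, 0 < jj r) ∧ (∀ r ∈ Icc s r2, jj r < 0) ∧ R * Real.log (R / r1) < 1 ∧
    0 < c ∧ (1 - c ^ 2) * R ^ 2 ≤ κ ∧ ∀ r ∈ Icc 0 R, 0 < jj (c * r) := by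
  obtain ⟨ρ, hρ, hj0, hX, hpos⟩ := exists_rho
  have h1 : ∀ᶠ r in 𝓝[>] ρ, 0 < -jj r :=
    eventually_pos_right (hasDerivAt_jj ρ).neg (by simp [hj0])
      (by rw [← neg_div]; exact div_pos (by linarith) hρ)
  obtain ⟨d, hd, hdneg⟩ := (mem_nhdsGT_iff_exists_Ioo_subset).1 h1
  have hd : ρ < d := hd
  -- the dilation factor
  obtain ⟨c, hc0, hc1, hcκ⟩ : ∃ c : ℝ, 0 < c ∧ c < 1 ∧ (1 - c ^ 2) * (ρ + 1) ^ 2 ≤ κ := by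
    have h2 : ∀ᶠ c in 𝓝[<] (1 : ℝ), (1 - c ^ 2) * (ρ + 1) ^ 2 < κ := by
      refine nhdsWithin_le_nhds (ContinuousAt.eventually_lt (by fun_prop) continuousAt_const ?_)
      simpa using hκ
    have h3 : ∀ᶠ c in 𝓝[<] (1 : ℝ), 0 < c := nhdsWithin_le_nhds (lt_mem_nhds one_pos)
    obtain ⟨c, hc, hc', hc''⟩ := (h2.and (h3.and self_mem_nhdsWithin)).exists
    exact ⟨c, hc', hc'', hc.le⟩
  -- the outer radius
  have hρc : ρ < ρ / c := by rw [lt_div_iff₀ hc0]; nlinarith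
  have h4 : ∀ᶠ R in 𝓝[>] ρ, R < d ∧ R < ρ + 1 ∧ R < ρ / c ∧ R * Real.log (R / ρ) < 1 := by
    have h5 : ∀ᶠ R in 𝓝 ρ, R * Real.log (R / ρ) < 1 := by
      refine ContinuousAt.eventually_lt ?_ continuousAt_const ?_
      · have : ρ / ρ ≠ 0 := by rw [div_self hρ.ne']; exact one_ne_zero
        exact continuousAt_id.mul ((continuousAt_id.div_const ρ).log this)
      · rw [div_self hρ.ne']; simp
    refine nhdsWithin_le_nhds ?_
    filter_upwards [gt_mem_nhds hd, gt_mem_nhds (by linarith : ρ < ρ + 1), gt_mem_nhds hρc, h5]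
      with R a b c d using ⟨a, b, c, d⟩
  obtain ⟨R, ⟨hRd, hR1, hRc, hRlog⟩, hρR⟩ := (h4.and self_mem_nhdsWithin).exists
  have hρR : ρ < R := hρR
  have h6 : ∀ᶠ r1 in 𝓝[<] ρ, 0 < r1 ∧ R * Real.log (R / r1) < 1 := by
    refine nhdsWithin_le_nhds ?_
    have h5 : ∀ᶠ r1 in 𝓝 ρ, R * Real.log (R / r1) < 1 := by
      refine ContinuousAt.eventually_lt ?_ continuousAt_const hRlog
      have : R / ρ ≠ 0 := (div_pos (hρ.trans hρR) hρ).ne'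
      exact continuousAt_const.mul ((continuousAt_const.div continuousAt_id hρ.ne').log this)
    filter_upwards [lt_mem_nhds hρ, h5] with r a b using ⟨a, b⟩
  obtain ⟨r1, ⟨hr10, hr1⟩, hr1ρ⟩ := (h6.and self_mem_nhdsWithin).exists
  have hr1ρ : r1 < ρ := hr1ρ
  refine ⟨c, r1, (ρ + R) / 2, R, (R + d) / 2, hr10, by linarith, by linarith, by linarith,
    fun r hr => hpos r ⟨hr.1, by linarith [hr.2]⟩, fun r hr => ?_, hr1, hc0, ?_, fun r hr => ?_⟩
  · have : 0 < -jj r := hdneg ⟨by linarith [hr.1], by linarith [hr.2]⟩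
    linarith
  · have : (0 : ℝ) ≤ 1 - c ^ 2 := by nlinarith
    have h7 : R ^ 2 ≤ (ρ + 1) ^ 2 := by
      have : 0 < R := hρ.trans hρR
      gcongr
    nlinarith
  · refine hpos _ ⟨mul_nonneg hc0.le hr.1, ?_⟩
    rw [lt_div_iff₀ hc0] at hRc
    nlinarith [hr.2]

/-- The auxiliary parabola in logarithmic coordinates. -/
noncomputable def chi (K α γ r : ℝ) : ℝ := 1 / K + (Real.log r - α) * (γ - Real.log r)

set_option maxHeartbeats 1000000 in
lemma exists_data {κ : ℝ} (hκ : 0 < κ) : Nonempty (Data κ) := by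
  obtain ⟨c, r1, s, R, r2', hr1, hr1s, hsR, hRr2', hjA, hjneg', hlog, hc, hcκ, hjc⟩ :=
    exists_inner_radii hκ
  have hR : 0 < R := by linarith
  obtain ⟨R2, hRR2, hPR2, hXR2, hjR2, hPpos⟩ := exists_R2 hR (hjneg' R ⟨hsR.le, hRr2'.le⟩)
  -- choice of `r2`
  set r2 := (R + min r2' R2) / 2 with hr2
  have hmin : R < min r2' R2 := lt_min hRr2' hRR2
  have hRr2 : R < r2 := by linarith
  have hr2r2' : r2 < r2' := by linarith [min_le_left r2' R2]
  have hr2R2 : r2 < R2 := by linarith [min_le_right r2' R2]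
  have hjneg : ∀ r ∈ Icc s r2, jj r < 0 := fun r hr => hjneg' r ⟨hr.1, by linarith [hr.2]⟩
  have hPnn : ∀ r ∈ Icc R R2, 0 ≤ Phi R r := fun r hr => by
    rcases hr.1.eq_or_lt with h | h
    · rw [← h, Phi_self]
    rcases hr.2.eq_or_lt with h' | h'
    · rw [h', hPR2]
    · exact (hPpos r ⟨h, h'⟩).le
  have hP0 : ∀ r ∈ Icc R R2, Phi R r = 0 → r = R ∨ r = R2 := fun r hr h => by
    by_contra! hne
    exact (hPpos r ⟨lt_of_le_of_ne hr.1 hne.1.symm, lt_of_le_of_ne hr.2 hne.2⟩).ne' h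
  have hR2 : 0 < R2 := by linarith
  set K := R2 ^ 2 with hK
  have hK0 : 0 < K := by positivity
  set α := Real.log R with hα
  set γ := Real.log R2 with hγ
  have hlogc : ∀ r : ℝ, 0 < r → ContinuousAt Real.log r := fun r hr =>
    Real.continuousAt_log hr.ne'
  have hlogon : ∀ {I : Set ℝ}, (∀ r ∈ I, 0 < r) → ContinuousOn Real.log I := fun h r hr =>
    (hlogc r (h r hr)).continuousWithinAt
  have hchic : ∀ r : ℝ, 0 < r → ContinuousAt (chi K α γ) r := fun r hr =>
    continuousAt_const.add (((hlogc r hr).sub continuousAt_const).mul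
      (continuousAt_const.sub (hlogc r hr)))
  set f : ℝ → ℝ := fun r => (2 + (κ - r ^ 2) * chi K α γ r) / κ with hf
  have hfc : ∀ r : ℝ, 0 < r → ContinuousAt f r := fun r hr =>
    (continuousAt_const.add ((by fun_prop : ContinuousAt (fun r : ℝ => κ - r ^ 2) r).mul
      (hchic r hr))).div_const κ
  have hpos1 : ∀ r ∈ Icc R R2, 0 < r := fun r hr => by linarith [hr.1]
  have hpos2 : ∀ r ∈ Icc r2 R2, 0 < r := fun r hr => by linarith [hr.1]
  have hchiR : chi K α γ R = 1 / K := by simp [chi, hα]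
  have hchiR2 : chi K α γ R2 = 1 / K := by simp [chi, hγ]
  have hfpos : ∀ r ∈ Icc R R2, chi K α γ r = 1 / K → 0 < f r := by
    intro r hr h
    simp only [hf, h]
    refine div_pos ?_ hκ
    have h1 : r ^ 2 ≤ K := by
      have h0 := hpos1 r hr
      rw [hK]
      exact pow_le_pow_left₀ h0.le hr.2 2
    have h2 : r ^ 2 * (1 / K) ≤ 1 := by
      rw [mul_one_div, div_le_one hK0]; exact h1
    have h3 : 0 < κ * (1 / K) := by positivity
    linarith
  obtain ⟨η1, hη1, h_η1⟩ := exists_eta isCompact_Icc (continuousOn_Phi hpos2)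
    (continuous_jj.continuousOn) (fun r hr => hPnn r ⟨by linarith [hr.1], hr.2⟩) fun r hr h => by
      rcases hP0 r ⟨by linarith [hr.1], hr.2⟩ h with h' | h'
      · linarith [hr.1]
      · rwa [h']
  obtain ⟨η2, hη2, h_η2⟩ := exists_eta isCompact_Icc (continuousOn_Phi hpos1)
    (fun r hr => (hchic r (hpos1 r hr)).continuousWithinAt) hPnn fun r hr h => by
      rcases hP0 r hr h with h' | h' <;> subst h' <;> simp only [hchiR, hchiR2] <;> positivity
  obtain ⟨η3, hη3, h_η3⟩ := exists_eta isCompact_Icc (continuousOn_Phi hpos1)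
    (fun r hr => (hfc r (hpos1 r hr)).continuousWithinAt) hPnn fun r hr h => by
      refine hfpos r hr ?_
      rcases hP0 r hr h with h' | h' <;> subst h' <;> assumption
  set η := min η1 (min η2 η3) with hη
  have hη0 : 0 < η := lt_min hη1 (lt_min hη2 hη3)
  replace h_η1 := h_η1 η hη0 (min_le_left _ _)
  replace h_η2 := h_η2 η hη0 ((min_le_right _ _).trans (min_le_left _ _))
  replace h_η3 := h_η3 η hη0 ((min_le_right _ _).trans (min_le_right _ _))
  -- choice of `R3`
  have hPc : ContinuousAt (Phi R) R2 := (hasDerivAt_Phi R hR2.ne').continuousAt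
  have hev : ∀ᶠ r in 𝓝 R2, 0 < Phi R r + η * jj r ∧ 0 < Phi R r + η * chi K α γ r ∧
      0 < Phi R r + η * f r := by
    have e : R2 ∈ Icc R R2 := ⟨hRR2.le, le_rfl⟩
    refine ((hPc.add (continuous_jj.continuousAt.const_mul η)).eventually
      (lt_mem_nhds (h_η1 R2 ⟨hr2R2.le, le_rfl⟩))).and
      (((hPc.add ((hchic R2 hR2).const_mul η)).eventually (lt_mem_nhds (h_η2 R2 e))).and
      ((hPc.add ((hfc R2 hR2).const_mul η)).eventually (lt_mem_nhds (h_η3 R2 e))))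
  obtain ⟨δ, hδ, hball⟩ := Metric.eventually_nhds_iff.1 hev
  have hneg : ∀ᶠ r in 𝓝[>] R2, 0 < -Phi R r :=
    eventually_pos_right (hasDerivAt_Phi R hR2.ne').neg (by simp [hPR2])
      (by rw [← neg_div]; exact div_pos (by linarith) hR2)
  have hltδ : ∀ᶠ r in 𝓝[>] R2, r < R2 + δ := nhdsWithin_le_nhds (gt_mem_nhds (by linarith))
  obtain ⟨R3, hR3neg, hR3δ, hR23⟩ := (hneg.and (hltδ.and self_mem_nhdsWithin)).exists
  have hR23 : R2 < R3 := hR23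
  have hext : ∀ r, R2 ≤ r → r ≤ R3 → 0 < Phi R r + η * jj r ∧ 0 < Phi R r + η * chi K α γ r ∧
      0 < Phi R r + η * f r := fun r h1 h2 => hball (by
        rw [Real.dist_eq, abs_of_nonneg (by linarith)]; linarith)
  have hD : ∀ r ∈ Icc r2 R3, 0 < Phi R r + η * jj r := fun r hr => by
    rcases le_total r R2 with h | h
    · exact h_η1 r ⟨hr.1, h⟩
    · exact (hext r h hr.2).1
  have hC : ∀ r ∈ Icc R R3, 0 < Phi R r + η * chi K α γ r ∧ 0 < Phi R r + η * f r := fun r hr => by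
    rcases le_total r R2 with h | h
    · exact ⟨h_η2 r ⟨hr.1, h⟩, h_η3 r ⟨hr.1, h⟩⟩
    · exact (hext r h hr.2).2
  have posB : ∀ r ∈ Icc r1 R, 0 < r := fun r hr => by linarith [hr.1]
  have posC : ∀ r ∈ Icc R r2, 0 < r := fun r hr => by linarith [hr.1]
  have posD : ∀ r ∈ Icc r2 R3, 0 < r := fun r hr => by linarith [hr.1]
  have posE : ∀ r ∈ Icc R R3, 0 < r := fun r hr => by linarith [hr.1]
  have hjc' := continuous_jj
  have hXc' := continuous_XJ
  -- the Riccati functions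
  have RA : Ricc 0 (fun r => XJ r / jj r) 0 r1 := by
    refine ricc_of_pos (X' := fun r => -r * jj r) hjc'.continuousOn hXc'.continuousOn hjA
      fun r hr => ⟨hr.1.ne', hasDerivAt_jj r, hasDerivAt_XJ r, le_of_eq (by ring)⟩
  have RzA : Ricc κ (fun r => XJ (c * r) / jj (c * r)) 0 R := by
    refine ricc_of_pos (p := fun r => jj (c * r)) (X := fun r => XJ (c * r))
      (X' := fun r => -(c * r) * jj (c * r) * c) (by fun_prop) (by fun_prop) hjc fun r hr => ?_
    have hcr : HasDerivAt (fun r => c * r) c r := by simpa using (hasDerivAt_id r).const_mul c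
    have hr0 := hr.1.ne'
    refine ⟨hr0, ((hasDerivAt_jj (c * r)).comp r hcr).congr_deriv (by field_simp),
      (hasDerivAt_XJ (c * r)).comp r hcr, ?_⟩
    have h1 := hjc r ⟨hr.1.le, hr.2.le⟩
    have hr2 : r ^ 2 ≤ R ^ 2 := by
      have := hr.1
      have := hr.2
      gcongr
    have h2 : (1 - c ^ 2) * r ^ 2 ≤ κ := by
      rcases le_total 0 (1 - c ^ 2) with h | h
      · nlinarith
      · nlinarith [sq_nonneg r]
    nlinarith
  have RB : Ricc 0 (fun r => (-R * Real.sin (R * (Real.log r - Real.log r1))) /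
      Real.cos (R * (Real.log r - Real.log r1))) r1 R := by
    have hl := hlogon posB
    refine ricc_of_pos (p := fun r => Real.cos (R * (Real.log r - Real.log r1)))
      (X := fun r => -R * Real.sin (R * (Real.log r - Real.log r1)))
      (X' := fun r => -R * (Real.cos (R * (Real.log r - Real.log r1)) * (R * r⁻¹)))
      (by fun_prop) (by fun_prop) ?_ ?_
    · intro r hr
      have hrp := posB r hr
      have h1 : Real.log r1 ≤ Real.log r := Real.log_le_log hr1 hr.1
      have h2 : Real.log r ≤ Real.log R := Real.log_le_log hrp hr.2
      rw [Real.log_div hR.ne' hr1.ne'] at hlog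
      refine Real.cos_pos_of_mem_Ioo ⟨?_, ?_⟩
      · have : 0 ≤ R * (Real.log r - Real.log r1) := mul_nonneg hR.le (by linarith)
        linarith [Real.pi_pos]
      · have : R * (Real.log r - Real.log r1) ≤ R * (Real.log R - Real.log r1) := by gcongr
        linarith [Real.pi_gt_three]
    · intro r hr
      have hrp := posB r ⟨hr.1.le, hr.2.le⟩
      have hin : HasDerivAt (fun r => R * (Real.log r - Real.log r1)) (R * r⁻¹) r :=
        ((Real.hasDerivAt_log hrp.ne').sub_const _).const_mul R
      refine ⟨hrp.ne', hin.cos.congr_deriv (by field_simp), (hin.sin.const_mul _), ?_⟩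
      have h1 : Real.log r1 ≤ Real.log r := Real.log_le_log hr1 hr.1.le
      have h2 : Real.log r ≤ Real.log R := Real.log_le_log hrp hr.2.le
      have hcos : 0 ≤ Real.cos (R * (Real.log r - Real.log r1)) := by
        rw [Real.log_div hR.ne' hr1.ne'] at hlog
        refine (Real.cos_pos_of_mem_Ioo ⟨?_, ?_⟩).le
        · have : 0 ≤ R * (Real.log r - Real.log r1) := mul_nonneg hR.le (by linarith)
          linarith [Real.pi_pos]
        · have : R * (Real.log r - Real.log r1) ≤ R * (Real.log R - Real.log r1) := by gcongr
          linarith [Real.pi_gt_three]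
      have h3 : r * (-R * (Real.cos (R * (Real.log r - Real.log r1)) * (R * r⁻¹))) =
          -R ^ 2 * Real.cos (R * (Real.log r - Real.log r1)) := by field_simp
      rw [h3]
      have hr2 : r ^ 2 ≤ R ^ 2 := by
        have := hr.2
        gcongr
      nlinarith
  have RC : Ricc 0 (fun r => (XPhi R r - XJ r) / (Phi R r - jj r)) R r2 := by
    refine ricc_of_pos (X' := fun r => -r * Phi R r - -r * jj r)
      ((continuousOn_Phi posC).sub hjc'.continuousOn)
      ((continuousOn_XPhi posC).sub hXc'.continuousOn) ?_ ?_
    · intro r hr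
      have h1 := hjneg r ⟨by linarith [hr.1], hr.2⟩
      have h2 := hPnn r ⟨hr.1, by linarith [hr.2]⟩
      linarith
    · intro r hr
      have h0 := (posC r ⟨hr.1.le, hr.2.le⟩).ne'
      exact ⟨h0, ((hasDerivAt_Phi R h0).sub (hasDerivAt_jj r)).congr_deriv (by ring),
        (hasDerivAt_XPhi R h0).sub (hasDerivAt_XJ r), le_of_eq (by ring)⟩
  have RD : Ricc 0 (fun r => (XPhi R r + η * XJ r) / (Phi R r + η * jj r)) r2 R3 := by
    refine ricc_of_pos (X' := fun r => -r * Phi R r + η * (-r * jj r))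
      ((continuousOn_Phi posD).add (hjc'.continuousOn.const_mul η))
      ((continuousOn_XPhi posD).add (hXc'.continuousOn.const_mul η)) hD ?_
    intro r hr
    have h0 := (posD r ⟨hr.1.le, hr.2.le⟩).ne'
    exact ⟨h0, ((hasDerivAt_Phi R h0).add ((hasDerivAt_jj r).const_mul η)).congr_deriv (by ring),
      (hasDerivAt_XPhi R h0).add ((hasDerivAt_XJ r).const_mul η), le_of_eq (by ring)⟩
  have RzC : Ricc κ (fun r => (XPhi R r + η * (γ + α - 2 * Real.log r)) /
      (Phi R r + η * chi K α γ r)) R R3 := by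
    have hl := hlogon posE
    refine ricc_of_pos (X' := fun r => -r * Phi R r + η * (0 - 2 * r⁻¹))
      ((continuousOn_Phi posE).add (ContinuousOn.const_mul
        (fun r hr => (hchic r (posE r hr)).continuousWithinAt) η))
      ((continuousOn_XPhi posE).add (by fun_prop)) (fun r hr => (hC r hr).1) ?_
    intro r hr
    have hm : r ∈ Icc R R3 := ⟨hr.1.le, hr.2.le⟩
    have h0 := (posE r hm).ne'
    have hl' := Real.hasDerivAt_log h0
    refine ⟨h0, ((hasDerivAt_Phi R h0).add ((((hl'.sub_const α).mul
      (hl'.const_sub γ)).const_add (1 / K)).const_mul η)).congr_deriv ?_,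
      (hasDerivAt_XPhi R h0).add (((hasDerivAt_const r (γ + α)).sub (hl'.const_mul 2)).const_mul η), ?_⟩
    · field_simp
      ring
    · have h2 := (hC r hm).2
      have h3 : 0 ≤ κ * (Phi R r + η * f r) := mul_nonneg hκ.le h2.le
      have h4 : κ * f r = 2 + (κ - r ^ 2) * chi K α γ r := by simp only [hf]; field_simp
      have h5 : κ * (Phi R r + η * f r) =
          κ * Phi R r + η * (2 + (κ - r ^ 2) * chi K α γ r) := by rw [← h4]; ring
      have h6 : r * (-r * Phi R r + η * (0 - 2 * r⁻¹)) = -r ^ 2 * Phi R r - 2 * η := by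
        field_simp
        ring
      rw [h6]
      rw [h5] at h3
      linear_combination h3
  -- the bound
  obtain ⟨b1, hb1⟩ := isCompact_Icc.exists_bound_of_continuousOn RB.1
  obtain ⟨b2, hb2⟩ := isCompact_Icc.exists_bound_of_continuousOn RzA.1
  obtain ⟨b3, hb3⟩ := isCompact_Icc.exists_bound_of_continuousOn RC.1
  obtain ⟨b4, hb4⟩ := isCompact_Icc.exists_bound_of_continuousOn RzC.1
  have e1 := le_abs_self b1
  have e2 := le_abs_self b2
  have e3 := le_abs_self b3
  have e4 := le_abs_self b4
  have f1 := abs_nonneg b1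
  have f2 := abs_nonneg b2
  have f3 := abs_nonneg b3
  have f4 := abs_nonneg b4
  exact ⟨{
    r1 := r1, s := s, R := R, r2 := r2, R3 := R3, b0 := |b1| + |b2| + |b3| + |b4| + 1
    r1_pos := hr1, r1_lt := hr1s, s_lt := hsR, R_lt := hRr2, r2_lt := by linarith
    b0_pos := by positivity
    jj_r1 := hjA r1 ⟨hr1.le, le_rfl⟩
    jj_neg := hjneg
    Phi_pos := fun r hr => hPpos r ⟨hr.1, by linarith [hr.2]⟩
    Phi_R3 := by linarith
    wA := _, wB := _, wC := _, wD := _, zA := _, zC := _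
    ricc_wA := RA, ricc_wB := RB, ricc_wC := RC, ricc_wD := RD, ricc_zA := RzA, ricc_zC := RzC
    wA_zero := by simp [XJ_zero]
    zA_zero := by simp [XJ_zero]
    le_wB := fun r hr => by linarith [(abs_le.1 (hb1 r hr)).1]
    le_zA := fun r hr => by linarith [(abs_le.1 (hb2 r ⟨by linarith [hr.1], hr.2⟩)).1]
    wC_le := fun r hr => by linarith [(abs_le.1 (hb3 r hr)).2]
    zC_le := fun r hr => by linarith [(abs_le.1 (hb4 r ⟨hr.1, by linarith [hr.2]⟩)).2] }⟩

end Payne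

namespace Payne

open Filter Topology Set Function

lemma exists_param_bound {F : ℝ → ℝ → ℝ} {U : Set ℝ} (hU : IsOpen U)
    (hF : ContinuousOn (uncurry F) (U ×ˢ univ)) {r₀ : ℝ} (h : r₀ ∈ U) (a b : ℝ) :
    ∃ s ∈ 𝓝 r₀, s ⊆ U ∧ ∃ C, ∀ r ∈ s, ∀ ψ ∈ uIcc a b, ‖F r ψ‖ ≤ C := by
  obtain ⟨ε, hε, hball⟩ := Metric.nhds_basis_closedBall.mem_iff.1 (hU.mem_nhds h)
  have hc : IsCompact (Metric.closedBall r₀ ε ×ˢ uIcc a b) :=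
    (isCompact_closedBall r₀ ε).prod isCompact_uIcc
  obtain ⟨C, hC⟩ := hc.exists_bound_of_continuousOn
    (hF.mono (prod_mono hball (subset_univ _)))
  exact ⟨_, Metric.closedBall_mem_nhds r₀ hε, hball, C, fun r hr ψ hψ => hC (r, ψ) ⟨hr, hψ⟩⟩

lemma continuous_slice {F : ℝ → ℝ → ℝ} {U : Set ℝ}
    (hF : ContinuousOn (uncurry F) (U ×ˢ univ)) {r : ℝ} (h : r ∈ U) : Continuous (F r) := by
  rw [← continuousOn_univ]
  exact hF.comp (f := fun ψ => (r, ψ)) (by fun_prop) fun ψ _ => ⟨h, mem_univ _⟩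

/-- Continuity of a parametric integral with jointly continuous integrand. -/
lemma continuousAt_param {F : ℝ → ℝ → ℝ} {U : Set ℝ} (hU : IsOpen U)
    (hF : ContinuousOn (uncurry F) (U ×ˢ univ)) {r₀ : ℝ} (h : r₀ ∈ U) (a b : ℝ) :
    ContinuousAt (fun r => ∫ ψ in a..b, F r ψ) r₀ := by
  obtain ⟨s, hs, hsU, C, hC⟩ := exists_param_bound hU hF h a b
  refine intervalIntegral.continuousAt_of_dominated_interval (bound := fun _ => C) ?_ ?_
    intervalIntegrable_const ?_
  · filter_upwards [hU.mem_nhds h] with r hr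
    exact (continuous_slice hF hr).aestronglyMeasurable
  · filter_upwards [hs] with r hr
    exact Eventually.of_forall fun ψ hψ => hC r hr ψ (uIoc_subset_uIcc hψ)
  · refine Eventually.of_forall fun ψ _ => ?_
    have h1 : ContinuousAt (uncurry F) (r₀, ψ) :=
      hF.continuousAt ((hU.prod isOpen_univ).mem_nhds ⟨h, mem_univ _⟩)
    exact h1.comp (f := fun r => (r, ψ)) (by fun_prop)

/-- Differentiation under the integral sign for jointly continuous derivatives. -/
lemma hasDerivAt_param {F F' : ℝ → ℝ → ℝ} {U : Set ℝ} (hU : IsOpen U)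
    (hF : ContinuousOn (uncurry F) (U ×ˢ univ)) (hF' : ContinuousOn (uncurry F') (U ×ˢ univ))
    (hd : ∀ r ∈ U, ∀ ψ, HasDerivAt (fun r => F r ψ) (F' r ψ) r) {r₀ : ℝ} (h : r₀ ∈ U) (a b : ℝ) :
    HasDerivAt (fun r => ∫ ψ in a..b, F r ψ) (∫ ψ in a..b, F' r₀ ψ) r₀ := by
  obtain ⟨s, hs, hsU, C, hC⟩ := exists_param_bound hU hF' h a b
  refine (intervalIntegral.hasDerivAt_integral_of_dominated_loc_of_deriv_le
    (bound := fun _ => C) hs ?_ ((continuous_slice hF h).intervalIntegrable a b)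
    (continuous_slice hF' h).aestronglyMeasurable ?_ intervalIntegrable_const ?_).2
  · filter_upwards [hU.mem_nhds h] with r hr
    exact (continuous_slice hF hr).aestronglyMeasurable
  · exact Eventually.of_forall fun ψ hψ r hr => hC r hr ψ (uIoc_subset_uIcc hψ)
  · exact Eventually.of_forall fun ψ _ r hr => hd r (hsU hr) ψ

/-- The second derivative of `ph`. -/
noncomputable def ph2 (s : ℝ) : ℝ := (-ph s / 4 - ph1 s) / s

lemma hasDerivAt_ph1 {s : ℝ} (hs : s ≠ 0) : HasDerivAt ph1 (ph2 s) s := by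
  have h1 := (hasDerivAt_mul_ph1 hs).div (hasDerivAt_id s) hs
  have h2 : ph1 =ᶠ[𝓝 s] (fun s => s * ph1 s) / id := by
    filter_upwards [isOpen_ne.mem_nhds hs] with x hx
    have hx' : x ≠ 0 := hx
    simp only [Pi.div_apply, id]
    field_simp
  refine (h1.congr_of_eventuallyEq h2).congr_deriv ?_
  rw [ph2]
  simp only [id]
  field_simp

lemma continuousOn_ph : ContinuousOn ph (Ioi 0) := fun _ hs =>
  (hasDerivAt_ph (ne_of_gt hs)).continuousAt.continuousWithinAt

lemma continuousOn_ph1 : ContinuousOn ph1 (Ioi 0) := fun _ hs =>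
  (hasDerivAt_ph1 (ne_of_gt hs)).continuousAt.continuousWithinAt

lemma continuousOn_ph2 : ContinuousOn ph2 (Ioi 0) :=
  ((continuousOn_ph.neg.div_const 4).sub continuousOn_ph1).div continuousOn_id
    fun _ hs => ne_of_gt hs

/-- The squared distance between points at radii `r`, `R` and relative angle `ψ`. -/
noncomputable def sqd (R r ψ : ℝ) : ℝ := r ^ 2 + R ^ 2 - 2 * r * R * Real.cos ψ

lemma sqd_comm (R r ψ : ℝ) : sqd R r ψ = sqd r R ψ := by rw [sqd, sqd]; ring

lemma sqd_eq (R r ψ : ℝ) :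
    sqd R r ψ = (R - r * Real.cos ψ) ^ 2 + (r * Real.sin ψ) ^ 2 := by
  rw [sqd]
  linear_combination (-r ^ 2) * Real.sin_sq_add_cos_sq ψ

lemma sqd_pos {R r : ℝ} (h : |r| < R) (ψ : ℝ) : 0 < sqd R r ψ := by
  rw [sqd_eq]
  have h1 : |r * Real.cos ψ| ≤ |r| := by
    rw [abs_mul]
    exact mul_le_of_le_one_right (abs_nonneg r) (Real.abs_cos_le_one ψ)
  have h2 : 0 < R - r * Real.cos ψ := by linarith [le_abs_self (r * Real.cos ψ)]
  positivity

lemma hasDerivAt_sqd (R r ψ : ℝ) :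
    HasDerivAt (fun r => sqd R r ψ) (2 * r - 2 * R * Real.cos ψ) r := by
  have h := ((hasDerivAt_sq r).add_const (R ^ 2)).sub
    ((((hasDerivAt_id r).const_mul 2).mul_const R).mul_const (Real.cos ψ))
  exact h.congr_deriv (by ring)

lemma hasDerivAt_sqd_angle (R r ψ : ℝ) :
    HasDerivAt (fun ψ => sqd R r ψ) (2 * r * R * Real.sin ψ) ψ := by
  have h := ((Real.hasDerivAt_cos ψ).const_mul (2 * r * R)).const_sub (r ^ 2 + R ^ 2)
  exact h.congr_deriv (by ring)

lemma continuous_sqd (R : ℝ) : Continuous fun p : ℝ × ℝ => sqd R p.1 p.2 := by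
  unfold sqd
  fun_prop

/-- The mean value formula for the logarithmic solution, for interior points. -/
lemma integral_ph_of_lt {R r : ℝ} (hr : 0 ≤ r) (hrR : r < R) :
    ∫ ψ in (0 : ℝ)..(2 * π), ph (sqd R r ψ) = 2 * π * (gg R * jj r) := by
  set U : Set ℝ := Ioo (-R) R with hUdef
  have hU : IsOpen U := isOpen_Ioo
  have hR : 0 < R := by linarith
  have hpos : ∀ p ∈ U ×ˢ (univ : Set ℝ), sqd R p.1 p.2 ∈ Ioi (0 : ℝ) := fun p hp =>
    sqd_pos (abs_lt.2 hp.1) p.2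
  have hpos' : ∀ r ∈ U, ∀ ψ, sqd R r ψ ≠ 0 := fun r hr ψ =>
    (sqd_pos (abs_lt.2 hr) ψ).ne'
  have hs := (continuous_sqd R).continuousOn (s := U ×ˢ univ)
  have c0 : ContinuousOn (uncurry fun r ψ => ph (sqd R r ψ)) (U ×ˢ univ) :=
    continuousOn_ph.comp hs hpos
  have c1' : ContinuousOn (uncurry fun r ψ => ph1 (sqd R r ψ)) (U ×ˢ univ) :=
    continuousOn_ph1.comp hs hpos
  have c2' : ContinuousOn (uncurry fun r ψ => ph2 (sqd R r ψ)) (U ×ˢ univ) :=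
    continuousOn_ph2.comp hs hpos
  have cl : ContinuousOn (fun p : ℝ × ℝ => 2 * p.1 - 2 * R * Real.cos p.2) (U ×ˢ univ) := by
    fun_prop
  have c1 : ContinuousOn (uncurry fun r ψ => ph1 (sqd R r ψ) * (2 * r - 2 * R * Real.cos ψ))
      (U ×ˢ univ) := c1'.mul cl
  have c2 : ContinuousOn (uncurry fun r ψ =>
      ph2 (sqd R r ψ) * (2 * r - 2 * R * Real.cos ψ) ^ 2 + ph1 (sqd R r ψ) * 2) (U ×ˢ univ) :=
    (c2'.mul (cl.pow 2)).add (c1'.mul continuousOn_const)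
  have d1 : ∀ r ∈ U, ∀ ψ, HasDerivAt (fun r => ph (sqd R r ψ))
      (ph1 (sqd R r ψ) * (2 * r - 2 * R * Real.cos ψ)) r := fun r hr ψ =>
    HasDerivAt.comp (h := fun r => sqd R r ψ) r (hasDerivAt_ph (hpos' r hr ψ))
      (hasDerivAt_sqd R r ψ)
  have d2 : ∀ r ∈ U, ∀ ψ, HasDerivAt (fun r => ph1 (sqd R r ψ) * (2 * r - 2 * R * Real.cos ψ))
      (ph2 (sqd R r ψ) * (2 * r - 2 * R * Real.cos ψ) ^ 2 + ph1 (sqd R r ψ) * 2) r := by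
    intro r hr ψ
    have h1 := HasDerivAt.comp (h := fun r => sqd R r ψ) r (hasDerivAt_ph1 (hpos' r hr ψ))
      (hasDerivAt_sqd R r ψ)
    have h2 : HasDerivAt (fun r => 2 * r - 2 * R * Real.cos ψ) 2 r := by
      simpa using ((hasDerivAt_id r).const_mul 2).sub_const (2 * R * Real.cos ψ)
    exact (h1.mul h2).congr_deriv (by simp only [comp]; ring)
  set m : ℝ → ℝ := fun r => ∫ ψ in (0 : ℝ)..(2 * π), ph (sqd R r ψ) with hm
  set m1 : ℝ → ℝ := fun r => ∫ ψ in (0 : ℝ)..(2 * π),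
    ph1 (sqd R r ψ) * (2 * r - 2 * R * Real.cos ψ) with hm1
  have hmd : ∀ r ∈ U, HasDerivAt m (m1 r) r := fun r hr => hasDerivAt_param hU c0 c1 d1 hr _ _
  have hm1d : ∀ r ∈ U, r ≠ 0 → HasDerivAt m1 (-m r - m1 r / r) r := by
    intro r hr hr0
    refine (hasDerivAt_param hU c1 c2 d2 hr 0 (2 * π)).congr_deriv ?_
    have e : ∫ ψ in (0 : ℝ)..(2 * π), (ph2 (sqd R r ψ) * (2 * r * R * Real.sin ψ) ^ 2 +
        ph1 (sqd R r ψ) * (2 * r * R * Real.cos ψ)) = 0 := by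
      have hFTC := intervalIntegral.integral_eq_sub_of_hasDerivAt (a := (0 : ℝ)) (b := 2 * π)
        (f := fun ψ => ph1 (sqd R r ψ) * (2 * r * R * Real.sin ψ))
        (f' := fun ψ => ph2 (sqd R r ψ) * (2 * r * R * Real.sin ψ) ^ 2 +
          ph1 (sqd R r ψ) * (2 * r * R * Real.cos ψ)) ?_ ?_
      · rw [hFTC]
        simp
      · intro ψ _
        have h1 := HasDerivAt.comp (h := fun ψ => sqd R r ψ) ψ (hasDerivAt_ph1 (hpos' r hr ψ))
          (hasDerivAt_sqd_angle R r ψ)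
        exact (h1.mul ((Real.hasDerivAt_sin ψ).const_mul (2 * r * R))).congr_deriv
          (by simp only [comp]; ring)
      · refine Continuous.intervalIntegrable ?_ _ _
        have i1 := continuous_slice c1' hr
        have i2 := continuous_slice c2' hr
        fun_prop
    have i0 := continuous_slice c0 hr
    have i1 := continuous_slice c1 hr
    have i1' := continuous_slice c1' hr
    have i2' := continuous_slice c2' hr
    have e2 : ∀ ψ, ph2 (sqd R r ψ) * (2 * r - 2 * R * Real.cos ψ) ^ 2 + ph1 (sqd R r ψ) * 2 =
        (-ph (sqd R r ψ) - ph1 (sqd R r ψ) * (2 * r - 2 * R * Real.cos ψ) / r) -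
        (ph2 (sqd R r ψ) * (2 * r * R * Real.sin ψ) ^ 2 +
        ph1 (sqd R r ψ) * (2 * r * R * Real.cos ψ)) / r ^ 2 := by
      intro ψ
      have hne := hpos' r hr ψ
      have e3 : ph2 (sqd R r ψ) * sqd R r ψ = -ph (sqd R r ψ) / 4 - ph1 (sqd R r ψ) := by
        rw [ph2]; field_simp
      have e4 : 4 * r * sqd R r ψ = r * (2 * r - 2 * R * Real.cos ψ) ^ 2 +
          4 * r * R ^ 2 * Real.sin ψ ^ 2 := by
        rw [sqd]
        linear_combination (-4 * r * R ^ 2) * Real.sin_sq_add_cos_sq ψ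
      field_simp
      linear_combination (4 * r) * e3 - ph2 (sqd R r ψ) * e4
    simp only [e2]
    rw [intervalIntegral.integral_sub, intervalIntegral.integral_sub, intervalIntegral.integral_neg,
      intervalIntegral.integral_div, intervalIntegral.integral_div, e]
    · simp [hm, hm1]
    · exact (i0.neg).intervalIntegrable _ _
    · exact (i1.div_const r).intervalIntegrable _ _
    · exact ((i0.neg).sub (i1.div_const r)).intervalIntegrable _ _
    · refine Continuous.intervalIntegrable ?_ _ _
      fun_prop
  -- energy argument
  set D : ℝ → ℝ := fun r => m r - 2 * π * (gg R * jj r) with hD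
  set Y : ℝ → ℝ := fun r => m1 r - 2 * π * (gg R * (2 * r * fa1 (r ^ 2))) with hY
  have eXJ : ∀ x : ℝ, x ≠ 0 → XJ x / x = 2 * x * fa1 (x ^ 2) := fun x hx => by
    rw [XJ]; field_simp
  have hDd : ∀ x ∈ U, x ≠ 0 → HasDerivAt D (Y x) x := by
    intro x hx hx0
    refine ((hmd x hx).sub (((hasDerivAt_jj x).const_mul (gg R)).const_mul (2 * π))).congr_deriv ?_
    rw [eXJ x hx0]
  have hYd : ∀ x ∈ U, x ≠ 0 → HasDerivAt Y (-D x - Y x / x) x := by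
    intro x hx hx0
    have h1 : HasDerivAt (fun r => XJ r / r) (-jj x - 2 * fa1 (x ^ 2)) x := by
      refine ((hasDerivAt_XJ x).div (hasDerivAt_id x) hx0).congr_deriv ?_
      simp only [id, XJ]
      field_simp
    have h2 : HasDerivAt (fun r => 2 * r * fa1 (r ^ 2)) (-jj x - 2 * fa1 (x ^ 2)) x := by
      refine h1.congr_of_eventuallyEq ?_
      filter_upwards [isOpen_ne.mem_nhds hx0] with y hy
      exact (eXJ y hy).symm
    refine ((hm1d x hx hx0).sub ((h2.const_mul (gg R)).const_mul (2 * π))).congr_deriv ?_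
    simp only [hD, hY]
    field_simp
    ring
  have hcD : ContinuousOn D (Ico 0 R) := fun x hx => by
    have hxU : x ∈ U := ⟨by linarith [hx.1], hx.2⟩
    exact ((hmd x hxU).continuousAt.sub
      ((continuous_jj.continuousAt.const_mul (gg R)).const_mul (2 * π))).continuousWithinAt
  have hcY : ContinuousOn Y (Ico 0 R) := fun x hx => by
    have hxU : x ∈ U := ⟨by linarith [hx.1], hx.2⟩
    have h1 := continuousAt_param hU c1 hxU 0 (2 * π)
    have h2 := contDiff_fa1.continuous
    have h3 : Continuous fun r : ℝ => 2 * π * (gg R * (2 * r * fa1 (r ^ 2))) := by fun_prop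
    exact (h1.sub h3.continuousAt).continuousWithinAt
  have hanti : AntitoneOn (fun x => D x ^ 2 + Y x ^ 2) (Ico 0 R) := by
    have hd : ∀ x ∈ Ioo 0 R, HasDerivAt (fun x => D x ^ 2 + Y x ^ 2)
        (2 * D x * Y x + 2 * Y x * (-D x - Y x / x)) x := fun x hx => by
      have hxU : x ∈ U := ⟨by linarith [hx.1], hx.2⟩
      refine (((hDd x hxU hx.1.ne').pow 2).add ((hYd x hxU hx.1.ne').pow 2)).congr_deriv ?_
      simp
    refine antitoneOn_of_deriv_nonpos (convex_Ico _ _) ((hcD.pow 2).add (hcY.pow 2)) ?_ ?_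
    · rw [interior_Ico]
      exact fun x hx => (hd x hx).differentiableAt.differentiableWithinAt
    · rw [interior_Ico]
      intro x hx
      rw [(hd x hx).deriv]
      have : 0 ≤ Y x ^ 2 / x := div_nonneg (sq_nonneg _) hx.1.le
      have e : Y x * (Y x / x) = Y x ^ 2 / x := by ring
      nlinarith
  have hD0 : D 0 = 0 := by
    have : ∀ ψ, sqd R 0 ψ = R ^ 2 := fun ψ => by simp [sqd]
    simp only [hD, hm, this, jj_zero, gg]
    simp
  have hY0 : Y 0 = 0 := by
    have : ∀ ψ, sqd R 0 ψ = R ^ 2 := fun ψ => by simp [sqd]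
    simp only [hY, hm1, this]
    simp
  have h1 := hanti ⟨le_rfl, hR⟩ ⟨hr, hrR⟩ hr
  simp only [hD0, hY0] at h1
  have h2 : D r = 0 := by nlinarith [sq_nonneg (D r), sq_nonneg (Y r)]
  simp only [hD] at h2
  linarith

/-- The mean value formula for the logarithmic solution. -/
lemma integral_ph {R r : ℝ} (hr : 0 ≤ r) (hR : 0 < R) (hne : r ≠ R) :
    ∫ ψ in (0 : ℝ)..(2 * π), ph (sqd R r ψ) = 2 * π * (gg (max r R) * jj (min r R)) := by
  rcases lt_or_gt_of_ne hne with h | h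
  · rw [max_eq_right h.le, min_eq_left h.le, integral_ph_of_lt hr h]
  · rw [max_eq_left h.le, min_eq_right h.le]
    simp only [sqd_comm R r]
    exact integral_ph_of_lt hR.le h

/-- The difference between the logarithmic solution and the logarithm, at distance `d`. -/
noncomputable def KK (d : ℝ) : ℝ := Real.log d * (fa (d ^ 2) - 1) + fb (d ^ 2)

lemma ph_sq_eq (d : ℝ) : ph (d ^ 2) = Real.log d + KK d := by
  rw [ph, KK, Real.log_pow]
  push_cast
  ring

lemma fa_sub_one (s : ℝ) : fa s - 1 = s * dslope fa 0 s := by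
  have h := sub_smul_dslope fa 0 s
  rw [sub_zero, smul_eq_mul, fa_zero] at h
  exact h.symm

lemma continuous_dslope_fa : Continuous (dslope fa 0) := by
  rw [← continuousOn_univ, continuousOn_dslope univ_mem]
  exact ⟨contDiff_fa.continuous.continuousOn, (hasDerivAt_fa 0).differentiableAt⟩

lemma KK_eq (d : ℝ) : KK d = (d * Real.log d) * d * dslope fa 0 (d ^ 2) + fb (d ^ 2) := by
  rw [KK, fa_sub_one]
  ring

lemma continuous_KK : Continuous KK := by
  have e : KK = fun d => (d * Real.log d) * d * dslope fa 0 (d ^ 2) + fb (d ^ 2) := funext KK_eq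
  rw [e]
  have h1 := continuous_mul_log
  have h2 := continuous_dslope_fa
  have h3 := contDiff_fb.continuous
  fun_prop

/-- The derivative of `KK`. -/
noncomputable def dKK (d : ℝ) : ℝ :=
  d * dslope fa 0 (d ^ 2) + 2 * (d * Real.log d) * fa1 (d ^ 2) + 2 * d * fb1 (d ^ 2)

lemma continuous_dKK : Continuous dKK := by
  unfold dKK
  have h1 := continuous_mul_log
  have h2 := continuous_dslope_fa
  have h3 := contDiff_fb1.continuous
  have h4 := contDiff_fa1.continuous
  fun_prop

lemma hasDerivAt_KK {d : ℝ} (hd : d ≠ 0) : HasDerivAt KK (dKK d) d := by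
  have h1 := HasDerivAt.comp (h := fun d : ℝ => d ^ 2) d (hasDerivAt_fa (d ^ 2)) (hasDerivAt_sq d)
  have h2 := HasDerivAt.comp (h := fun d : ℝ => d ^ 2) d (hasDerivAt_fb (d ^ 2)) (hasDerivAt_sq d)
  refine (((Real.hasDerivAt_log hd).mul (h1.sub_const 1)).add h2).congr_deriv ?_
  rw [dKK]
  simp only [comp]
  rw [fa_sub_one]
  field_simp

lemma exists_lipschitz_KK (D : ℝ) : ∃ L, 0 ≤ L ∧ ∀ a ∈ Icc 0 D, ∀ b ∈ Icc 0 D,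
    |KK a - KK b| ≤ L * |a - b| := by
  obtain ⟨L, hL⟩ := isCompact_Icc.exists_bound_of_continuousOn
    (continuous_dKK.continuousOn (s := Icc 0 D))
  have key : ∀ a ∈ Icc 0 D, ∀ b ∈ Icc 0 D, a < b → |KK a - KK b| ≤ |L| * |a - b| := by
    intro a ha b hb hab
    obtain ⟨c, hc, hc'⟩ := exists_hasDerivAt_eq_slope KK dKK hab continuous_KK.continuousOn
      fun x hx => hasDerivAt_KK (by linarith [hx.1, ha.1] : x ≠ 0)
    rw [eq_div_iff (by linarith)] at hc'
    rw [abs_sub_comm, ← hc', abs_mul, abs_sub_comm b a]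
    refine mul_le_mul_of_nonneg_right ?_ (abs_nonneg _)
    exact (hL c ⟨by linarith [hc.1, ha.1], by linarith [hc.2, hb.2]⟩).trans (le_abs_self L)
  refine ⟨|L|, abs_nonneg L, fun a ha b hb => ?_⟩
  rcases lt_trichotomy a b with h | h | h
  · exact key a ha b hb h
  · simp [h]
  · rw [abs_sub_comm, abs_sub_comm a]
    exact key b hb a ha h

/-- Equally spaced points approximate the integral of a Lipschitz function. -/
lemma riemann_sum_le {F : ℝ → ℝ} {L : ℝ} (hL : 0 ≤ L) (hF : ∀ a b, |F a - F b| ≤ L * |a - b|)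
    {N : ℕ} (hN : 0 < N) :
    |∑ j ∈ Finset.range N, F (2 * π * j / N) - N / (2 * π) * ∫ t in (0 : ℝ)..(2 * π), F t| ≤
      2 * π * L := by
  have hN' : (0 : ℝ) < N := by exact_mod_cast hN
  have hc : Continuous F := by
    refine (LipschitzWith.of_dist_le_mul (K := ⟨L, hL⟩) fun a b => ?_).continuous
    rw [Real.dist_eq, Real.dist_eq]
    exact hF a b
  set h : ℝ := 2 * π / N with hh
  have hh0 : 0 < h := by positivity
  set a : ℕ → ℝ := fun j => 2 * π * j / N with ha
  have hsucc : ∀ j, a (j + 1) = a j + h := fun j => by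
    simp only [ha, hh]
    push_cast
    ring
  have hsum := intervalIntegral.sum_integral_adjacent_intervals (f := F) (μ := volume) (a := a)
    (n := N) fun k _ => hc.intervalIntegrable _ _
  have ha0 : a 0 = 0 := by simp [ha]
  have haN : a N = 2 * π := by simp only [ha]; field_simp
  rw [ha0, haN] at hsum
  have hstep : ∀ j, |h * F (a j) - ∫ t in a j..a (j + 1), F t| ≤ L * h * h := by
    intro j
    have e : h * F (a j) - ∫ t in a j..a (j + 1), F t = ∫ t in a j..a (j + 1), (F (a j) - F t) := by
      rw [intervalIntegral.integral_sub intervalIntegrable_const (hc.intervalIntegrable _ _)]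
      simp [hsucc]
    rw [e]
    have hb := intervalIntegral.norm_integral_le_of_norm_le_const (a := a j) (b := a (j + 1))
      (f := fun t => F (a j) - F t) (C := L * h) fun t ht => by
        rw [hsucc, uIoc_of_le (by linarith)] at ht
        refine (hF _ _).trans ?_
        refine mul_le_mul_of_nonneg_left ?_ hL
        rw [abs_sub_comm, abs_of_nonneg (by linarith [ht.1])]
        linarith [ht.2]
    rw [hsucc, add_sub_cancel_left, abs_of_pos hh0, ← hsucc] at hb
    exact hb
  have e2 : ∑ j ∈ Finset.range N, F (a j) - N / (2 * π) * ∫ t in (0 : ℝ)..(2 * π), F t =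
      N / (2 * π) * ∑ j ∈ Finset.range N, (h * F (a j) - ∫ t in a j..a (j + 1), F t) := by
    rw [Finset.sum_sub_distrib, hsum, ← Finset.mul_sum, hh]
    field_simp
  rw [e2, abs_mul, abs_of_pos (by positivity)]
  have h3 : |∑ j ∈ Finset.range N, (h * F (a j) - ∫ t in a j..a (j + 1), F t)| ≤
      N * (L * h * h) := by
    refine (Finset.abs_sum_le_sum_abs _ _).trans ?_
    refine (Finset.sum_le_card_nsmul _ _ _ fun j _ => hstep j).trans ?_
    simp
  refine (mul_le_mul_of_nonneg_left h3 (by positivity)).trans (le_of_eq ?_)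
  rw [hh]
  field_simp

/-- The `j`-th of `N` equally spaced points on the circle of radius `R`. -/
noncomputable def pt (R : ℝ) (N j : ℕ) : ℂ := circleMap 0 R (2 * π * j / N)

lemma prod_sub_pt (R : ℝ) {N : ℕ} (hN : 0 < N) (z : ℂ) :
    ∏ j ∈ Finset.range N, (z - pt R N j) = z ^ N - (R : ℂ) ^ N := by
  have h := X_pow_sub_C_eq_prod (Complex.isPrimitiveRoot_exp N hN.ne') hN
    (rfl : (R : ℂ) ^ N = (R : ℂ) ^ N)
  have h2 := congrArg (Polynomial.eval z) h
  rw [Polynomial.eval_prod] at h2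
  simp only [Polynomial.eval_sub, Polynomial.eval_pow, Polynomial.eval_X, Polynomial.eval_C] at h2
  rw [h2]
  refine Finset.prod_congr rfl fun j _ => ?_
  rw [pt, circleMap_zero, ← Complex.exp_nat_mul]
  push_cast
  rw [mul_comm]
  congr 3
  ring

lemma log_norm_pow_sub {R : ℝ} {N : ℕ} (hN : 0 < N) {z : ℂ} (hz : z ^ N ≠ (R : ℂ) ^ N) :
    Real.log ‖z ^ N - (R : ℂ) ^ N‖ = ∑ j ∈ Finset.range N, Real.log ‖z - pt R N j‖ := by
  rw [← prod_sub_pt R hN, norm_prod, Real.log_prod]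
  intro j hj
  rw [norm_ne_zero_iff]
  intro h
  refine sub_ne_zero.2 hz ?_
  rw [← prod_sub_pt R hN]
  exact Finset.prod_eq_zero hj h

lemma norm_sub_circleMap_sq (R : ℝ) (z : ℂ) (ψ : ℝ) :
    ‖z - circleMap 0 R ψ‖ ^ 2 = sqd R ‖z‖ (ψ - z.arg) := by
  conv_lhs => rw [← Complex.norm_mul_exp_arg_mul_I z]
  rw [circleMap_zero, Complex.sq_norm, Complex.normSq_apply, sqd, Real.cos_sub]
  simp only [Complex.sub_re, Complex.sub_im, Complex.mul_re, Complex.mul_im, Complex.ofReal_re,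
    Complex.ofReal_im, Complex.exp_ofReal_mul_I_re, Complex.exp_ofReal_mul_I_im, zero_mul, sub_zero,
    add_zero]
  linear_combination ‖z‖ ^ 2 * Real.sin_sq_add_cos_sq z.arg + R ^ 2 * Real.sin_sq_add_cos_sq ψ

/-- The mean of `KK` over the circle of radius `R`. -/
noncomputable def meanK (R r : ℝ) : ℝ := gg (max r R) * jj (min r R) - Real.log (max r R)

lemma integral_KK_of_ne {R : ℝ} (hR : 0 < R) {z : ℂ} (hz : ‖z‖ ≠ R) :
    ∫ ψ in (0 : ℝ)..(2 * π), KK ‖z - circleMap 0 R ψ‖ = 2 * π * meanK R ‖z‖ := by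
  have hpos : ∀ ψ, ‖z - circleMap 0 R ψ‖ ≠ 0 := fun ψ h => by
    rw [norm_eq_zero, sub_eq_zero] at h
    rw [h, norm_circleMap_zero, abs_of_pos hR] at hz
    exact hz rfl
  have hcc : Continuous fun ψ => ‖z - circleMap 0 R ψ‖ :=
    (continuous_const.sub (continuous_circleMap 0 R)).norm
  have clog : Continuous fun ψ => Real.log ‖z - circleMap 0 R ψ‖ := hcc.log hpos
  have cK : Continuous fun ψ => KK ‖z - circleMap 0 R ψ‖ := continuous_KK.comp hcc
  have hsum : ∫ ψ in (0 : ℝ)..(2 * π), ph (‖z - circleMap 0 R ψ‖ ^ 2) =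
      (∫ ψ in (0 : ℝ)..(2 * π), Real.log ‖z - circleMap 0 R ψ‖) +
      ∫ ψ in (0 : ℝ)..(2 * π), KK ‖z - circleMap 0 R ψ‖ := by
    rw [← intervalIntegral.integral_add (clog.intervalIntegrable _ _) (cK.intervalIntegrable _ _)]
    simp only [ph_sq_eq]
  have hper : Periodic (fun ψ => ph (sqd R ‖z‖ ψ)) (2 * π) := fun ψ => by
    simp only [sqd, Real.cos_add_two_pi]
  have hph : ∫ ψ in (0 : ℝ)..(2 * π), ph (‖z - circleMap 0 R ψ‖ ^ 2) =
      2 * π * (gg (max ‖z‖ R) * jj (min ‖z‖ R)) := by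
    simp only [norm_sub_circleMap_sq]
    rw [intervalIntegral.integral_comp_sub_right (fun ψ => ph (sqd R ‖z‖ ψ))]
    have := hper.intervalIntegral_add_eq (-z.arg) 0
    rw [zero_sub, sub_eq_neg_add, this, zero_add]
    exact integral_ph (norm_nonneg z) hR hz
  have hlog : ∫ ψ in (0 : ℝ)..(2 * π), Real.log ‖z - circleMap 0 R ψ‖ =
      2 * π * Real.log (max ‖z‖ R) := by
    have h := circleAverage_log_norm_sub_const_eq_log_radius_add_posLog (c := 0) (a := z) hR.ne'
    rw [circleAverage_def, smul_eq_mul] at h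
    simp only [norm_sub_rev _ z, sub_zero] at h
    have h2 : Real.log R + posLog (R⁻¹ * ‖z‖) = Real.log (max ‖z‖ R) := by
      rcases lt_or_gt_of_ne hz with h3 | h3
      · rw [max_eq_right h3.le, (posLog_eq_zero_iff _).2, add_zero]
        rw [abs_of_nonneg (by positivity), inv_mul_le_iff₀ hR]
        linarith
      · rw [max_eq_left h3.le, posLog_eq_log, Real.log_mul (by positivity) (by linarith),
          Real.log_inv]
        · ring
        · rw [abs_of_nonneg (by positivity), ← div_eq_inv_mul, le_div_iff₀ hR]
          linarith
    rw [h2] at h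
    rw [← h]
    field_simp
  rw [meanK]
  linarith

lemma continuousOn_meanK {R : ℝ} (hR : 0 < R) : Continuous (meanK R) := by
  rw [continuous_iff_continuousAt]
  intro r
  have hm : max r R ≠ 0 := (lt_max_of_lt_right hR).ne'
  have h1 : ContinuousAt (fun r => max r R) r := by fun_prop
  have h2 : ContinuousAt (fun r => min r R) r := by fun_prop
  have h3 : ContinuousAt (fun r => gg (max r R)) r :=
    ContinuousAt.comp (f := fun r => max r R) (x := r) (g := gg)
      (hasDerivAt_gg hm).continuousAt h1
  have h4 : ContinuousAt (fun r => jj (min r R)) r :=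
    ContinuousAt.comp (f := fun r => min r R) (x := r) (g := jj)
      continuous_jj.continuousAt h2
  exact (h3.mul h4).sub (h1.log hm)

lemma integral_KK {R : ℝ} (hR : 0 < R) (z : ℂ) :
    ∫ ψ in (0 : ℝ)..(2 * π), KK ‖z - circleMap 0 R ψ‖ = 2 * π * meanK R ‖z‖ := by
  by_cases hz : ‖z‖ = R
  swap
  · exact integral_KK_of_ne hR hz
  have hz0 : z ≠ 0 := by
    rw [← norm_pos_iff, hz]; exact hR
  have c1 : Continuous fun t : ℝ => ∫ ψ in (0 : ℝ)..(2 * π), KK ‖(t : ℂ) * z - circleMap 0 R ψ‖ := by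
    refine intervalIntegral.continuous_parametric_intervalIntegral_of_continuous' ?_ _ _
    have := continuous_KK
    have := continuous_circleMap 0 R
    unfold uncurry
    fun_prop
  have c2 : Continuous fun t : ℝ => 2 * π * meanK R ‖(t : ℂ) * z‖ := by
    have := continuousOn_meanK hR
    fun_prop
  have h1 : (fun t : ℝ => ∫ ψ in (0 : ℝ)..(2 * π), KK ‖(t : ℂ) * z - circleMap 0 R ψ‖) =ᶠ[𝓝[>] 1]
      fun t : ℝ => 2 * π * meanK R ‖(t : ℂ) * z‖ := by
    filter_upwards [self_mem_nhdsWithin] with t ht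
    have ht : 1 < t := ht
    refine integral_KK_of_ne hR ?_
    rw [norm_mul, Complex.norm_real, Real.norm_eq_abs, abs_of_pos (by linarith), hz]
    nlinarith
  have t1 := (c1.tendsto 1).mono_left (nhdsWithin_le_nhds (s := Ioi 1))
  have t2 := (c2.tendsto 1).mono_left (nhdsWithin_le_nhds (s := Ioi 1))
  have := tendsto_nhds_unique (t1.congr' h1) t2
  simpa using this

/-- Uniform approximation of the superposition of logarithmic solutions. -/
lemma exists_sum_bound {R : ℝ} (hR : 0 < R) (R' : ℝ) : ∃ C, ∀ N : ℕ, 0 < N → ∀ z : ℂ, ‖z‖ ≤ R' →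
    z ^ N ≠ (R : ℂ) ^ N →
    |∑ j ∈ Finset.range N, ph (‖z - pt R N j‖ ^ 2) -
      (N * meanK R ‖z‖ + Real.log ‖z ^ N - (R : ℂ) ^ N‖)| ≤ C := by
  obtain ⟨L, hL0, hL⟩ := exists_lipschitz_KK (R' + R)
  refine ⟨2 * π * (L * R), fun N hN z hz hzN => ?_⟩
  have hmem : ∀ ψ, ‖z - circleMap 0 R ψ‖ ∈ Icc 0 (R' + R) := fun ψ => by
    refine ⟨norm_nonneg _, (norm_sub_le _ _).trans ?_⟩
    rw [norm_circleMap_zero, abs_of_pos hR]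
    linarith
  have hF : ∀ a b, |KK ‖z - circleMap 0 R a‖ - KK ‖z - circleMap 0 R b‖| ≤ L * R * |a - b| := by
    intro a b
    refine (hL _ (hmem a) _ (hmem b)).trans ?_
    rw [mul_assoc]
    refine mul_le_mul_of_nonneg_left ?_ hL0
    refine (abs_norm_sub_norm_le _ _).trans ?_
    rw [sub_sub_sub_cancel_left, norm_sub_rev]
    have := (lipschitzWith_circleMap 0 R).dist_le_mul a b
    rw [dist_eq_norm, Real.dist_eq] at this
    simpa [abs_of_pos hR] using this
  have h := riemann_sum_le (mul_nonneg hL0 hR.le) hF hN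
  rw [integral_KK hR] at h
  have e : ∑ j ∈ Finset.range N, ph (‖z - pt R N j‖ ^ 2) -
      (N * meanK R ‖z‖ + Real.log ‖z ^ N - (R : ℂ) ^ N‖) =
      ∑ j ∈ Finset.range N, KK ‖z - circleMap 0 R (2 * π * j / N)‖ -
        N / (2 * π) * (2 * π * meanK R ‖z‖) := by
    rw [log_norm_pow_sub hN hzN]
    simp only [ph_sq_eq, Finset.sum_add_distrib]
    change _ + ∑ j ∈ Finset.range N, KK ‖z - pt R N j‖ - _ =
      ∑ j ∈ Finset.range N, KK ‖z - pt R N j‖ - _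
    field_simp
    ring
  rw [e]
  exact h

/-- A function in polar coordinates together with its radial derivative `Hr` and the
tangential derivative `K`. -/
structure Polar (H Hr K : ℝ → ℝ → ℝ) : Prop where
  cont : Continuous (uncurry H)
  cont_r : Continuous (uncurry Hr)
  cont_t : Continuous (uncurry K)
  deriv_r : ∀ r θ, HasDerivAt (fun r => H r θ) (Hr r θ) r
  deriv_t : ∀ r θ, HasDerivAt (H r) (r * K r θ) θ
  periodic : ∀ r, H r π = H r (-π)

noncomputable def mean1 (H : ℝ → ℝ → ℝ) (r : ℝ) : ℝ := ∫ θ in (-π)..π, H r θ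

noncomputable def mean2 (H : ℝ → ℝ → ℝ) (r : ℝ) : ℝ := ∫ θ in (-π)..π, H r θ ^ 2

noncomputable def energy (H Hr K : ℝ → ℝ → ℝ) (r : ℝ) : ℝ :=
  ∫ θ in (-π)..π, r * (Hr r θ ^ 2 + K r θ ^ 2 - H r θ ^ 2)

lemma sq_integral_le {f : ℝ → ℝ} (hf : Continuous f) :
    (∫ θ in (-π)..π, f θ) ^ 2 ≤ 2 * π * ∫ θ in (-π)..π, f θ ^ 2 := by
  set I := ∫ θ in (-π)..π, f θ with hI
  have hpi := pi_pos
  have h : 0 ≤ ∫ θ in (-π)..π, (f θ - I / (2 * π)) ^ 2 :=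
    intervalIntegral.integral_nonneg (by linarith) fun θ _ => sq_nonneg _
  have e : ∫ θ in (-π)..π, (f θ - I / (2 * π)) ^ 2 =
      (∫ θ in (-π)..π, f θ ^ 2) - 2 * (I / (2 * π)) * I + (2 * π) * (I / (2 * π)) ^ 2 := by
    have : ∀ θ, (f θ - I / (2 * π)) ^ 2 =
      f θ ^ 2 - 2 * (I / (2 * π)) * f θ + (I / (2 * π)) ^ 2 := fun θ => by ring
    simp_rw [this]
    rw [intervalIntegral.integral_add, intervalIntegral.integral_sub,
      intervalIntegral.integral_const_mul, intervalIntegral.integral_const]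
    · simp only [smul_eq_mul]; ring
    all_goals exact Continuous.intervalIntegrable (by fun_prop) _ _
  rw [e] at h
  have h2 : (2 * π) * ((∫ θ in (-π)..π, f θ ^ 2) - 2 * (I / (2 * π)) * I
      + (2 * π) * (I / (2 * π)) ^ 2) = 2 * π * (∫ θ in (-π)..π, f θ ^ 2) - I ^ 2 := by
    field_simp
    ring
  have := mul_nonneg (by linarith : 0 ≤ 2 * π) h
  rw [h2] at this
  linarith

lemma sq_integral_le' {f : ℝ → ℝ} (hf : Continuous f) {a b : ℝ} (hab : a ≤ b) :
    (∫ θ in a..b, f θ) ^ 2 ≤ (b - a) * ∫ θ in a..b, f θ ^ 2 := by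
  rcases hab.eq_or_lt with rfl | hab
  · simp
  set I := ∫ θ in a..b, f θ with hI
  have hd : 0 < b - a := by linarith
  have h : 0 ≤ ∫ θ in a..b, (f θ - I / (b - a)) ^ 2 :=
    intervalIntegral.integral_nonneg (by linarith) fun θ _ => sq_nonneg _
  have e : ∫ θ in a..b, (f θ - I / (b - a)) ^ 2 =
      (∫ θ in a..b, f θ ^ 2) - 2 * (I / (b - a)) * I + (b - a) * (I / (b - a)) ^ 2 := by
    have : ∀ θ, (f θ - I / (b - a)) ^ 2 =
      f θ ^ 2 - 2 * (I / (b - a)) * f θ + (I / (b - a)) ^ 2 := fun θ => by ring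
    simp_rw [this]
    rw [intervalIntegral.integral_add, intervalIntegral.integral_sub,
      intervalIntegral.integral_const_mul, intervalIntegral.integral_const]
    · simp only [smul_eq_mul]; ring
    all_goals exact Continuous.intervalIntegrable (by fun_prop) _ _
  rw [e] at h
  have h2 : (b - a) * ((∫ θ in a..b, f θ ^ 2) - 2 * (I / (b - a)) * I
      + (b - a) * (I / (b - a)) ^ 2) = (b - a) * (∫ θ in a..b, f θ ^ 2) - I ^ 2 := by
    field_simp
    ring
  have := mul_nonneg hd.le h
  rw [h2] at this
  linarith

/-- A crude Poincaré inequality on the circle. -/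
lemma poincare {f f' : ℝ → ℝ} (hf' : Continuous f') (hd : ∀ θ, HasDerivAt f (f' θ) θ) :
    1 / (4 * π ^ 2) * ((∫ θ in (-π)..π, f θ ^ 2) - (∫ θ in (-π)..π, f θ) ^ 2 / (2 * π)) ≤
      ∫ θ in (-π)..π, f' θ ^ 2 := by
  have hpi := pi_pos
  have hf : Continuous f := continuous_iff_continuousAt.2 fun θ => (hd θ).continuousAt
  set D := ∫ θ in (-π)..π, f' θ ^ 2 with hD
  set c := f (-π)
  have hp : ∀ θ ∈ Icc (-π) π, (f θ - c) ^ 2 ≤ 2 * π * D := fun θ hθ => by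
    have e : f θ - c = ∫ x in (-π)..θ, f' x :=
      (intervalIntegral.integral_eq_sub_of_hasDerivAt (fun x _ => hd x)
        (hf'.intervalIntegrable _ _)).symm
    rw [e]
    refine (sq_integral_le' hf' hθ.1).trans ?_
    have h0 : 0 ≤ ∫ x in (-π)..θ, f' x ^ 2 :=
      intervalIntegral.integral_nonneg hθ.1 fun x _ => sq_nonneg _
    have h1 : ∫ x in (-π)..θ, f' x ^ 2 ≤ D := by
      refine intervalIntegral.integral_mono_interval le_rfl hθ.1 hθ.2
        (Eventually.of_forall fun x => sq_nonneg _) ?_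
      exact Continuous.intervalIntegrable (by fun_prop) _ _
    have := hθ.2
    exact mul_le_mul (by linarith) h1 h0 (by linarith)
  have hI : ∫ θ in (-π)..π, (f θ - c) ^ 2 ≤ 4 * π ^ 2 * D := by
    have := intervalIntegral.integral_mono_on (μ := volume) (by linarith : -π ≤ π)
      (Continuous.intervalIntegrable (by fun_prop : Continuous fun θ => (f θ - c) ^ 2) _ _)
      (intervalIntegrable_const) hp
    rw [intervalIntegral.integral_const, smul_eq_mul] at this
    linarith
  have h2 := sq_integral_le (f := fun θ => f θ - c) (by fun_prop)
  have e1 : ∫ θ in (-π)..π, (f θ - c) = (∫ θ in (-π)..π, f θ) - 2 * π * c := by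
    rw [intervalIntegral.integral_sub (hf.intervalIntegrable _ _) intervalIntegrable_const,
      intervalIntegral.integral_const, smul_eq_mul]
    ring
  have e2 : ∫ θ in (-π)..π, (f θ - c) ^ 2 =
      (∫ θ in (-π)..π, f θ ^ 2) - 2 * c * (∫ θ in (-π)..π, f θ) + 2 * π * c ^ 2 := by
    have : ∀ θ, (f θ - c) ^ 2 = f θ ^ 2 - 2 * c * f θ + c ^ 2 := fun θ => by ring
    simp_rw [this]
    rw [intervalIntegral.integral_add, intervalIntegral.integral_sub,
      intervalIntegral.integral_const_mul, intervalIntegral.integral_const]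
    · simp only [smul_eq_mul]; ring
    all_goals exact Continuous.intervalIntegrable (by fun_prop) _ _
  set I1 := ∫ θ in (-π)..π, f θ
  set I2 := ∫ θ in (-π)..π, f θ ^ 2
  have e3 : I2 - I1 ^ 2 / (2 * π) ≤ 4 * π ^ 2 * D := by
    have : I1 ^ 2 / (2 * π) = 2 * c * I1 - 2 * π * c ^ 2 + (I1 - 2 * π * c) ^ 2 / (2 * π) := by
      field_simp; ring
    have : 0 ≤ (I1 - 2 * π * c) ^ 2 / (2 * π) := by positivity
    linarith
  rw [one_div, inv_mul_le_iff₀ (by positivity)]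
  exact e3

variable {H Hr K : ℝ → ℝ → ℝ}

lemma Polar.continuous_slice (hP : Polar H Hr K) (r : ℝ) : Continuous (H r) :=
  hP.cont.comp (by fun_prop : Continuous fun θ => (r, θ))

lemma Polar.continuous_slice_r (hP : Polar H Hr K) (r : ℝ) : Continuous (Hr r) :=
  hP.cont_r.comp (by fun_prop : Continuous fun θ => (r, θ))

lemma Polar.continuous_slice_t (hP : Polar H Hr K) (r : ℝ) : Continuous (K r) :=
  hP.cont_t.comp (by fun_prop : Continuous fun θ => (r, θ))

lemma Polar.hasDerivAt_mean1 (hP : Polar H Hr K) (r : ℝ) :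
    HasDerivAt (mean1 H) (∫ θ in (-π)..π, Hr r θ) r :=
  hasDerivAt_param isOpen_univ hP.cont.continuousOn hP.cont_r.continuousOn
    (fun r _ θ => hP.deriv_r r θ) (mem_univ r) _ _

lemma Polar.hasDerivAt_mean2 (hP : Polar H Hr K) (r : ℝ) :
    HasDerivAt (mean2 H) (2 * ∫ θ in (-π)..π, H r θ * Hr r θ) r := by
  have h1 := hP.cont
  have h2 := hP.cont_r
  rw [← intervalIntegral.integral_const_mul]
  refine hasDerivAt_param (F := fun r θ => H r θ ^ 2) (F' := fun r θ => 2 * (H r θ * Hr r θ))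
    isOpen_univ ?_ ?_
    (fun r _ θ => ?_) (mem_univ r) _ _
  · exact (h1.pow 2).continuousOn
  · exact (continuous_const.mul (h1.mul h2)).continuousOn
  · refine ((hP.deriv_r r θ).pow 2).congr_deriv ?_
    push_cast
    ring

lemma Polar.continuous_energy (hP : Polar H Hr K) : Continuous (energy H Hr K) := by
  have h1 := hP.cont
  have h2 := hP.cont_r
  have h3 := hP.cont_t
  rw [continuous_iff_continuousAt]
  refine fun r => continuousAt_param isOpen_univ (Continuous.continuousOn ?_) (mem_univ r) _ _
  unfold uncurry at *
  fun_prop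

/-- The energy of a slice dominates the derivative of a quadratic form in the slice when the
weights are Riccati subsolutions. -/
lemma Polar.slice (hP : Polar H Hr K) {r w0 w1 w0' w1' : ℝ} (hr : 0 < r)
    (h0 : r * w0' + w0 ^ 2 + r ^ 2 ≤ 0) (h1 : r * w1' + w1 ^ 2 + r ^ 2 ≤ 1 / (4 * π ^ 2)) :
    w1' * (mean2 H r - mean1 H r ^ 2 / (2 * π)) +
      w1 * (2 * (∫ θ in (-π)..π, H r θ * Hr r θ) -
        2 * mean1 H r * (∫ θ in (-π)..π, Hr r θ) / (2 * π)) +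
      (w0' * (mean1 H r ^ 2 / (2 * π)) +
        w0 * (2 * mean1 H r * (∫ θ in (-π)..π, Hr r θ) / (2 * π))) ≤ energy H Hr K r := by
  have hpi := pi_pos
  have c1 := hP.continuous_slice r
  have c2 := hP.continuous_slice_r r
  have c3 := hP.continuous_slice_t r
  have key := sq_integral_le (f := fun θ => r * Hr r θ - w1 * H r θ) (by fun_prop)
  have e1 : ∫ θ in (-π)..π, (r * Hr r θ - w1 * H r θ) =
      r * (∫ θ in (-π)..π, Hr r θ) - w1 * mean1 H r := by
    rw [intervalIntegral.integral_sub, intervalIntegral.integral_const_mul,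
      intervalIntegral.integral_const_mul, mean1]
    all_goals exact Continuous.intervalIntegrable (by fun_prop) _ _
  have e2 : ∫ θ in (-π)..π, (r * Hr r θ - w1 * H r θ) ^ 2 =
      r ^ 2 * (∫ θ in (-π)..π, Hr r θ ^ 2) -
        2 * r * w1 * (∫ θ in (-π)..π, H r θ * Hr r θ) + w1 ^ 2 * mean2 H r := by
    have : ∀ θ, (r * Hr r θ - w1 * H r θ) ^ 2 =
      r ^ 2 * Hr r θ ^ 2 - 2 * r * w1 * (H r θ * Hr r θ) + w1 ^ 2 * H r θ ^ 2 := fun θ => by ring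
    simp_rw [this]
    rw [intervalIntegral.integral_add, intervalIntegral.integral_sub,
      intervalIntegral.integral_const_mul, intervalIntegral.integral_const_mul,
      intervalIntegral.integral_const_mul, mean2]
    all_goals exact Continuous.intervalIntegrable (by fun_prop) _ _
  have e3 : energy H Hr K r = r * ((∫ θ in (-π)..π, Hr r θ ^ 2) +
      (∫ θ in (-π)..π, K r θ ^ 2) - mean2 H r) := by
    rw [energy, intervalIntegral.integral_const_mul, intervalIntegral.integral_sub,
      intervalIntegral.integral_add, mean2]
    all_goals exact Continuous.intervalIntegrable (by fun_prop) _ _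
  have p := poincare (f := H r) (f' := fun θ => r * K r θ) (by fun_prop) (hP.deriv_t r)
  have e4 : ∫ θ in (-π)..π, (r * K r θ) ^ 2 = r ^ 2 * ∫ θ in (-π)..π, K r θ ^ 2 := by
    rw [← intervalIntegral.integral_const_mul]
    simp_rw [mul_pow]
  have v : 0 ≤ mean2 H r - mean1 H r ^ 2 / (2 * π) := by
    have := sq_integral_le c1
    rw [sub_nonneg, div_le_iff₀ (by positivity)]
    simp only [mean1, mean2]
    linarith
  rw [e4] at p
  change 1 / (4 * π ^ 2) * (mean2 H r - mean1 H r ^ 2 / (2 * π)) ≤ _ at p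
  rw [e1, e2] at key
  rw [e3]
  set B := ∫ θ in (-π)..π, Hr r θ
  set D := ∫ θ in (-π)..π, Hr r θ ^ 2
  set M := ∫ θ in (-π)..π, H r θ * Hr r θ
  set T := ∫ θ in (-π)..π, K r θ ^ 2
  set a1 := mean1 H r
  set a2 := mean2 H r
  set κ := 1 / (4 * π ^ 2)
  have h2pi : (2 * π) ≠ 0 := by positivity
  obtain ⟨q, hq⟩ : ∃ q, q = 1 / (2 * π) := ⟨_, rfl⟩
  have hq0 : 0 < q := by rw [hq]; positivity
  have key' : (r * B - w1 * a1) ^ 2 * q ≤ r ^ 2 * D - 2 * r * w1 * M + w1 ^ 2 * a2 := by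
    rw [hq, mul_one_div, div_le_iff₀ (by positivity)]
    linarith
  simp only [div_eq_mul_inv] at v p ⊢
  rw [← one_div, ← hq] at *
  have n0 : 0 ≤ (r * B - w0 * a1) ^ 2 * q := by positivity
  have m1 := mul_le_mul_of_nonneg_right h1 v
  have m0 := mul_le_mul_of_nonneg_right h0 (by positivity : 0 ≤ a1 ^ 2 * q)
  refine le_of_mul_le_mul_left ?_ hr
  nlinarith

noncomputable def form (H : ℝ → ℝ → ℝ) (w1 w0 : ℝ → ℝ) (r : ℝ) : ℝ :=
  w1 r * (mean2 H r - mean1 H r ^ 2 / (2 * π)) + w0 r * (mean1 H r ^ 2 / (2 * π))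

lemma Ricc.mono {κ a b a' b' : ℝ} {w : ℝ → ℝ} (h : Ricc κ w a b) (ha : a ≤ a') (hb : b' ≤ b) :
    Ricc κ w a' b' := by
  obtain ⟨h1, w', h2⟩ := h
  exact ⟨h1.mono (Icc_subset_Icc ha hb), w', fun r hr => h2 r ⟨ha.trans_lt hr.1, hr.2.trans_le hb⟩⟩

lemma Polar.form_sub_le (hP : Polar H Hr K) {a b : ℝ} (ha : 0 ≤ a) (hab : a ≤ b) {w1 w0 : ℝ → ℝ}
    (h1 : Ricc (1 / (4 * π ^ 2)) w1 a b) (h0 : Ricc 0 w0 a b) :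
    form H w1 w0 b - form H w1 w0 a ≤ ∫ r in a..b, energy H Hr K r := by
  obtain ⟨c1, w1', d1⟩ := h1
  obtain ⟨c0, w0', d0⟩ := h0
  have m1 : Continuous (mean1 H) :=
    continuous_iff_continuousAt.2 fun r => (hP.hasDerivAt_mean1 r).continuousAt
  have m2 : Continuous (mean2 H) :=
    continuous_iff_continuousAt.2 fun r => (hP.hasDerivAt_mean2 r).continuousAt
  refine intervalIntegral.sub_le_integral_of_hasDeriv_right_of_le hab ?_ (fun r hr => ?_)
    hP.continuous_energy.continuousOn.integrableOn_Icc (fun r hr => hP.slice (ha.trans_lt hr.1)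
      (d0 r hr).2 (d1 r hr).2)
  · unfold form
    fun_prop
  · have q1 := ((hP.hasDerivAt_mean1 r).pow 2).div_const (2 * π)
    have q2 := ((d1 r hr).1.mul ((hP.hasDerivAt_mean2 r).sub q1)).add ((d0 r hr).1.mul q1)
    refine (HasDerivAt.congr_deriv q2 ?_).hasDerivWithinAt
    simp only [Pi.sub_apply, Pi.pow_apply]
    push_cast
    ring

variable {H Hr K : ℝ → ℝ → ℝ}

/-- Completing squares against a two-dimensional Riccati subsolution which is only defined near
the support of `H`. -/
lemma Polar.shell (hP : Polar H Hr K) {a b : ℝ} (ha : 0 < a) (hab : a ≤ b)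
    {F G F' G' : ℝ → ℝ → ℝ} {O : Set (ℝ × ℝ)} {U : Set ℝ} (hU : IsOpen U) (hUI : Icc a b ⊆ U)
    (cF : ∀ p ∈ O, ContinuousAt (uncurry F) p) (cF' : ∀ p ∈ O, ContinuousAt (uncurry F') p)
    (cG : ∀ p ∈ O, ContinuousAt (uncurry G) p) (cG' : ∀ p ∈ O, ContinuousAt (uncurry G') p)
    (dF : ∀ r θ, (r, θ) ∈ O → HasDerivAt (fun r => F r θ) (F' r θ) r)
    (dG : ∀ r θ, (r, θ) ∈ O → HasDerivAt (G r) (G' r θ) θ)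
    (per : ∀ r, G r π = G r (-π))
    (hO : ∀ r ∈ U, ∀ θ, (r, θ) ∈ O ∨ ∀ᶠ q in 𝓝 (r, θ), uncurry H q = 0)
    (hF : ∀ r ∈ Ioo a b, ∀ θ, (r, θ) ∈ O →
      r * F' r θ + F r θ ^ 2 + G' r θ + G r θ ^ 2 ≤ -r ^ 2)
    {c : ℝ} (hFa : ∀ θ, (a, θ) ∈ O → F a θ ≤ -c) (hFb : ∀ θ, (b, θ) ∈ O → c ≤ F b θ) :
    c * (mean2 H a + mean2 H b) ≤ ∫ r in a..b, energy H Hr K r := by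
  have hpi := pi_pos
  have cH := hP.cont
  have cHr := hP.cont_r
  have cK := hP.cont_t
  have c0 : ContinuousOn (uncurry fun r θ => F r θ * H r θ ^ 2) (U ×ˢ univ) := by
    rintro ⟨r, θ⟩ ⟨hr, -⟩
    refine ContinuousAt.continuousWithinAt ?_
    rcases hO r hr θ with h | h
    · exact (cF _ h).mul (cH.continuousAt.pow 2)
    · refine (continuousAt_const (y := (0 : ℝ))).congr ?_
      filter_upwards [h] with q hq
      have hq : H q.1 q.2 = 0 := hq
      simp [uncurry, hq]
  have c1 : ContinuousOn (uncurry fun r θ => F' r θ * H r θ ^ 2 + F r θ * (2 * H r θ * Hr r θ))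
      (U ×ˢ univ) := by
    rintro ⟨r, θ⟩ ⟨hr, -⟩
    refine ContinuousAt.continuousWithinAt ?_
    rcases hO r hr θ with h | h
    · exact ((cF' _ h).mul (cH.continuousAt.pow 2)).add
        ((cF _ h).mul ((continuousAt_const.mul cH.continuousAt).mul cHr.continuousAt))
    · refine (continuousAt_const (y := (0 : ℝ))).congr ?_
      filter_upwards [h] with q hq
      have hq : H q.1 q.2 = 0 := hq
      simp [uncurry, hq]
  have c2 : ContinuousOn (uncurry fun r θ => G' r θ * H r θ ^ 2 + G r θ * (2 * H r θ * (r * K r θ)))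
      (U ×ˢ univ) := by
    rintro ⟨r, θ⟩ ⟨hr, -⟩
    refine ContinuousAt.continuousWithinAt ?_
    rcases hO r hr θ with h | h
    · exact ((cG' _ h).mul (cH.continuousAt.pow 2)).add
        ((cG _ h).mul ((continuousAt_const.mul cH.continuousAt).mul
          (continuousAt_fst.mul cK.continuousAt)))
    · refine (continuousAt_const (y := (0 : ℝ))).congr ?_
      filter_upwards [h] with q hq
      have hq : H q.1 q.2 = 0 := hq
      simp [uncurry, hq]
  have d0 : ∀ r ∈ U, ∀ θ, HasDerivAt (fun r => F r θ * H r θ ^ 2)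
      (F' r θ * H r θ ^ 2 + F r θ * (2 * H r θ * Hr r θ)) r := by
    intro r hr θ
    rcases hO r hr θ with h | h
    · refine ((dF r θ h).mul ((hP.deriv_r r θ).pow 2)).congr_deriv ?_
      simp
    · have h' : ∀ᶠ x in 𝓝 r, H x θ = 0 :=
        (by fun_prop : ContinuousAt (fun x : ℝ => (x, θ)) r).eventually h
      have h2 : H r θ = 0 := h'.self_of_nhds
      rw [h2]
      simp only [ne_eq, OfNat.ofNat_ne_zero, not_false_eq_true, zero_pow, mul_zero, zero_mul,
        add_zero]
      refine (hasDerivAt_const r (0 : ℝ)).congr_of_eventuallyEq ?_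
      filter_upwards [h'] with x hx
      simp [hx]
  have d1 : ∀ r ∈ U, ∀ θ, HasDerivAt (fun θ => G r θ * H r θ ^ 2)
      (G' r θ * H r θ ^ 2 + G r θ * (2 * H r θ * (r * K r θ))) θ := by
    intro r hr θ
    rcases hO r hr θ with h | h
    · refine ((dG r θ h).mul ((hP.deriv_t r θ).pow 2)).congr_deriv ?_
      simp
    · have h' : ∀ᶠ x in 𝓝 θ, H r x = 0 :=
        (by fun_prop : ContinuousAt (fun x : ℝ => (r, x)) θ).eventually h
      have h2 : H r θ = 0 := h'.self_of_nhds
      rw [h2]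
      simp only [ne_eq, OfNat.ofNat_ne_zero, not_false_eq_true, zero_pow, mul_zero, zero_mul,
        add_zero]
      refine (hasDerivAt_const θ (0 : ℝ)).congr_of_eventuallyEq ?_
      filter_upwards [h'] with x hx
      simp [hx]
  have dm : ∀ r ∈ U, HasDerivAt (fun r => ∫ θ in (-π)..π, F r θ * H r θ ^ 2)
      (∫ θ in (-π)..π, (F' r θ * H r θ ^ 2 + F r θ * (2 * H r θ * Hr r θ))) r :=
    fun r hr => hasDerivAt_param (F := fun r θ => F r θ * H r θ ^ 2)
      (F' := fun r θ => F' r θ * H r θ ^ 2 + F r θ * (2 * H r θ * Hr r θ)) hU c0 c1 d0 hr _ _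
  have haU : a ∈ U := hUI (left_mem_Icc.2 hab)
  have hbU : b ∈ U := hUI (right_mem_Icc.2 hab)
  have ca := Payne.continuous_slice (F := fun r θ => F r θ * H r θ ^ 2) c0 haU
  have cb := Payne.continuous_slice (F := fun r θ => F r θ * H r θ ^ 2) c0 hbU
  have cHa := hP.continuous_slice a
  have cHb := hP.continuous_slice b
  have ea : ∫ θ in (-π)..π, F a θ * H a θ ^ 2 ≤ -c * mean2 H a := by
    rw [mean2, ← intervalIntegral.integral_const_mul]
    refine intervalIntegral.integral_mono_on (by linarith)
      (Continuous.intervalIntegrable (by fun_prop) _ _)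
      (Continuous.intervalIntegrable (by fun_prop) _ _) fun θ _ => ?_
    rcases hO a haU θ with h | h
    · exact mul_le_mul_of_nonneg_right (hFa θ h) (sq_nonneg _)
    · have h2 : H a θ = 0 := h.self_of_nhds
      simp [h2]
  have eb : c * mean2 H b ≤ ∫ θ in (-π)..π, F b θ * H b θ ^ 2 := by
    rw [mean2, ← intervalIntegral.integral_const_mul]
    refine intervalIntegral.integral_mono_on (by linarith)
      (Continuous.intervalIntegrable (by fun_prop) _ _)
      (Continuous.intervalIntegrable (by fun_prop) _ _) fun θ _ => ?_
    rcases hO b hbU θ with h | h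
    · exact mul_le_mul_of_nonneg_right (hFb θ h) (sq_nonneg _)
    · have h2 : H b θ = 0 := h.self_of_nhds
      simp [h2]
  suffices (∫ θ in (-π)..π, F b θ * H b θ ^ 2) - (∫ θ in (-π)..π, F a θ * H a θ ^ 2) ≤
      ∫ r in a..b, energy H Hr K r by linarith
  refine intervalIntegral.sub_le_integral_of_hasDeriv_right_of_le hab
    (fun r hr => (dm r (hUI hr)).continuousAt.continuousWithinAt)
    (fun r hr => (dm r (hUI (Ioo_subset_Icc_self hr))).hasDerivWithinAt)
    hP.continuous_energy.continuousOn.integrableOn_Icc (fun r hr => ?_)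
  have hrU := hUI (Ioo_subset_Icc_self hr)
  have hr0 : 0 < r := ha.trans hr.1
  have s1 : Continuous fun θ => F' r θ * H r θ ^ 2 + F r θ * (2 * H r θ * Hr r θ) :=
    Payne.continuous_slice c1 hrU
  have s2 : Continuous fun θ => G' r θ * H r θ ^ 2 + G r θ * (2 * H r θ * (r * K r θ)) :=
    Payne.continuous_slice c2 hrU
  have z : ∫ θ in (-π)..π, (G' r θ * H r θ ^ 2 + G r θ * (2 * H r θ * (r * K r θ))) = 0 := by
    rw [intervalIntegral.integral_eq_sub_of_hasDerivAt (fun θ _ => d1 r hrU θ)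
      (s2.intervalIntegrable _ _), per, hP.periodic, sub_self]
  have t1 := hP.continuous_slice r
  have t2 := hP.continuous_slice_r r
  have t3 := hP.continuous_slice_t r
  have main : ∫ θ in (-π)..π, (r * (F' r θ * H r θ ^ 2 + F r θ * (2 * H r θ * Hr r θ)) +
      (G' r θ * H r θ ^ 2 + G r θ * (2 * H r θ * (r * K r θ)))) ≤
      ∫ θ in (-π)..π, r * (r * (Hr r θ ^ 2 + K r θ ^ 2 - H r θ ^ 2)) := by
    refine intervalIntegral.integral_mono_on (by linarith)
      (Continuous.intervalIntegrable (by fun_prop) _ _)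
      (Continuous.intervalIntegrable (by fun_prop) _ _) fun θ _ => ?_
    rcases hO r hrU θ with h | h
    · have := mul_le_mul_of_nonneg_right (hF r hr θ h) (sq_nonneg (H r θ))
      nlinarith [sq_nonneg (r * Hr r θ - F r θ * H r θ), sq_nonneg (r * K r θ - G r θ * H r θ)]
    · have h2 : H r θ = 0 := h.self_of_nhds
      rw [h2]
      have : 0 ≤ r * (r * (Hr r θ ^ 2 + K r θ ^ 2)) := by positivity
      simpa using this
  rw [intervalIntegral.integral_add (Continuous.intervalIntegrable (by fun_prop) _ _)
    (Continuous.intervalIntegrable (by fun_prop) _ _), z, add_zero,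
    intervalIntegral.integral_const_mul, intervalIntegral.integral_const_mul] at main
  exact le_of_mul_le_mul_left main hr0

lemma form_nonneg_aux (hP : Polar H Hr K) (r : ℝ) :
    0 ≤ mean2 H r - mean1 H r ^ 2 / (2 * π) := by
  have hpi := pi_pos
  have := sq_integral_le (hP.continuous_slice r)
  rw [sub_nonneg, div_le_iff₀ (by positivity)]
  simp only [mean1, mean2]
  linarith

/-- Combination of the Riccati estimates on the regular annuli with an estimate on a thin shell. -/
lemma Polar.energy_nonneg (hP : Polar H Hr K) (d : Data (1 / (4 * π ^ 2))) {a b : ℝ}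
    (ha : a ∈ Icc d.r1 d.R) (hb : b ∈ Icc d.R d.r2) (h1 : mean1 H d.r1 = 0)
    (h2 : mean1 H d.r2 = 0) (h3 : ∀ θ, H d.R3 θ = 0)
    (hs : d.b0 * (mean2 H a + mean2 H b) ≤ ∫ r in a..b, energy H Hr K r) :
    0 ≤ ∫ r in (0 : ℝ)..d.R3, energy H Hr K r := by
  have hpi := pi_pos
  have i1 := d.r1_pos
  have i2 := d.r1_lt
  have i3 := d.s_lt
  have i4 := d.R_lt
  have i5 := d.r2_lt
  obtain ⟨ha1, ha2⟩ := ha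
  obtain ⟨hb1, hb2⟩ := hb
  have A := hP.form_sub_le le_rfl i1.le (d.ricc_zA.mono le_rfl (by linarith)) d.ricc_wA
  have B := hP.form_sub_le i1.le ha1 (d.ricc_zA.mono i1.le ha2) (d.ricc_wB.mono le_rfl ha2)
  have C := hP.form_sub_le (by linarith) hb2 (d.ricc_zC.mono hb1 i5.le) (d.ricc_wC.mono hb1 le_rfl)
  have D := hP.form_sub_le (by linarith) i5.le (d.ricc_zC.mono i4.le le_rfl) d.ricc_wD
  have hm3 : mean2 H d.R3 = 0 := by simp [mean2, h3]
  have hm3' : mean1 H d.R3 = 0 := by simp [mean1, h3]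
  have va := form_nonneg_aux hP a
  have vb := form_nonneg_aux hP b
  have ua : 0 ≤ mean1 H a ^ 2 / (2 * π) := by positivity
  have ub : 0 ≤ mean1 H b ^ 2 / (2 * π) := by positivity
  have pa := mul_le_mul_of_nonneg_right (d.le_zA a ⟨ha1, ha2⟩) va
  have pa' := mul_le_mul_of_nonneg_right (d.le_wB a ⟨ha1, ha2⟩) ua
  have pb := mul_le_mul_of_nonneg_right (d.zC_le b ⟨hb1, hb2⟩) vb
  have pb' := mul_le_mul_of_nonneg_right (d.wC_le b ⟨hb1, hb2⟩) ub
  simp only [form, h1, h2, hm3, hm3', d.wA_zero, d.zA_zero] at A B C D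
  have ii : ∀ x y, IntervalIntegrable (energy H Hr K) volume x y :=
    fun x y => hP.continuous_energy.intervalIntegrable x y
  rw [← intervalIntegral.integral_add_adjacent_intervals (ii 0 d.r1) (ii d.r1 d.R3),
    ← intervalIntegral.integral_add_adjacent_intervals (ii d.r1 a) (ii a d.R3),
    ← intervalIntegral.integral_add_adjacent_intervals (ii a b) (ii b d.R3),
    ← intervalIntegral.integral_add_adjacent_intervals (ii b d.r2) (ii d.r2 d.R3)]
  simp only [ne_eq, OfNat.ofNat_ne_zero, not_false_eq_true, zero_pow, zero_div, mul_zero,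
    zero_mul, add_zero, sub_zero, sub_self] at A B C D
  linarith

noncomputable def EE (R N r θ : ℝ) : ℝ := 2 * cosh (N * Real.log (r / R)) - 2 * cos (N * θ)

noncomputable def VV (R N A k r θ : ℝ) : ℝ :=
  Real.log (EE R N r θ) / 2 + A - k * Real.log (r / R) ^ 2

lemma hasDerivAt_logdiv {R r : ℝ} (hR : 0 < R) (hr : 0 < r) :
    HasDerivAt (fun r => Real.log (r / R)) r⁻¹ r := by
  refine (((hasDerivAt_id r).div_const R).log (by simp only [id]; positivity)).congr_deriv ?_
  simp only [id]
  field_simp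

lemma hasDerivAt_EE_r {R N r : ℝ} (θ : ℝ) (hR : 0 < R) (hr : 0 < r) :
    HasDerivAt (fun r => EE R N r θ) (2 * N * sinh (N * Real.log (r / R)) / r) r := by
  refine ((((hasDerivAt_logdiv hR hr).const_mul N).cosh.const_mul 2).sub_const _).congr_deriv ?_
  field_simp

lemma hasDerivAt_EE_t (R N r θ : ℝ) :
    HasDerivAt (EE R N r) (2 * N * sin (N * θ)) θ := by
  refine (((((hasDerivAt_id θ).const_mul N).cos).const_mul 2).const_sub _).congr_deriv ?_
  simp only [id]
  ring

lemma hasDerivAt_VV_r {R N A k r θ : ℝ} (hR : 0 < R) (hr : 0 < r) (hE : 0 < EE R N r θ) :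
    HasDerivAt (fun r => VV R N A k r θ) ((N * sinh (N * Real.log (r / R)) / EE R N r θ -
      2 * k * Real.log (r / R)) / r) r := by
  refine (((((hasDerivAt_EE_r θ hR hr).log hE.ne').div_const 2).add_const A).sub
    (((hasDerivAt_logdiv hR hr).pow 2).const_mul k)).congr_deriv ?_
  push_cast
  field_simp

lemma hasDerivAt_VV_t {R N A k r θ : ℝ} (hE : 0 < EE R N r θ) :
    HasDerivAt (VV R N A k r) (N * sin (N * θ) / EE R N r θ) θ := by
  refine (((((hasDerivAt_EE_t R N r θ).log hE.ne').div_const 2).add_const A).sub_const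
    _).congr_deriv ?_
  field_simp

noncomputable def FF (R N A k r θ : ℝ) : ℝ :=
  (N * sinh (N * Real.log (r / R)) / EE R N r θ - 2 * k * Real.log (r / R)) / VV R N A k r θ

noncomputable def GG (R N A k r θ : ℝ) : ℝ := N * sin (N * θ) / EE R N r θ / VV R N A k r θ

noncomputable def FF' (R N A k r θ : ℝ) : ℝ :=
  ((N ^ 2 * (cosh (N * Real.log (r / R)) * EE R N r θ - 2 * sinh (N * Real.log (r / R)) ^ 2) /
    EE R N r θ ^ 2 - 2 * k) / VV R N A k r θ - FF R N A k r θ ^ 2) / r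

noncomputable def GG' (R N A k r θ : ℝ) : ℝ :=
  N ^ 2 * (cos (N * θ) * EE R N r θ - 2 * sin (N * θ) ^ 2) / EE R N r θ ^ 2 / VV R N A k r θ -
    GG R N A k r θ ^ 2

lemma hasDerivAt_FF {R N A k r θ : ℝ} (hR : 0 < R) (hr : 0 < r) (hE : 0 < EE R N r θ)
    (hV : 0 < VV R N A k r θ) :
    HasDerivAt (fun r => FF R N A k r θ) (FF' R N A k r θ) r := by
  have hL := hasDerivAt_logdiv hR hr
  refine HasDerivAt.congr_deriv ((((((hL.const_mul N).sinh).const_mul N).div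
    (hasDerivAt_EE_r θ hR hr) hE.ne').sub (hL.const_mul (2 * k))).div (hasDerivAt_VV_r hR hr hE)
    hV.ne') ?_
  unfold FF' FF
  simp only [Pi.sub_apply, Pi.div_apply]
  field_simp

lemma hasDerivAt_GG {R N A k r θ : ℝ} (hE : 0 < EE R N r θ) (hV : 0 < VV R N A k r θ) :
    HasDerivAt (GG R N A k r) (GG' R N A k r θ) θ := by
  refine HasDerivAt.congr_deriv ((((((hasDerivAt_id θ).const_mul N).sin).const_mul N).div
    (hasDerivAt_EE_t R N r θ) hE.ne').div (hasDerivAt_VV_t hE) hV.ne') ?_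
  unfold GG' GG
  simp only [Pi.div_apply, id]
  field_simp

lemma FF_GG {R N A k r θ : ℝ} (hr : 0 < r) (hE : 0 < EE R N r θ) (hV : 0 < VV R N A k r θ) :
    r * FF' R N A k r θ + FF R N A k r θ ^ 2 + GG' R N A k r θ + GG R N A k r θ ^ 2 =
      -(2 * k) / VV R N A k r θ := by
  have h : (cosh (N * Real.log (r / R)) * EE R N r θ - 2 * sinh (N * Real.log (r / R)) ^ 2) +
      (cos (N * θ) * EE R N r θ - 2 * sin (N * θ) ^ 2) = 0 := by
    have := cosh_sq (N * Real.log (r / R))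
    have := cos_sq' (N * θ)
    unfold EE
    nlinarith
  have h' : cosh (N * Real.log (r / R)) * EE R N r θ - 2 * sinh (N * Real.log (r / R)) ^ 2 =
      -(cos (N * θ) * EE R N r θ - 2 * sin (N * θ) ^ 2) := by linarith
  unfold FF' GG'
  rw [h']
  field_simp
  ring

lemma continuousAt_EE {R N : ℝ} (hR : 0 < R) {p : ℝ × ℝ} (hp : 0 < p.1) :
    ContinuousAt (fun p : ℝ × ℝ => EE R N p.1 p.2) p := by
  have : p.1 / R ≠ 0 := by positivity
  unfold EE
  fun_prop (disch := assumption)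

set_option maxHeartbeats 400000 in
lemma exists_shell {R R3 : ℝ} (hR : 0 < R) (hR3 : R < R3) (A0 b0 : ℝ) (hA0 : 0 ≤ A0) (hb0 : 0 ≤ b0) :
    ∃ N0 : ℝ, ∀ N : ℕ, N0 ≤ N → 0 < N ∧ ∀ H Hr K : ℝ → ℝ → ℝ, Polar H Hr K →
      (∀ r ∈ Ioo (R * rexp (-2 / N)) (R * rexp (2 / N)), ∀ θ, rexp (-2 * A0) < EE R N r θ ∨
        ∀ᶠ q in 𝓝 (r, θ), uncurry H q = 0) →
      b0 * (mean2 H (R * rexp (-1 / N)) + mean2 H (R * rexp (1 / N))) ≤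
        ∫ r in (R * rexp (-1 / N))..(R * rexp (1 / N)), energy H Hr K r := by
  obtain ⟨A, hA⟩ : ∃ A, A = A0 + 1 := ⟨_, rfl⟩
  obtain ⟨k, hk⟩ : ∃ k, k = R3 ^ 2 * (A + 1) / 2 := ⟨_, rfl⟩
  have hk0 : 0 < k := by rw [hk, hA]; have : 0 < R3 := hR.trans hR3; positivity
  have hlogR : 0 < Real.log (R3 / R) := Real.log_pos (by rwa [lt_div_iff₀ hR, one_mul])
  refine ⟨1 + 8 * k + 6 * (b0 * (A + 1) + 2 * k) + 1 / Real.log (R3 / R), fun N hN => ?_⟩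
  have p1 : 0 ≤ b0 * (A + 1) := by rw [hA]; positivity
  have p2 : 0 < 1 / Real.log (R3 / R) := by positivity
  have hN1 : (1 : ℝ) ≤ N := by linarith
  have hN8 : 8 * k ≤ N := by linarith
  have hN6 : 6 * (b0 * (A + 1) + 2 * k) ≤ N := by linarith
  have hNl : 1 / N ≤ Real.log (R3 / R) := by
    rw [div_le_iff₀ (by linarith), mul_comm, ← div_le_iff₀ hlogR]
    linarith
  have hN0 : (0 : ℝ) < N := by linarith
  refine ⟨by exact_mod_cast hN0, fun H Hr K hP hO => ?_⟩
  set n : ℝ := (N : ℝ)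
  have hlog : ∀ t, Real.log (R * rexp t / R) = t := fun t => by
    rw [mul_div_cancel_left₀ _ hR.ne', Real.log_exp]
  have hlt : ∀ r t, 0 < r → (Real.log (r / R) < t ↔ r < R * rexp t) := fun r t hr => by
    rw [Real.log_lt_iff_lt_exp (by positivity), div_lt_iff₀ hR, mul_comm]
  have hgt : ∀ r t, 0 < r → (t < Real.log (r / R) ↔ R * rexp t < r) := fun r t hr => by
    rw [Real.lt_log_iff_exp_lt (by positivity), lt_div_iff₀ hR, mul_comm]
  -- the region where the weight is regular
  let O : Set (ℝ × ℝ) := {p | p.1 ∈ Ioo (R * rexp (-2 / n)) (R * rexp (2 / n)) ∧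
    rexp (-2 * A0) < EE R n p.1 p.2}
  have pos : ∀ p ∈ O, 0 < p.1 := fun p hp => (by positivity : 0 < R * rexp (-2 / n)).trans hp.1.1
  have posE : ∀ p ∈ O, 0 < EE R n p.1 p.2 := fun p hp => (exp_pos _).trans hp.2
  have posV : ∀ p ∈ O, 0 < VV R n A k p.1 p.2 := fun p hp => by
    have h1 : -2 * A0 ≤ Real.log (EE R n p.1 p.2) :=
      (Real.le_log_iff_exp_le (posE p hp)).2 hp.2.le
    have h2 := (hlt p.1 _ (pos p hp)).2 hp.1.2
    have h3 := (hgt p.1 _ (pos p hp)).2 hp.1.1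
    have h4 : Real.log (p.1 / R) ^ 2 ≤ (2 / n) ^ 2 := by
      refine sq_le_sq' ?_ h2.le
      rw [neg_div] at h3
      exact h3.le
    have h5 : k * (2 / n) ^ 2 ≤ 1 / 2 := by
      rw [div_pow, mul_div_assoc', div_le_iff₀ (by positivity)]
      nlinarith
    have := mul_le_mul_of_nonneg_left h4 hk0.le
    unfold VV
    linarith
  have cE : ∀ p ∈ O, ContinuousAt (fun p : ℝ × ℝ => EE R n p.1 p.2) p :=
    fun p hp => continuousAt_EE hR (pos p hp)
  have cL : ∀ p ∈ O, ContinuousAt (fun p : ℝ × ℝ => Real.log (p.1 / R)) p := fun p hp => by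
    have : p.1 / R ≠ 0 := by have := pos p hp; positivity
    fun_prop (disch := assumption)
  have cV : ∀ p ∈ O, ContinuousAt (fun p : ℝ × ℝ => VV R n A k p.1 p.2) p := fun p hp => by
    have h1 := cE p hp
    have h2 := cL p hp
    have h3 := (posE p hp).ne'
    unfold VV
    fun_prop (disch := assumption)
  have cF : ∀ p ∈ O, ContinuousAt (fun p : ℝ × ℝ => FF R n A k p.1 p.2) p := fun p hp => by
    have h1 := cE p hp
    have h2 := cL p hp
    have h3 := (posE p hp).ne'
    have h4 := cV p hp
    have h5 := (posV p hp).ne'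
    unfold FF
    have e1 : ContinuousAt (fun p : ℝ × ℝ => sinh (n * Real.log (p.1 / R))) p :=
      continuous_sinh.continuousAt.comp (continuousAt_const.mul h2)
    fun_prop (disch := assumption)
  have cG : ∀ p ∈ O, ContinuousAt (fun p : ℝ × ℝ => GG R n A k p.1 p.2) p := fun p hp => by
    have h1 := cE p hp
    have h3 := (posE p hp).ne'
    have h4 := cV p hp
    have h5 := (posV p hp).ne'
    unfold GG
    fun_prop (disch := assumption)
  have cF' : ∀ p ∈ O, ContinuousAt (fun p : ℝ × ℝ => FF' R n A k p.1 p.2) p := fun p hp => by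
    have h1 := cE p hp
    have h2 := cL p hp
    have h3 := (posE p hp).ne'
    have h3' : EE R n p.1 p.2 ^ 2 ≠ 0 := pow_ne_zero 2 h3
    have h4 := cV p hp
    have h5 := (posV p hp).ne'
    have h6 := cF p hp
    have h7 := (pos p hp).ne'
    unfold FF'
    have e1 : ContinuousAt (fun p : ℝ × ℝ => sinh (n * Real.log (p.1 / R))) p :=
      continuous_sinh.continuousAt.comp (continuousAt_const.mul h2)
    have e2 : ContinuousAt (fun p : ℝ × ℝ => cosh (n * Real.log (p.1 / R))) p :=
      continuous_cosh.continuousAt.comp (continuousAt_const.mul h2)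
    fun_prop (disch := assumption)
  have cG' : ∀ p ∈ O, ContinuousAt (fun p : ℝ × ℝ => GG' R n A k p.1 p.2) p := fun p hp => by
    have h1 := cE p hp
    have h3 := (posE p hp).ne'
    have h3' : EE R n p.1 p.2 ^ 2 ≠ 0 := pow_ne_zero 2 h3
    have h4 := cV p hp
    have h5 := (posV p hp).ne'
    have h6 := cG p hp
    unfold GG'
    fun_prop (disch := assumption)
  -- bounds on the closed shell
  have cosh1 : cosh 1 ≤ 2 := by
    rw [cosh_eq]
    have h1 := exp_one_lt_d9
    have h2 : rexp (-1) ≤ 1 := exp_le_one_iff.2 (by norm_num)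
    linarith
  have E6 : ∀ r ∈ Icc (R * rexp (-1 / n)) (R * rexp (1 / n)), ∀ θ, EE R n r θ ≤ 6 := by
    intro r hr θ
    have hr0 : 0 < r := (by positivity : 0 < R * rexp (-1 / n)).trans_le hr.1
    have h1 : Real.log (r / R) ≤ 1 / n := by
      rw [Real.log_le_iff_le_exp (by positivity), div_le_iff₀ hR, mul_comm]; exact hr.2
    have h2 : -1 / n ≤ Real.log (r / R) := by
      rw [Real.le_log_iff_exp_le (by positivity), le_div_iff₀ hR, mul_comm]; exact hr.1
    rw [neg_div] at h2
    have h3 : |n * Real.log (r / R)| ≤ |1| := by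
      rw [abs_mul, abs_of_pos hN0, abs_one, mul_comm, ← le_div_iff₀ hN0]
      exact abs_le.2 ⟨h2, h1⟩
    have h4 := cosh_le_cosh.2 h3
    have h5 := neg_one_le_cos (n * θ)
    unfold EE
    linarith
  have V1 : ∀ r ∈ Icc (R * rexp (-1 / n)) (R * rexp (1 / n)), ∀ θ, (r, θ) ∈ O →
      VV R n A k r θ ≤ A + 1 := by
    intro r hr θ hp
    have h1 : Real.log (EE R n r θ) ≤ 2 := by
      rw [Real.log_le_iff_le_exp (posE _ hp)]
      refine (E6 r hr θ).trans ?_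
      have h1 := exp_one_gt_d9
      have h2 : rexp 2 = rexp 1 * rexp 1 := by rw [← Real.exp_add]; norm_num
      rw [h2]
      nlinarith
    have : 0 ≤ k * Real.log (r / R) ^ 2 := by positivity
    unfold VV
    linarith
  have sinh1 : 1 ≤ sinh 1 := self_le_sinh_iff.2 (by norm_num)
  have mono2 : (-2 : ℝ) / n < -1 / n := by gcongr; norm_num
  have mono3 : (1 : ℝ) / n < 2 / n := by gcongr; norm_num
  have mono1 : (-1 : ℝ) / n ≤ 1 / n := by gcongr; norm_num
  have num : ∀ E : ℝ, 0 < E → E ≤ 6 → b0 * (A + 1) ≤ n * sinh 1 / E - 2 * k * (1 / n) := by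
    intro E hE hE6
    have h1 : n / 6 ≤ n * sinh 1 / E := by
      gcongr
      nlinarith
    have h2 : 2 * k * (1 / n) ≤ 2 * k * 1 := by
      gcongr
      rw [div_le_one hN0]
      exact hN1
    linarith
  have dF : ∀ r θ, (r, θ) ∈ O →
      HasDerivAt (fun r => FF R n A k r θ) (FF' R n A k r θ) r :=
    fun r θ h => hasDerivAt_FF hR (pos (r, θ) h) (posE (r, θ) h) (posV (r, θ) h)
  have dG : ∀ r θ, (r, θ) ∈ O → HasDerivAt (GG R n A k r) (GG' R n A k r θ) θ :=
    fun r θ h => hasDerivAt_GG (posE (r, θ) h) (posV (r, θ) h)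
  have ha : 0 < R * rexp (-1 / n) := by positivity
  have hab : R * rexp (-1 / n) ≤ R * rexp (1 / n) := by gcongr
  have memO : ∀ r ∈ Ioo (R * rexp (-2 / n)) (R * rexp (2 / n)), ∀ θ,
      rexp (-2 * A0) < EE R n r θ → (r, θ) ∈ O := fun r hr θ h => ⟨hr, h⟩
  clear_value O
  refine hP.shell (F := FF R n A k) (G := GG R n A k) (F' := FF' R n A k) (G' := GG' R n A k)
    (O := O) (U := Ioo (R * rexp (-2 / n)) (R * rexp (2 / n))) ha hab isOpen_Ioo ?_ cF cF' cG cG'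
    dF dG ?_ ?_ ?_ ?_ ?_
  · intro r hr
    refine ⟨lt_of_lt_of_le ?_ hr.1, lt_of_le_of_lt hr.2 ?_⟩
    · gcongr
    · gcongr
  · intro r
    have e1 : sin (n * π) = 0 := sin_nat_mul_pi N
    have e2 : sin (n * -π) = 0 := by rw [mul_neg, sin_neg, e1, neg_zero]
    simp only [GG, e1, e2, mul_zero, zero_div]
  · intro r hr θ
    rcases hO r hr θ with h | h
    · exact Or.inl (memO r hr θ h)
    · exact Or.inr h
  · intro r hr θ h
    rw [FF_GG (pos (r, θ) h) (posE (r, θ) h) (posV (r, θ) h), neg_div, neg_le_neg_iff,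
      le_div_iff₀ (posV (r, θ) h)]
    have hr0 : 0 < r := pos (r, θ) h
    have hr3 : r ≤ R3 := by
      refine hr.2.le.trans ?_
      rw [mul_comm, ← le_div_iff₀ hR, ← Real.le_log_iff_exp_le (by
        have : 0 < R3 := hR.trans hR3
        positivity)]
      exact hNl
    have h1 : r ^ 2 ≤ R3 ^ 2 := pow_le_pow_left₀ hr0.le hr3 2
    have h2 := V1 r (Ioo_subset_Icc_self hr) θ h
    have h3 := mul_le_mul h1 h2 (posV (r, θ) h).le (by positivity)
    have e : 2 * k = R3 ^ 2 * (A + 1) := by rw [hk]; ring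
    rw [e]
    exact h3
  · intro θ h
    have hm : R * rexp (-1 / n) ∈ Icc (R * rexp (-1 / n)) (R * rexp (1 / n)) :=
      ⟨le_rfl, by gcongr⟩
    have h2 := num _ (posE _ h) (E6 _ hm θ)
    have h3 := mul_le_mul_of_nonneg_left (V1 _ hm θ h) hb0
    rw [FF, div_le_iff₀ (posV _ h), hlog, neg_div, mul_neg, mul_one_div_cancel hN0.ne', sinh_neg,
      mul_neg, neg_div]
    rw [neg_div] at h3 h2
    linarith
  · intro θ h
    have hm : R * rexp (1 / n) ∈ Icc (R * rexp (-1 / n)) (R * rexp (1 / n)) :=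
      ⟨by gcongr, le_rfl⟩
    have h2 := num _ (posE _ h) (E6 _ hm θ)
    have h3 := mul_le_mul_of_nonneg_left (V1 _ hm θ h) hb0
    rw [FF, le_div_iff₀ (posV _ h), hlog, mul_one_div_cancel hN0.ne']
    linarith

/-- The Euclidean plane. -/
abbrev Pl := EuclideanSpace ℝ (Fin 2)

/-- The point with polar coordinates `r`, `θ`. -/
noncomputable def pol (r θ : ℝ) : Pl := !₂[r * cos θ, r * sin θ]

/-- The integral of a function over a circle centred at the origin. -/
noncomputable def circ (ρ : ℝ) (h : Pl → ℝ) : ℝ := ∫ θ in (-π)..π, h (pol ρ θ)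

lemma vec_eq (a b : ℝ) : (!₂[a, b] : Pl) =
    a • EuclideanSpace.single 0 1 + b • EuclideanSpace.single 1 1 := by
  ext i
  fin_cases i <;> simp

lemma norm_vec_sq (a b : ℝ) : ‖(!₂[a, b] : Pl)‖ ^ 2 = a ^ 2 + b ^ 2 := by
  rw [EuclideanSpace.norm_sq_eq]
  simp

lemma norm_pol (r θ : ℝ) : ‖pol r θ‖ = |r| := by
  rw [← abs_norm, ← sq_eq_sq_iff_abs_eq_abs, pol, norm_vec_sq]
  linear_combination r ^ 2 * sin_sq_add_cos_sq θ

lemma continuous_pol : Continuous (uncurry pol) := by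
  unfold uncurry pol
  simp only [vec_eq]
  fun_prop

lemma hasDerivAt_pol_r (r θ : ℝ) : HasDerivAt (fun r => pol r θ) !₂[cos θ, sin θ] r := by
  unfold pol
  simp only [vec_eq]
  have := (((hasDerivAt_id r).mul_const (cos θ)).smul_const
    (EuclideanSpace.single 0 1 : Pl)).add
    (((hasDerivAt_id r).mul_const (sin θ)).smul_const (EuclideanSpace.single 1 1 : Pl))
  refine HasDerivAt.congr_deriv this ?_
  simp only [one_mul]

lemma hasDerivAt_pol_t (r θ : ℝ) : HasDerivAt (pol r) (r • !₂[-sin θ, cos θ]) θ := by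
  unfold pol
  simp only [vec_eq]
  have := (((hasDerivAt_cos θ).const_mul r).smul_const
    (EuclideanSpace.single 0 1 : Pl)).add
    (((hasDerivAt_sin θ).const_mul r).smul_const (EuclideanSpace.single 1 1 : Pl))
  refine HasDerivAt.congr_deriv this ?_
  simp only [smul_add, smul_smul]

lemma fderiv_vec (h : Pl → ℝ) (x : Pl) (a b : ℝ) : fderiv ℝ h x !₂[a, b] =
    a * fderiv ℝ h x (EuclideanSpace.single 0 1) + b * fderiv ℝ h x (EuclideanSpace.single 1 1) := by
  rw [vec_eq, map_add, map_smul, map_smul]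
  rfl

lemma norm_gradient_sq (h : Pl → ℝ) (x : Pl) : ‖gradient h x‖ ^ 2 =
    fderiv ℝ h x (EuclideanSpace.single 0 1) ^ 2 + fderiv ℝ h x (EuclideanSpace.single 1 1) ^ 2 := by
  have e : ∀ i, gradient h x i = fderiv ℝ h x (EuclideanSpace.single i 1) := fun i => by
    have := InnerProductSpace.toDual_symm_apply (𝕜 := ℝ) (x := (EuclideanSpace.single i 1 : Pl))
      (y := fderiv ℝ h x)
    rw [← this, EuclideanSpace.inner_single_right]
    simp [gradient]
  rw [EuclideanSpace.norm_sq_eq, Fin.sum_univ_two, e, e]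
  simp

lemma polar_of_contDiff {h : Pl → ℝ} (hh : ContDiff ℝ 1 h) :
    Polar (fun r θ => h (pol r θ)) (fun r θ => fderiv ℝ h (pol r θ) !₂[cos θ, sin θ])
      (fun r θ => fderiv ℝ h (pol r θ) !₂[-sin θ, cos θ]) := by
  have hd : Differentiable ℝ h := hh.differentiable one_ne_zero
  have hc : Continuous (fderiv ℝ h) := hh.continuous_fderiv one_ne_zero
  have c0 : Continuous fun x => fderiv ℝ h x (EuclideanSpace.single 0 1) := by fun_prop
  have c1 : Continuous fun x => fderiv ℝ h x (EuclideanSpace.single 1 1) := by fun_prop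
  refine ⟨hh.continuous.comp continuous_pol, ?_, ?_, fun r θ => ?_, fun r θ => ?_, fun r => ?_⟩
  · simp only [fderiv_vec]
    have d0 := c0.comp continuous_pol
    have d1 := c1.comp continuous_pol
    unfold uncurry comp at *
    fun_prop
  · simp only [fderiv_vec]
    have d0 := c0.comp continuous_pol
    have d1 := c1.comp continuous_pol
    unfold uncurry comp at *
    fun_prop
  · exact (hd (pol r θ)).hasFDerivAt.comp_hasDerivAt r (hasDerivAt_pol_r r θ)
  · refine ((hd (pol r θ)).hasFDerivAt.comp_hasDerivAt θ (hasDerivAt_pol_t r θ)).congr_deriv ?_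
    rw [map_smul, smul_eq_mul]
  · simp [pol]

lemma integral_plane (f : Pl → ℝ) : ∫ x, f x = ∫ p : ℝ × ℝ, f !₂[p.1, p.2] := by
  have m1 := EuclideanSpace.volume_preserving_symm_measurableEquiv_toLp (Fin 2)
  have m2 := MeasureTheory.volume_preserving_finTwoArrow ℝ
  rw [← m1.symm.integral_comp (MeasurableEquiv.measurableEmbedding _) f,
    ← m2.symm.integral_comp (MeasurableEquiv.measurableEmbedding _)]
  rfl

/-- Integration in polar coordinates of a function vanishing outside a disc. -/
lemma integral_polar {f : Pl → ℝ} (hf : Continuous f) {ρ : ℝ} (hρ : 0 ≤ ρ)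
    (h0 : ∀ x, ρ < ‖x‖ → f x = 0) :
    ∫ x, f x = ∫ r in (0 : ℝ)..ρ, ∫ θ in (-π)..π, r * f (pol r θ) := by
  have hpi := pi_pos
  have hc : Continuous fun p : ℝ × ℝ => p.1 * f (pol p.1 p.2) :=
    continuous_fst.mul (hf.comp continuous_pol)
  rw [integral_plane, ← integral_comp_polarCoord_symm, polarCoord_target]
  have e : ∀ p : ℝ × ℝ, p.1 • f !₂[(polarCoord.symm p).1, (polarCoord.symm p).2] =
    p.1 * f (pol p.1 p.2) := fun p => by simp [pol, polarCoord_symm_apply]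
  simp_rw [e]
  have e2 : ∫ p in Ioi (0 : ℝ) ×ˢ Ioo (-π) π, p.1 * f (pol p.1 p.2) =
      ∫ p in Ioc (0 : ℝ) ρ ×ˢ Ioc (-π) π, p.1 * f (pol p.1 p.2) := by
    have e3 : ∫ p in Ioi (0 : ℝ) ×ˢ Ioo (-π) π, p.1 * f (pol p.1 p.2) =
      ∫ p in Ioi (0 : ℝ) ×ˢ Ioc (-π) π, p.1 * f (pol p.1 p.2) := by
      refine setIntegral_congr_set ?_
      exact Measure.set_prod_ae_eq (ae_eq_refl _) Ioo_ae_eq_Ioc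
    rw [e3]
    refine setIntegral_eq_of_subset_of_forall_sdiff_eq_zero
      (measurableSet_Ioi.prod measurableSet_Ioc)
      (prod_mono (fun x hx => hx.1) subset_rfl) ?_
    rintro ⟨r, θ⟩ ⟨⟨hr, hθ⟩, hn⟩
    have hr : 0 < r := hr
    have : ρ < r := by
      by_contra! hle
      exact hn ⟨⟨hr, hle⟩, hθ⟩
    rw [h0 _ (by rw [norm_pol, abs_of_pos hr]; exact this), mul_zero]
  rw [e2, Measure.volume_eq_prod, setIntegral_prod, intervalIntegral.integral_of_le hρ]
  · simp_rw [intervalIntegral.integral_of_le (by linarith : -π ≤ π)]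
  · exact (hc.continuousOn.integrableOn_compact (isCompact_Icc.prod isCompact_Icc)).mono_set
      (prod_mono Ioc_subset_Icc_self Ioc_subset_Icc_self)

lemma continuous_norm_gradient_sq {h : Pl → ℝ} (hh : ContDiff ℝ 1 h) :
    Continuous fun x => ‖gradient h x‖ ^ 2 := by
  have hc : Continuous (fderiv ℝ h) := hh.continuous_fderiv one_ne_zero
  simp only [norm_gradient_sq]
  fun_prop

lemma gradient_eq_zero_of_notMem_tsupport {h : Pl → ℝ} {x : Pl} (hx : x ∉ tsupport h) :
    gradient h x = 0 := by
  rw [gradient, fderiv_of_notMem_tsupport ℝ hx, map_zero]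

lemma integrable_norm_gradient_sq {h : Pl → ℝ} (hh : ContDiff ℝ 1 h) (hs : HasCompactSupport h) :
    Integrable fun x => ‖gradient h x‖ ^ 2 := by
  refine (continuous_norm_gradient_sq hh).integrable_of_hasCompactSupport
    (hs.mono' fun x hx => ?_)
  by_contra hn
  exact hx (by simp [gradient_eq_zero_of_notMem_tsupport hn])

lemma integrable_sq {h : Pl → ℝ} (hh : Continuous h) (hs : HasCompactSupport h) :
    Integrable fun x => h x ^ 2 := by
  have hc : Continuous fun x => h x ^ 2 := by fun_prop
  refine hc.integrable_of_hasCompactSupport (hs.mono fun x hx => ?_)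
  contrapose! hx
  simp only [mem_support, ne_eq, not_not] at hx ⊢
  rw [hx]
  norm_num

lemma exp_div_eventually {R c e : ℝ} (h : R < c) :
    ∀ᶠ N : ℕ in atTop, R * rexp (e / N) < c := by
  have h1 : Tendsto (fun N : ℕ => R * rexp (e / N)) atTop (𝓝 (R * rexp 0)) :=
    (continuous_exp.continuousAt.tendsto.comp (tendsto_const_div_atTop_nhds_zero_nat e)).const_mul R
  rw [exp_zero, mul_one] at h1
  exact h1.eventually_lt_const h

lemma exp_div_eventually' {R c e : ℝ} (h : c < R) :
    ∀ᶠ N : ℕ in atTop, c < R * rexp (e / N) := by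
  have h1 : Tendsto (fun N : ℕ => R * rexp (e / N)) atTop (𝓝 (R * rexp 0)) :=
    (continuous_exp.continuousAt.tendsto.comp (tendsto_const_div_atTop_nhds_zero_nat e)).const_mul R
  rw [exp_zero, mul_one] at h1
  exact h1.eventually_const_lt h

/-- Functions with vanishing means on two circles, supported away from small neighbourhoods of
`N` equidistributed points, have Rayleigh quotient at least one. -/
lemma eventually_rayleigh (d : Data (1 / (4 * π ^ 2))) {A0 : ℝ} (hA0 : 0 ≤ A0) :
    ∀ᶠ N : ℕ in atTop, ∀ h : Pl → ℝ, ContDiff ℝ 1 h → (∀ x, d.R3 ≤ ‖x‖ → h x = 0) →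
      circ d.r1 h = 0 → circ d.r2 h = 0 →
      (∀ r ∈ Ioo d.s d.r2, ∀ θ, pol r θ ∈ tsupport h → rexp (-2 * A0) < EE d.R N r θ) →
      ∫ x, h x ^ 2 ≤ ∫ x, ‖gradient h x‖ ^ 2 := by
  have i1 := d.r1_pos
  have i2 := d.r1_lt
  have i3 := d.s_lt
  have i4 := d.R_lt
  have i5 := d.r2_lt
  have hR : 0 < d.R := by linarith
  obtain ⟨N0, hN0⟩ := exists_shell hR (i4.trans i5) A0 d.b0 hA0 d.b0_pos.le
  have hNat : ∀ᶠ N : ℕ in atTop, N0 ≤ (N : ℝ) :=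
    tendsto_natCast_atTop_atTop.eventually_ge_atTop N0
  filter_upwards [hNat, exp_div_eventually (e := 2) i4, exp_div_eventually' (e := -2) i3]
    with N hN hN2 hN3 h hh h0 hc1 hc2 hsupp
  obtain ⟨hNpos, hshell⟩ := hN0 N hN
  have hn : (0 : ℝ) < N := by exact_mod_cast hNpos
  have hP := polar_of_contDiff hh
  have hcs : HasCompactSupport h := by
    refine HasCompactSupport.intro (isCompact_closedBall (0 : Pl) d.R3) fun x hx => h0 x ?_
    simp only [mem_closedBall_zero_iff, not_le] at hx
    exact hx.le
  have hcont := hh.continuous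
  have m2 : (-2 : ℝ) / N < -1 / N := by gcongr; norm_num
  have m3 : (1 : ℝ) / N < 2 / N := by gcongr; norm_num
  have m0 : (0 : ℝ) < 1 / N := by positivity
  have m0' : (-1 : ℝ) / N < 0 := by rw [neg_div]; linarith
  have a1 : d.R * rexp (-2 / N) < d.R * rexp (-1 / N) := by gcongr
  have a2 : d.R * rexp (-1 / N) ≤ d.R := by
    have := exp_lt_one_iff.2 m0'
    nlinarith
  have a3 : d.R ≤ d.R * rexp (1 / N) := by
    have := one_lt_exp_iff.2 m0
    nlinarith
  have a4 : d.R * rexp (1 / N) < d.R * rexp (2 / N) := by gcongr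
  have key := hP.energy_nonneg d (a := d.R * rexp (-1 / N)) (b := d.R * rexp (1 / N))
    ⟨by linarith, a2⟩ ⟨a3, by linarith⟩ hc1 hc2
    (fun θ => h0 _ (by rw [norm_pol, abs_of_pos (by linarith)]))
    (hshell _ _ _ hP fun r hr θ => by
      by_cases hm : pol r θ ∈ tsupport h
      · exact Or.inl (hsupp r ⟨hN3.trans hr.1, hr.2.trans hN2⟩ θ hm)
      · refine Or.inr ?_
        have e := notMem_tsupport_iff_eventuallyEq.1 hm
        exact (continuous_pol.continuousAt (x := (r, θ))).eventually
          (p := fun y => h y = 0) e)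
  have hI : ∫ x, (‖gradient h x‖ ^ 2 - h x ^ 2) = ∫ r in (0 : ℝ)..d.R3,
      energy (fun r θ => h (pol r θ)) (fun r θ => fderiv ℝ h (pol r θ) !₂[cos θ, sin θ])
      (fun r θ => fderiv ℝ h (pol r θ) !₂[-sin θ, cos θ]) r := by
    rw [integral_polar (f := fun x => ‖gradient h x‖ ^ 2 - h x ^ 2)
      ((continuous_norm_gradient_sq hh).sub (hcont.pow 2))
      (by linarith : 0 ≤ d.R3)]
    · refine intervalIntegral.integral_congr fun r _ => intervalIntegral.integral_congr
        fun θ _ => ?_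
      simp only [norm_gradient_sq, fderiv_vec, neg_mul]
      linear_combination (-r * (fderiv ℝ h (pol r θ) (EuclideanSpace.single 0 1) ^ 2 +
        fderiv ℝ h (pol r θ) (EuclideanSpace.single 1 1) ^ 2)) * sin_sq_add_cos_sq θ
    · intro x hx
      have : x ∉ tsupport h := by
        rw [notMem_tsupport_iff_eventuallyEq]
        filter_upwards [(isOpen_lt continuous_const continuous_norm).mem_nhds hx] with y hy
        exact h0 y (le_of_lt hy)
      rw [gradient_eq_zero_of_notMem_tsupport this, h0 x hx.le]
      simp
  rw [integral_sub (integrable_norm_gradient_sq hh hcs) (integrable_sq hcont hcs)] at hI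
  linarith

/-- A smooth function vanishing on `(-∞, 1]` and equal to the identity on `[2, ∞)`. -/
noncomputable def cutp (t : ℝ) : ℝ := t * smoothTransition (t - 1)

noncomputable def cutq (t : ℝ) : ℝ := ∫ x in (0 : ℝ)..t, deriv cutp x ^ 2

lemma contDiff_cutp : ContDiff ℝ (⊤ : ℕ∞) cutp :=
  contDiff_id.mul (smoothTransition.contDiff.comp (contDiff_id.sub contDiff_const))

lemma cutp_of_le {t : ℝ} (h : t ≤ 1) : cutp t = 0 := by
  rw [cutp, smoothTransition.zero_of_nonpos (by linarith), mul_zero]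

lemma cutp_of_ge {t : ℝ} (h : 2 ≤ t) : cutp t = t := by
  rw [cutp, smoothTransition.one_of_one_le (by linarith), mul_one]

lemma cutp_nonneg (t : ℝ) : 0 ≤ cutp t := by
  rcases le_total t 1 with h | h
  · rw [cutp_of_le h]
  · exact mul_nonneg (by linarith) (smoothTransition.nonneg _)

lemma cutp_le {t : ℝ} (h : 0 ≤ t) : cutp t ≤ t :=
  mul_le_of_le_one_right h (smoothTransition.le_one _)

lemma hasDerivAt_cutp (t : ℝ) : HasDerivAt cutp (deriv cutp t) t :=
  ((contDiff_cutp.differentiable (by simp)) t).hasDerivAt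

lemma continuous_deriv_cutp : Continuous (deriv cutp) :=
  contDiff_cutp.continuous_deriv (by simp)

lemma deriv_cutp_of_lt {t : ℝ} (h : t < 1) : deriv cutp t = 0 := by
  have : cutp =ᶠ[𝓝 t] fun _ => 0 := by
    filter_upwards [Iio_mem_nhds h] with x hx using cutp_of_le (le_of_lt hx)
  rw [this.deriv_eq, deriv_const]

lemma deriv_cutp_of_gt {t : ℝ} (h : 2 < t) : deriv cutp t = 1 := by
  have : cutp =ᶠ[𝓝 t] fun x => x := by
    filter_upwards [Ioi_mem_nhds h] with x hx using cutp_of_ge (le_of_lt hx)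
  rw [this.deriv_eq, deriv_id'']

lemma hasDerivAt_cutq (t : ℝ) : HasDerivAt cutq (deriv cutp t ^ 2) t :=
  intervalIntegral.integral_hasDerivAt_right
    ((continuous_deriv_cutp.pow 2).intervalIntegrable _ _)
    (continuous_deriv_cutp.pow 2).aestronglyMeasurable.stronglyMeasurableAtFilter
    (continuous_deriv_cutp.pow 2).continuousAt

lemma cutq_of_le {t : ℝ} (h : t ≤ 1) : cutq t = 0 := by
  have h0 : ∀ x ∈ uIcc 0 t, deriv cutp x ^ 2 = (0 : ℝ) := by
    intro x hx
    have hx1 : x ≤ 1 := hx.2.trans (max_le (by norm_num) h)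
    have hcl : IsClosed {x | deriv cutp x = 0} :=
      isClosed_eq continuous_deriv_cutp continuous_const
    have : Iic (1 : ℝ) ⊆ {x | deriv cutp x = 0} := by
      rw [← closure_Iio]
      exact hcl.closure_subset_iff.2 fun y hy => deriv_cutp_of_lt hy
    have e : deriv cutp x = 0 := this hx1
    rw [e]
    norm_num
  rw [cutq, intervalIntegral.integral_congr h0]
  simp

lemma exists_cut_bound : ∃ C, 0 ≤ C ∧ ∀ t, |t * cutq t - cutp t ^ 2| ≤ C * |t| := by
  have hc : Continuous cutq := continuous_iff_continuousAt.2 fun t => (hasDerivAt_cutq t).continuousAt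
  obtain ⟨M, hM⟩ := (isCompact_Icc (a := (0 : ℝ)) (b := 2)).exists_bound_of_continuousOn
    hc.continuousOn
  have hM0 : 0 ≤ M := (norm_nonneg _).trans (hM 0 ⟨le_rfl, by norm_num⟩)
  refine ⟨M + 2, by linarith, fun t => ?_⟩
  rcases le_total t 0 with h | h
  · rw [cutq_of_le (by linarith), cutp_of_le (by linarith)]
    simp only [mul_zero, ne_eq, OfNat.ofNat_ne_zero, not_false_eq_true, zero_pow, sub_self,
      abs_zero]
    positivity
  rw [abs_of_nonneg h]
  rcases le_total t 2 with h2 | h2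
  · have h3 := abs_le.1 (hM t ⟨h, h2⟩)
    have h4 := cutp_nonneg t
    have h5 := cutp_le h
    rw [abs_le]
    constructor <;> nlinarith
  · have e : cutq t = cutq 2 + (t - 2) := by
      have e1 : ∫ x in (2 : ℝ)..t, deriv cutp x ^ 2 = ∫ x in (2 : ℝ)..t, (1 : ℝ) := by
        refine intervalIntegral.integral_congr_ae (Eventually.of_forall fun x hx => ?_)
        rw [uIoc_of_le h2] at hx
        rw [deriv_cutp_of_gt hx.1]
        norm_num
      have cc : Continuous fun x => deriv cutp x ^ 2 := continuous_deriv_cutp.pow 2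
      rw [cutq, ← intervalIntegral.integral_add_adjacent_intervals (b := 2)
        (cc.intervalIntegrable _ _) (cc.intervalIntegrable _ _), e1]
      simp [cutq]
    have h3 := abs_le.1 (hM 2 ⟨by norm_num, le_rfl⟩)
    rw [e, cutp_of_ge h2, abs_le]
    constructor <;> nlinarith

/-- `Θ`: a smooth truncation of `α t⁺ + β t⁻`. -/
noncomputable def cutT (ε α β t : ℝ) : ℝ := ε * (α * cutp (t / ε) + β * cutp (-t / ε))

/-- A primitive of the squared derivative of `cutT`. -/
noncomputable def cutS (ε α β t : ℝ) : ℝ := ε * (α ^ 2 * cutq (t / ε) - β ^ 2 * cutq (-t / ε))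

lemma contDiff_cutT (ε α β : ℝ) : ContDiff ℝ (⊤ : ℕ∞) (cutT ε α β) :=
  contDiff_const.mul ((contDiff_const.mul (contDiff_cutp.comp (contDiff_id.div_const ε))).add
    (contDiff_const.mul (contDiff_cutp.comp (contDiff_neg.div_const ε))))

lemma div_le_of_abs_le {ε t : ℝ} (hε : 0 < ε) (h : |t| ≤ ε) : t / ε ≤ 1 ∧ -t / ε ≤ 1 := by
  rw [div_le_one hε, div_le_one hε]
  have := abs_le.1 h
  exact ⟨this.2, by linarith⟩

lemma cutT_of_abs_le {ε α β t : ℝ} (hε : 0 < ε) (h : |t| ≤ ε) : cutT ε α β t = 0 := by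
  obtain ⟨h1, h2⟩ := div_le_of_abs_le hε h
  rw [cutT, cutp_of_le h1, cutp_of_le h2]
  ring

lemma cutS_of_abs_le {ε α β t : ℝ} (hε : 0 < ε) (h : |t| ≤ ε) : cutS ε α β t = 0 := by
  obtain ⟨h1, h2⟩ := div_le_of_abs_le hε h
  rw [cutS, cutq_of_le h1, cutq_of_le h2]
  ring

lemma cutT_of_ge {ε α β t : ℝ} (hε : 0 < ε) (h : 2 * ε ≤ t) : cutT ε α β t = α * t := by
  have h1 : 2 ≤ t / ε := by rwa [le_div_iff₀ hε]
  have h2 : -t / ε ≤ 1 := by rw [div_le_one hε]; linarith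
  rw [cutT, cutp_of_ge h1, cutp_of_le h2]
  field_simp
  ring

lemma cutT_of_le {ε α β t : ℝ} (hε : 0 < ε) (h : t ≤ -(2 * ε)) : cutT ε α β t = -β * t := by
  have h1 : 2 ≤ -t / ε := by rw [le_div_iff₀ hε]; linarith
  have h2 : t / ε ≤ 1 := by rw [div_le_one hε]; linarith
  rw [cutT, cutp_of_ge h1, cutp_of_le h2]
  field_simp
  ring

lemma abs_cutT_sub_le {ε : ℝ} (hε : 0 < ε) (t : ℝ) : |cutT ε 1 (-1) t - t| ≤ 2 * ε := by
  rcases le_total (2 * ε) t with h | h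
  · rw [cutT_of_ge hε h]
    simpa using hε.le
  rcases le_total t (-(2 * ε)) with h' | h'
  · rw [cutT_of_le hε h']
    simpa using hε.le
  rcases le_total 0 t with h0 | h0
  · have h1 : 0 ≤ t / ε := by positivity
    have h2 : -t / ε ≤ 1 := by rw [div_le_one hε]; linarith
    have h3 := mul_le_mul_of_nonneg_left (cutp_le h1) hε.le
    have h4 := mul_nonneg hε.le (cutp_nonneg (t / ε))
    rw [mul_div_cancel₀ _ hε.ne'] at h3
    rw [cutT, cutp_of_le h2, abs_le]
    constructor <;> linarith
  · have h1 : 0 ≤ -t / ε := div_nonneg (by linarith) hε.le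
    have h2 : t / ε ≤ 1 := by rw [div_le_one hε]; linarith
    have h3 := mul_le_mul_of_nonneg_left (cutp_le h1) hε.le
    have h4 := mul_nonneg hε.le (cutp_nonneg (-t / ε))
    rw [mul_div_cancel₀ _ hε.ne'] at h3
    rw [cutT, cutp_of_le h2, abs_le]
    constructor <;> linarith

lemma deriv_cutp_mul (s : ℝ) : deriv cutp s * deriv cutp (-s) = 0 := by
  rcases le_total s 0 with h | h
  · rw [deriv_cutp_of_lt (by linarith), zero_mul]
  · rw [deriv_cutp_of_lt (t := -s) (by linarith), mul_zero]

lemma hasDerivAt_cutT {ε : ℝ} (hε : 0 < ε) (α β t : ℝ) : HasDerivAt (cutT ε α β)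
    (α * deriv cutp (t / ε) - β * deriv cutp (-t / ε)) t := by
  have h1 := (hasDerivAt_cutp (t / ε)).comp t ((hasDerivAt_id t).div_const ε)
  have h2 := (hasDerivAt_cutp (-t / ε)).comp t ((hasDerivAt_neg t).div_const ε)
  refine (((h1.const_mul α).add (h2.const_mul β)).const_mul ε).congr_deriv ?_
  field_simp
  ring

lemma hasDerivAt_cutS {ε : ℝ} (hε : 0 < ε) (α β t : ℝ) : HasDerivAt (cutS ε α β)
    ((deriv (cutT ε α β) t) ^ 2) t := by
  have h1 := (hasDerivAt_cutq (t / ε)).comp t ((hasDerivAt_id t).div_const ε)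
  have h2 := (hasDerivAt_cutq (-t / ε)).comp t ((hasDerivAt_neg t).div_const ε)
  refine (((h1.const_mul (α ^ 2)).sub (h2.const_mul (β ^ 2))).const_mul ε).congr_deriv ?_
  rw [(hasDerivAt_cutT hε α β t).deriv]
  have := deriv_cutp_mul (t / ε)
  rw [← neg_div] at this
  generalize deriv cutp (t / ε) = a at *
  generalize deriv cutp (-t / ε) = b at *
  field_simp
  linear_combination (2 * α * β) * this

lemma contDiff_cutS {ε : ℝ} (hε : 0 < ε) (α β : ℝ) : ContDiff ℝ 1 (cutS ε α β) := by
  rw [contDiff_one_iff_deriv]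
  refine ⟨fun t => (hasDerivAt_cutS hε α β t).differentiableAt, ?_⟩
  have : deriv (cutS ε α β) = fun t => (deriv (cutT ε α β) t) ^ 2 :=
    funext fun t => (hasDerivAt_cutS hε α β t).deriv
  rw [this]
  exact ((contDiff_cutT ε α β).continuous_deriv (by simp)).pow 2

lemma exists_cutS_bound : ∃ C, 0 ≤ C ∧ ∀ ε, 0 < ε → ∀ α β t : ℝ,
    |t * cutS ε α β t - cutT ε α β t ^ 2| ≤ C * ε * (α ^ 2 + β ^ 2) * |t| := by
  obtain ⟨C, hC0, hC⟩ := exists_cut_bound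
  refine ⟨C, hC0, fun ε hε α β t => ?_⟩
  rcases le_total 0 t with h | h
  · have h2 : -t / ε ≤ 1 := by rw [div_le_one hε]; linarith
    have e : t * cutS ε α β t - cutT ε α β t ^ 2 =
        ε ^ 2 * α ^ 2 * (t / ε * cutq (t / ε) - cutp (t / ε) ^ 2) := by
      rw [cutS, cutT, cutp_of_le h2, cutq_of_le h2]
      field_simp
      ring
    rw [e, abs_mul, abs_of_nonneg (by positivity : 0 ≤ ε ^ 2 * α ^ 2)]
    refine (mul_le_mul_of_nonneg_left (hC _) (by positivity)).trans ?_
    rw [abs_div, abs_of_pos hε]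
    have : ε ^ 2 * α ^ 2 * (C * (|t| / ε)) = C * ε * α ^ 2 * |t| := by field_simp
    rw [this]
    gcongr
    nlinarith [sq_nonneg β]
  · have h2 : t / ε ≤ 1 := by rw [div_le_one hε]; linarith
    have e : t * cutS ε α β t - cutT ε α β t ^ 2 =
        ε ^ 2 * β ^ 2 * (-t / ε * cutq (-t / ε) - cutp (-t / ε) ^ 2) := by
      rw [cutS, cutT, cutp_of_le h2, cutq_of_le h2]
      field_simp
      ring
    rw [e, abs_mul, abs_of_nonneg (by positivity : 0 ≤ ε ^ 2 * β ^ 2)]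
    refine (mul_le_mul_of_nonneg_left (hC _) (by positivity)).trans ?_
    rw [abs_div, abs_of_pos hε, abs_neg]
    have : ε ^ 2 * β ^ 2 * (C * (|t| / ε)) = C * ε * β ^ 2 * |t| := by field_simp
    rw [this]
    gcongr
    nlinarith [sq_nonneg α]

/-- The partial derivative in the `i`-th coordinate. -/
noncomputable def pd (i : Fin 2) (f : Pl → ℝ) (x : Pl) : ℝ :=
  fderiv ℝ f x (EuclideanSpace.single i 1)

lemma natCast_le_top (n : ℕ) : (n : WithTop ℕ∞) ≤ ((⊤ : ℕ∞) : WithTop ℕ∞) := by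
  exact_mod_cast (le_top : (n : ℕ∞) ≤ ⊤)

lemma lap_eq (f : Pl → ℝ) (x : Pl) : lap f x = pd 0 (pd 0 f) x + pd 1 (pd 1 f) x := by
  rw [lap, Fin.sum_univ_two]
  rfl

lemma norm_gradient_sq' (f : Pl → ℝ) (x : Pl) : ‖gradient f x‖ ^ 2 = pd 0 f x ^ 2 + pd 1 f x ^ 2 :=
  norm_gradient_sq f x

lemma contDiffAt_pd {i : Fin 2} {f : Pl → ℝ} {x : Pl} {m n : WithTop ℕ∞} (h : ContDiffAt ℝ n f x)
    (hmn : m + 1 ≤ n) : ContDiffAt ℝ m (pd i f) x :=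
  (h.fderiv_right hmn).clm_apply contDiffAt_const

lemma contDiff_pd {i : Fin 2} {f : Pl → ℝ} {m n : WithTop ℕ∞} (h : ContDiff ℝ n f)
    (hmn : m + 1 ≤ n) : ContDiff ℝ m (pd i f) :=
  contDiff_iff_contDiffAt.2 fun _ => contDiffAt_pd h.contDiffAt hmn

lemma pd_mul {i : Fin 2} {f g : Pl → ℝ} {x : Pl} (hf : DifferentiableAt ℝ f x)
    (hg : DifferentiableAt ℝ g x) :
    pd i (fun y => f y * g y) x = f x * pd i g x + pd i f x * g x := by
  rw [pd, fderiv_fun_mul hf hg]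
  simp [pd, mul_comm]

lemma pd_add {i : Fin 2} {f g : Pl → ℝ} {x : Pl} (hf : DifferentiableAt ℝ f x)
    (hg : DifferentiableAt ℝ g x) :
    pd i (fun y => f y + g y) x = pd i f x + pd i g x := by
  rw [pd, fderiv_fun_add hf hg]
  rfl

lemma pd_sub {i : Fin 2} {f g : Pl → ℝ} {x : Pl} (hf : DifferentiableAt ℝ f x)
    (hg : DifferentiableAt ℝ g x) :
    pd i (fun y => f y - g y) x = pd i f x - pd i g x := by
  rw [pd, fderiv_fun_sub hf hg]
  rfl

lemma pd_const_mul {i : Fin 2} {f : Pl → ℝ} {x : Pl} (c : ℝ) (hf : DifferentiableAt ℝ f x) :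
    pd i (fun y => c * f y) x = c * pd i f x := by
  rw [pd, fderiv_const_mul hf]
  rfl

lemma pd_comp {i : Fin 2} {T : ℝ → ℝ} {f : Pl → ℝ} {x : Pl} {T' : ℝ} (hT : HasDerivAt T T' (f x))
    (hf : DifferentiableAt ℝ f x) : pd i (fun y => T (f y)) x = T' * pd i f x := by
  have := hT.comp_hasFDerivAt x hf.hasFDerivAt
  rw [pd, HasFDerivAt.fderiv (f := fun y => T (f y)) this]
  rfl

lemma pd_congr {i : Fin 2} {f g : Pl → ℝ} {x : Pl} (h : f =ᶠ[𝓝 x] g) : pd i f x = pd i g x := by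
  rw [pd, h.fderiv_eq, pd]

lemma pd_eventually_congr {i : Fin 2} {f g : Pl → ℝ} {x : Pl} (h : f =ᶠ[𝓝 x] g) :
    pd i f =ᶠ[𝓝 x] pd i g := by
  filter_upwards [h.eventually_nhds] with y hy using pd_congr hy

lemma pd_zero (i : Fin 2) (x : Pl) : pd i (fun _ => 0) x = 0 := by
  simp [pd]

lemma lap_congr {f g : Pl → ℝ} {x : Pl} (h : f =ᶠ[𝓝 x] g) : lap f x = lap g x := by
  rw [lap_eq, lap_eq, pd_congr (pd_eventually_congr h), pd_congr (pd_eventually_congr h)]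

lemma pd_hasCompactSupport {i : Fin 2} {f : Pl → ℝ} (h : HasCompactSupport f) :
    HasCompactSupport (pd i f) :=
  h.fderiv_apply ℝ _

lemma integral_pd {i : Fin 2} {f : Pl → ℝ} (h : ContDiff ℝ 1 f) (hs : HasCompactSupport f) :
    ∫ x, pd i f x = 0 := by
  have hc : Continuous (pd i f) := (contDiff_pd (m := 0) h (by simp)).continuous
  have := integral_mul_fderiv_eq_neg_fderiv_mul_of_integrable (μ := (volume : Measure Pl))
    (f := fun _ : Pl => (1 : ℝ)) (g := f) (v := EuclideanSpace.single i 1) (by simp)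
    (by simp only [one_mul]; exact hc.integrable_of_hasCompactSupport (pd_hasCompactSupport hs))
    (by simpa only [one_mul] using h.continuous.integrable_of_hasCompactSupport hs)
    (fun _ _ => differentiableAt_const _) (fun x _ => h.differentiable one_ne_zero x)
  simpa [pd] using this

/-- Smooth functions with compact support contained in `Ω`. -/
structure Test (n : WithTop ℕ∞) (Ω : Set Pl) (f : Pl → ℝ) : Prop where
  smooth : ContDiff ℝ n f
  compact : HasCompactSupport f
  sub : tsupport f ⊆ Ω

lemma Test.of_local {n : WithTop ℕ∞} {Ω : Set Pl} (hb : Bornology.IsBounded Ω) {f : Pl → ℝ}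
    (h1 : ∀ x ∈ Ω, ContDiffAt ℝ n f x) (h2 : ∀ x ∉ Ω, f =ᶠ[𝓝 x] fun _ => 0) : Test n Ω f := by
  have hs : tsupport f ⊆ Ω := fun x hx => by
    by_contra hn
    exact notMem_tsupport_iff_eventuallyEq.2 (h2 x hn) hx
  refine ⟨contDiff_iff_contDiffAt.2 fun x => ?_, ?_, hs⟩
  · by_cases hx : x ∈ Ω
    · exact h1 x hx
    · exact contDiffAt_const.congr_of_eventuallyEq (h2 x hx)
  · exact Metric.isCompact_of_isClosed_isBounded (isClosed_tsupport f) (hb.subset hs)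

lemma Test.eventually_zero {n : WithTop ℕ∞} {Ω : Set Pl} {f : Pl → ℝ} (h : Test n Ω f) {x : Pl}
    (hx : x ∉ Ω) : f =ᶠ[𝓝 x] fun _ => 0 :=
  notMem_tsupport_iff_eventuallyEq.1 fun h' => hx (h.sub h')

/-- Solutions of `-Δ u = u` in `Ω` vanishing outside of `Ω`. -/
structure Eigen (Ω : Set Pl) (u : Pl → ℝ) : Prop where
  isOpen : IsOpen Ω
  bdd : Bornology.IsBounded Ω
  cont : Continuous u
  zero : ∀ x ∉ Ω, u x = 0
  smooth : ∀ x ∈ Ω, ContDiffAt ℝ (⊤ : ℕ∞) u x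
  eq : ∀ x ∈ Ω, lap u x = -u x

namespace Eigen

variable {Ω : Set Pl} {u : Pl → ℝ}

lemma contDiffAt (hu : Eigen Ω u) {n : ℕ} {x : Pl} (hx : x ∈ Ω) : ContDiffAt ℝ n u x :=
  (hu.smooth x hx).of_le (by exact_mod_cast le_top)

lemma eventually_small (hu : Eigen Ω u) {ε : ℝ} (hε : 0 < ε) {x : Pl} (hx : x ∉ Ω) :
    ∀ᶠ y in 𝓝 x, |u y| ≤ ε := by
  have h : Tendsto (fun y => |u y|) (𝓝 x) (𝓝 |u x|) := hu.cont.abs.continuousAt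
  rw [hu.zero x hx, abs_zero] at h
  filter_upwards [h.eventually (gt_mem_nhds hε)] with y hy using hy.le

lemma hasCompactSupport (hu : Eigen Ω u) : HasCompactSupport u :=
  HasCompactSupport.of_support_subset_isCompact hu.bdd.isCompact_closure fun x hx => by
    by_contra hn
    exact hx (hu.zero x fun h => hn (subset_closure h))

lemma test_cutT (hu : Eigen Ω u) {ε : ℝ} (hε : 0 < ε) (α β : ℝ) :
    Test (⊤ : ℕ∞) Ω fun x => cutT ε α β (u x) := by
  refine Test.of_local hu.bdd (fun x hx => ?_) fun x hx => ?_
  · exact (contDiff_cutT ε α β).contDiffAt.comp x (hu.smooth x hx)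
  · filter_upwards [hu.eventually_small hε hx] with y hy using cutT_of_abs_le hε hy

lemma test_flux (hu : Eigen Ω u) {ε : ℝ} (hε : 0 < ε) (α β : ℝ) (i : Fin 2) :
    Test 1 Ω fun x => cutS ε α β (u x) * pd i u x := by
  refine Test.of_local hu.bdd (fun x hx => ?_) fun x hx => ?_
  · exact ((contDiff_cutS hε α β).contDiffAt.comp x (hu.contDiffAt (n := 1) hx)).mul
      (contDiffAt_pd (hu.contDiffAt (n := 2) hx) (by norm_num))
  · filter_upwards [hu.eventually_small hε hx] with y hy
    rw [cutS_of_abs_le hε hy, zero_mul]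

lemma continuous_cutS (hu : Eigen Ω u) {ε : ℝ} (hε : 0 < ε) (α β : ℝ) :
    Continuous fun x => u x * cutS ε α β (u x) :=
  hu.cont.mul ((contDiff_cutS hε α β).continuous.comp hu.cont)

lemma integrable_mul_cutS (hu : Eigen Ω u) {ε : ℝ} (hε : 0 < ε) (α β : ℝ) :
    Integrable fun x => u x * cutS ε α β (u x) :=
  (hu.continuous_cutS hε α β).integrable_of_hasCompactSupport hu.hasCompactSupport.mul_right

lemma integral_norm_gradient_cutT (hu : Eigen Ω u) {ε : ℝ} (hε : 0 < ε) (α β : ℝ) :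
    ∫ x, ‖gradient (fun y => cutT ε α β (u y)) x‖ ^ 2 = ∫ x, u x * cutS ε α β (u x) := by
  set w := fun y => cutT ε α β (u y) with hw
  have key : ∀ x, pd 0 (fun x => cutS ε α β (u x) * pd 0 u x) x +
      pd 1 (fun x => cutS ε α β (u x) * pd 1 u x) x =
      ‖gradient w x‖ ^ 2 - u x * cutS ε α β (u x) := by
    intro x
    by_cases hx : x ∈ Ω
    · have d1 := (hu.contDiffAt (n := 1) hx).differentiableAt (by norm_num)
      have d2 : ∀ i, DifferentiableAt ℝ (pd i u) x := fun i =>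
        (contDiffAt_pd (m := 1) (hu.contDiffAt (n := 2) hx) (by norm_num)).differentiableAt
          (by norm_num)
      have e : ∀ i, pd i (fun x => cutS ε α β (u x) * pd i u x) x =
          pd i w x ^ 2 + cutS ε α β (u x) * pd i (pd i u) x := fun i => by
        have hS := hasDerivAt_cutS hε α β (u x)
        have hT := ((contDiff_cutT ε α β).differentiable (by simp) (u x)).hasDerivAt
        rw [pd_mul (f := fun x => cutS ε α β (u x)) (hS.differentiableAt.comp x d1) (d2 i), pd_comp hS d1, hw, pd_comp hT d1]
        ring
      have h := hu.eq x hx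
      rw [lap_eq] at h
      rw [e, e, norm_gradient_sq']
      linear_combination cutS ε α β (u x) * h
    · have h1 : ∀ i, pd i (fun x => cutS ε α β (u x) * pd i u x) x = 0 := fun i => by
        rw [pd_congr ((hu.test_flux hε α β i).eventually_zero hx), pd_zero]
      have h2 : ∀ i, pd i w x = 0 := fun i => by
        rw [pd_congr ((hu.test_cutT hε α β).eventually_zero hx), pd_zero]
      rw [h1, h1, norm_gradient_sq', h2, h2, hu.zero x hx]
      ring
  have t := hu.test_cutT hε α β
  have t0 := hu.test_flux hε α β
  have i1 : Integrable fun x => ‖gradient w x‖ ^ 2 :=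
    integrable_norm_gradient_sq (t.smooth.of_le (by exact_mod_cast le_top)) t.compact
  have i2 : ∀ i, Integrable fun x => pd i (fun x => cutS ε α β (u x) * pd i u x) x := fun i =>
    (contDiff_pd (m := 0) (t0 i).smooth (by simp)).continuous.integrable_of_hasCompactSupport
      (pd_hasCompactSupport (t0 i).compact)
  have h : ∫ x, (‖gradient w x‖ ^ 2 - u x * cutS ε α β (u x)) = 0 := by
    simp only [← key]
    rw [integral_add (i2 0) (i2 1), integral_pd (t0 0).smooth (t0 0).compact,
      integral_pd (t0 1).smooth (t0 1).compact, add_zero]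
  rw [integral_sub i1 (hu.integrable_mul_cutS hε α β)] at h
  linarith

/-- The energy of the truncations of `u` is small. -/
lemma exists_energy_bound (hu : Eigen Ω u) : ∃ C, 0 ≤ C ∧ ∀ ε, 0 < ε → ∀ α β : ℝ,
    |(∫ x, ‖gradient (fun y => cutT ε α β (u y)) x‖ ^ 2) - ∫ x, cutT ε α β (u x) ^ 2| ≤
      C * ε * (α ^ 2 + β ^ 2) := by
  obtain ⟨C, hC, hb⟩ := exists_cutS_bound
  have iu : Integrable fun x => |u x| :=
    (hu.cont.integrable_of_hasCompactSupport hu.hasCompactSupport).abs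
  refine ⟨C * ∫ x, |u x|, mul_nonneg hC (integral_nonneg fun x => abs_nonneg _),
    fun ε hε α β => ?_⟩
  have t := hu.test_cutT hε α β
  have i1 : Integrable fun x => cutT ε α β (u x) ^ 2 :=
    integrable_sq t.smooth.continuous t.compact
  rw [hu.integral_norm_gradient_cutT hε, ← integral_sub (hu.integrable_mul_cutS hε α β) i1]
  calc |∫ x, (u x * cutS ε α β (u x) - cutT ε α β (u x) ^ 2)|
      ≤ ∫ x, |u x * cutS ε α β (u x) - cutT ε α β (u x) ^ 2| := abs_integral_le_integral_abs
    _ ≤ ∫ x, C * ε * (α ^ 2 + β ^ 2) * |u x| :=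
        integral_mono (((hu.integrable_mul_cutS hε α β).sub i1).abs) (iu.const_mul _)
          fun x => hb ε hε α β (u x)
    _ = _ := by rw [integral_const_mul]; ring

lemma integral_mul_lap (hu : Eigen Ω u) {f : Pl → ℝ} (hf : Test (⊤ : ℕ∞) Ω f) :
    ∫ x, u x * (lap f x + f x) = 0 := by
  have ht : ∀ i, Test 1 Ω fun x => u x * pd i f x - f x * pd i u x := fun i => by
    refine Test.of_local hu.bdd (fun x hx => ?_) fun x hx => ?_
    · have h2 : ContDiffAt ℝ 2 f x := (hf.smooth.of_le (natCast_le_top 2)).contDiffAt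
      exact ((hu.contDiffAt (n := 1) hx).mul (contDiffAt_pd h2 (by norm_num))).sub
        ((h2.of_le (by norm_num)).mul
          (contDiffAt_pd (hu.contDiffAt (n := 2) hx) (by norm_num)))
    · filter_upwards [hf.eventually_zero hx, pd_eventually_congr (i := i) (hf.eventually_zero hx)]
        with y h1 h2
      rw [h1, h2, pd_zero]
      ring
  have key : ∀ x, u x * (lap f x + f x) = pd 0 (fun x => u x * pd 0 f x - f x * pd 0 u x) x +
      pd 1 (fun x => u x * pd 1 f x - f x * pd 1 u x) x := by
    intro x
    by_cases hx : x ∈ Ω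
    · have d1 := (hu.contDiffAt (n := 1) hx).differentiableAt (by norm_num)
      have d2 : ∀ i, DifferentiableAt ℝ (pd i u) x := fun i =>
        (contDiffAt_pd (m := 1) (hu.contDiffAt (n := 2) hx) (by norm_num)).differentiableAt
          (by norm_num)
      have f1 : DifferentiableAt ℝ f x := hf.smooth.differentiable (by simp) x
      have f2 : ∀ i, DifferentiableAt ℝ (pd i f) x := fun i =>
        (contDiff_pd (m := 1) hf.smooth (natCast_le_top 2)).differentiable (by norm_num) x
      have e : ∀ i, pd i (fun x => u x * pd i f x - f x * pd i u x) x =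
          u x * pd i (pd i f) x - f x * pd i (pd i u) x := fun i => by
        rw [pd_sub (f := fun x => u x * pd i f x) (g := fun x => f x * pd i u x)
          (d1.mul (f2 i)) (f1.mul (d2 i)), pd_mul d1 (f2 i), pd_mul f1 (d2 i)]
        ring
      have h := hu.eq x hx
      rw [lap_eq] at h
      rw [e, e, lap_eq]
      linear_combination f x * h
    · have h1 : ∀ i, pd i (fun x => u x * pd i f x - f x * pd i u x) x = 0 := fun i => by
        rw [pd_congr ((ht i).eventually_zero hx), pd_zero]
      rw [h1, h1, hu.zero x hx]
      ring
  have i2 : ∀ i, Integrable fun x => pd i (fun x => u x * pd i f x - f x * pd i u x) x := fun i =>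
    (contDiff_pd (m := 0) (ht i).smooth (by simp)).continuous.integrable_of_hasCompactSupport
      (pd_hasCompactSupport (ht i).compact)
  simp only [key]
  rw [integral_add (i2 0) (i2 1), integral_pd (ht 0).smooth (ht 0).compact,
    integral_pd (ht 1).smooth (ht 1).compact, add_zero]

end Eigen

/-- The bilinear form associated with `-Δ - 1`. -/
noncomputable def bil (f g : Pl → ℝ) : ℝ :=
  ∫ x, (pd 0 f x * pd 0 g x + pd 1 f x * pd 1 g x - f x * g x)

lemma integrable_bil {f g : Pl → ℝ} (hf : ContDiff ℝ 1 f) (hg : ContDiff ℝ 1 g)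
    (sg : HasCompactSupport g) :
    Integrable fun x => pd 0 f x * pd 0 g x + pd 1 f x * pd 1 g x - f x * g x := by
  have cf : ∀ i, Continuous (pd i f) := fun i => (contDiff_pd (m := 0) hf (by simp)).continuous
  have cg : ∀ i, Continuous (pd i g) := fun i => (contDiff_pd (m := 0) hg (by simp)).continuous
  have i1 : ∀ i, Integrable fun x => pd i f x * pd i g x := fun i =>
    ((cf i).mul (cg i)).integrable_of_hasCompactSupport (pd_hasCompactSupport sg).mul_left
  exact ((i1 0).add (i1 1)).sub ((hf.continuous.mul hg.continuous).integrable_of_hasCompactSupport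
    sg.mul_left)

lemma bil_self {f : Pl → ℝ} (hf : ContDiff ℝ 1 f) (sf : HasCompactSupport f) :
    bil f f = (∫ x, ‖gradient f x‖ ^ 2) - ∫ x, f x ^ 2 := by
  rw [← integral_sub (integrable_norm_gradient_sq hf sf) (integrable_sq hf.continuous sf), bil]
  refine integral_congr_ae (Eventually.of_forall fun x => ?_)
  simp only [norm_gradient_sq']
  ring

lemma bil_add_self {f g : Pl → ℝ} (hf : ContDiff ℝ 1 f) (sf : HasCompactSupport f)
    (hg : ContDiff ℝ 1 g) (sg : HasCompactSupport g) (c : ℝ) :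
    bil (fun x => f x + c * g x) (fun x => f x + c * g x) =
      bil f f + 2 * c * bil f g + c ^ 2 * bil g g := by
  simp only [bil]
  have i1 := (integrable_bil hf hg sg).const_mul (2 * c)
  have i2 := (integrable_bil hf hf sf).add i1
  rw [← integral_const_mul, ← integral_const_mul, ← integral_add (integrable_bil hf hf sf) i1,
    ← integral_add (by exact i2) ((integrable_bil hg hg sg).const_mul _)]
  refine integral_congr_ae (Eventually.of_forall fun x => ?_)
  have df := hf.differentiable one_ne_zero x
  have dg := hg.differentiable one_ne_zero x
  simp only [pd_add df (dg.const_mul c), pd_const_mul c dg]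
  ring

lemma bil_eq {f g : Pl → ℝ} (hf : ContDiff ℝ 2 f) (hg : ContDiff ℝ 1 g)
    (sg : HasCompactSupport g) : bil f g = -∫ x, g x * (lap f x + f x) := by
  have h1 : ∀ i, ContDiff ℝ 1 (pd i f) := fun i => contDiff_pd hf (by norm_num)
  have ht : ∀ i, ContDiff ℝ 1 fun x => g x * pd i f x := fun i => hg.mul (h1 i)
  have hs : ∀ i, HasCompactSupport fun x => g x * pd i f x := fun i => sg.mul_right
  have i2 : ∀ i, Integrable fun x => pd i (fun x => g x * pd i f x) x := fun i =>
    (contDiff_pd (m := 0) (ht i) (by simp)).continuous.integrable_of_hasCompactSupport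
      (pd_hasCompactSupport (hs i))
  have hl : Continuous fun x => lap f x + f x := by
    simp only [lap_eq]
    exact ((contDiff_pd (m := 0) (h1 0) (by simp)).continuous.add
      (contDiff_pd (m := 0) (h1 1) (by simp)).continuous).add hf.continuous
  have i3 : Integrable fun x => g x * (lap f x + f x) :=
    (hg.continuous.mul hl).integrable_of_hasCompactSupport sg.mul_right
  have key : ∀ x, pd 0 f x * pd 0 g x + pd 1 f x * pd 1 g x - f x * g x =
      pd 0 (fun x => g x * pd 0 f x) x + pd 1 (fun x => g x * pd 1 f x) x -
        g x * (lap f x + f x) := fun x => by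
    have dg := hg.differentiable one_ne_zero x
    rw [pd_mul dg ((h1 0).differentiable one_ne_zero x),
      pd_mul dg ((h1 1).differentiable one_ne_zero x), lap_eq]
    ring
  rw [bil]
  simp only [key]
  rw [integral_sub (by exact (i2 0).add (i2 1)) i3, integral_add (i2 0) (i2 1), integral_pd (ht 0) (hs 0),
    integral_pd (ht 1) (hs 1)]
  ring

lemma Eigen.exists_bil_bound {Ω : Set Pl} {u : Pl → ℝ} (hu : Eigen Ω u) {f : Pl → ℝ}
    (hf : Test (⊤ : ℕ∞) Ω f) : ∃ C, 0 ≤ C ∧ ∀ ε, 0 < ε →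
      |bil f fun x => cutT ε 1 (-1) (u x)| ≤ C * ε := by
  have f2 : ContDiff ℝ 2 f := hf.smooth.of_le (natCast_le_top 2)
  have h1 : ∀ i, ContDiff ℝ 1 (pd i f) := fun i => contDiff_pd f2 (by norm_num)
  have hl : Continuous fun x => lap f x + f x := by
    simp only [lap_eq]
    exact ((contDiff_pd (m := 0) (h1 0) (by simp)).continuous.add
      (contDiff_pd (m := 0) (h1 1) (by simp)).continuous).add f2.continuous
  have hs : HasCompactSupport fun x => lap f x + f x := by
    simp only [lap_eq]
    exact ((pd_hasCompactSupport (pd_hasCompactSupport hf.compact)).add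
      (pd_hasCompactSupport (pd_hasCompactSupport hf.compact))).add hf.compact
  have ia : Integrable fun x => |lap f x + f x| := (hl.integrable_of_hasCompactSupport hs).abs
  refine ⟨2 * ∫ x, |lap f x + f x|, mul_nonneg zero_le_two
    (integral_nonneg fun x => abs_nonneg _), fun ε hε => ?_⟩
  have t := hu.test_cutT hε 1 (-1)
  have i1 : Integrable fun x => cutT ε 1 (-1) (u x) * (lap f x + f x) :=
    (t.smooth.continuous.mul hl).integrable_of_hasCompactSupport hs.mul_left
  have i2 : Integrable fun x => u x * (lap f x + f x) :=
    (hu.cont.mul hl).integrable_of_hasCompactSupport hs.mul_left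
  rw [bil_eq f2 (t.smooth.of_le (by exact_mod_cast le_top)) t.compact, abs_neg,
    ← sub_zero (∫ x, cutT ε 1 (-1) (u x) * (lap f x + f x)), ← hu.integral_mul_lap hf,
    ← integral_sub i1 i2]
  calc |∫ x, (cutT ε 1 (-1) (u x) * (lap f x + f x) - u x * (lap f x + f x))|
      ≤ ∫ x, |cutT ε 1 (-1) (u x) * (lap f x + f x) - u x * (lap f x + f x)| :=
        abs_integral_le_integral_abs
    _ ≤ ∫ x, 2 * ε * |lap f x + f x| := integral_mono (i1.sub i2).abs (ia.const_mul _) fun x => by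
        simp only
        rw [← sub_mul, abs_mul]
        exact mul_le_mul_of_nonneg_right (abs_cutT_sub_le hε _) (abs_nonneg _)
    _ = _ := by rw [integral_const_mul]; ring

lemma Test.of_le_one {Ω : Set Pl} {f : Pl → ℝ} (hf : Test (⊤ : ℕ∞) Ω f) : ContDiff ℝ 1 f :=
  hf.smooth.of_le (natCast_le_top 1)

lemma Test.add_mul {Ω : Set Pl} {f g : Pl → ℝ} (hf : Test (⊤ : ℕ∞) Ω f) (hg : Test (⊤ : ℕ∞) Ω g)
    (c : ℝ) : Test (⊤ : ℕ∞) Ω fun x => f x + c * g x := by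
  have hg' : HasCompactSupport fun x => c * g x := hg.compact.mul_left
  refine ⟨hf.smooth.add (contDiff_const.mul hg.smooth), hf.compact.add hg', ?_⟩
  refine (tsupport_add f fun x => c * g x).trans (union_subset hf.sub ?_)
  exact (tsupport_mul_subset_right (f := fun _ => c) (g := g)).trans hg.sub

lemma Test.setIntegral_sq {Ω : Set Pl} {f : Pl → ℝ} (hf : Test (⊤ : ℕ∞) Ω f) :
    ∫ x in Ω, f x ^ 2 = ∫ x, f x ^ 2 :=
  setIntegral_eq_integral_of_forall_compl_eq_zero fun x hx => by
    rw [image_eq_zero_of_notMem_tsupport fun h => hx (hf.sub h)]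
    norm_num

lemma Test.setIntegral_gradient {Ω : Set Pl} {f : Pl → ℝ} (hf : Test (⊤ : ℕ∞) Ω f) :
    ∫ x in Ω, ‖gradient f x‖ ^ 2 = ∫ x, ‖gradient f x‖ ^ 2 :=
  setIntegral_eq_integral_of_forall_compl_eq_zero fun x hx => by
    rw [gradient_eq_zero_of_notMem_tsupport fun h => hx (hf.sub h)]
    norm_num

lemma Test.integral_sq_pos {Ω : Set Pl} {f : Pl → ℝ} (hf : Test (⊤ : ℕ∞) Ω f) (h0 : f ≠ 0) :
    0 < ∫ x, f x ^ 2 := by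
  obtain ⟨x, hx⟩ := Function.ne_iff.1 h0
  refine Continuous.integral_pos_of_hasCompactSupport_nonneg_nonzero (x := x)
    (hf.smooth.continuous.pow 2) ?_ (fun x => sq_nonneg _) (pow_ne_zero 2 hx)
  exact hf.compact.comp_left (g := fun t : ℝ => t ^ 2) (by norm_num)

lemma continuous_circle {h : Pl → ℝ} (hh : Continuous h) (ρ : ℝ) :
    Continuous fun θ => h (pol ρ θ) :=
  hh.comp (continuous_pol.comp (continuous_const.prodMk continuous_id))

lemma circ_add_mul {f g : Pl → ℝ} (hf : Continuous f) (hg : Continuous g) (ρ c : ℝ) :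
    circ ρ (fun x => f x + c * g x) = circ ρ f + c * circ ρ g := by
  rw [circ, intervalIntegral.integral_add ((continuous_circle hf ρ).intervalIntegrable _ _)
    (((continuous_circle hg ρ).const_mul c).intervalIntegrable _ _),
    intervalIntegral.integral_const_mul]
  rfl

lemma circ_pos {f : Pl → ℝ} (hf : Continuous f) {ρ : ℝ} (h : ∀ θ, 0 < f (pol ρ θ)) :
    0 < circ ρ f :=
  intervalIntegral.intervalIntegral_pos_of_pos ((continuous_circle hf ρ).intervalIntegrable _ _)
    h (by linarith [pi_pos])

lemma pol_add_two_pi (ρ θ : ℝ) (n : ℤ) : pol ρ (θ + n * (2 * π)) = pol ρ θ := by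
  rw [pol, pol, cos_add_int_mul_two_pi, sin_add_int_mul_two_pi]

lemma exists_circle_bound {f : Pl → ℝ} (hf : Continuous f) {ρ : ℝ} (h : ∀ θ, 0 < f (pol ρ θ)) :
    ∃ c, 0 < c ∧ ∀ θ, c ≤ f (pol ρ θ) := by
  obtain ⟨t, -, ht⟩ := (isCompact_Icc (a := (0 : ℝ)) (b := 2 * π)).exists_isMinOn
    ⟨0, by simp [pi_pos.le]⟩ (continuous_circle hf ρ).continuousOn
  refine ⟨_, h t, fun θ => ?_⟩
  obtain ⟨y, hy, hy'⟩ := (show Function.Periodic (fun θ => f (pol ρ θ)) (2 * π) from fun θ => by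
    have := pol_add_two_pi ρ θ 1
    simp only [Int.cast_one, one_mul] at this
    simp only [this]).exists_mem_Ico₀ two_pi_pos θ
  rw [show f (pol ρ θ) = f (pol ρ y) from hy']
  exact ht ⟨hy.1, hy.2.le⟩

namespace Eigen

variable {Ω : Set Pl} {u : Pl → ℝ}

lemma exists_mass_bound (hu : Eigen Ω u) {p q : Pl} (hp : 0 < u p) (hq : u q < 0) :
    ∃ c0, 0 < c0 ∧ ∃ ε0, 0 < ε0 ∧ ∀ ε, 0 < ε → ε ≤ ε0 → ∀ α β : ℝ,
      c0 * (α ^ 2 + β ^ 2) ≤ ∫ x, cutT ε α β (u x) ^ 2 := by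
  set c := min (u p) (-u q) / 2 with hc
  have hc0 : 0 < c := half_pos (lt_min hp (neg_pos.2 hq))
  have hcp : c < u p := by
    have := min_le_left (u p) (-u q)
    linarith
  have hcq : c < -u q := by
    have := min_le_right (u p) (-u q)
    linarith
  set m : Pl → ℝ := fun x => max (u x - c) 0 ^ 2
  set n : Pl → ℝ := fun x => max (-u x - c) 0 ^ 2
  have cm : Continuous m := ((hu.cont.sub continuous_const).max continuous_const).pow 2
  have cn : Continuous n := ((hu.cont.neg.sub continuous_const).max continuous_const).pow 2
  have sm : HasCompactSupport m := hu.hasCompactSupport.comp_left (g := fun t => max (t - c) 0 ^ 2)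
    (by rw [max_eq_right (by linarith)]; norm_num)
  have sn : HasCompactSupport n := hu.hasCompactSupport.comp_left (g := fun t => max (-t - c) 0 ^ 2)
    (by rw [max_eq_right (by linarith)]; norm_num)
  have pm : 0 < ∫ x, m x := cm.integral_pos_of_hasCompactSupport_nonneg_nonzero sm
    (fun x => sq_nonneg _) (x := p) (pow_ne_zero 2 (by
      rw [max_eq_left (by linarith)]
      linarith))
  have pn : 0 < ∫ x, n x := cn.integral_pos_of_hasCompactSupport_nonneg_nonzero sn
    (fun x => sq_nonneg _) (x := q) (pow_ne_zero 2 (by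
      rw [max_eq_left (by linarith)]
      linarith))
  have im := cm.integrable_of_hasCompactSupport (μ := (volume : Measure Pl)) sm
  have inn := cn.integrable_of_hasCompactSupport (μ := (volume : Measure Pl)) sn
  refine ⟨min (∫ x, m x) (∫ x, n x), lt_min pm pn, c / 2, half_pos hc0, fun ε hε hε0 α β => ?_⟩
  have t := hu.test_cutT hε α β
  have h1 : ∫ x, (α ^ 2 * m x + β ^ 2 * n x) ≤ ∫ x, cutT ε α β (u x) ^ 2 := by
    refine integral_mono ((im.const_mul _).add (inn.const_mul _))
      (integrable_sq t.smooth.continuous t.compact) fun x => ?_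
    simp only [m, n]
    rcases le_total c (u x) with h | h
    · rw [max_eq_left (by linarith), max_eq_right (by linarith), cutT_of_ge hε (by linarith)]
      have : (u x - c) ^ 2 ≤ u x ^ 2 := by nlinarith
      nlinarith [sq_nonneg α]
    · rcases le_total (u x) (-c) with h' | h'
      · rw [max_eq_right (by linarith), max_eq_left (by linarith), cutT_of_le hε (by linarith)]
        have : (-u x - c) ^ 2 ≤ u x ^ 2 := by nlinarith
        nlinarith [sq_nonneg β]
      · rw [max_eq_right (by linarith), max_eq_right (by linarith)]
        nlinarith [sq_nonneg (cutT ε α β (u x))]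
  rw [integral_add (im.const_mul _) (inn.const_mul _), integral_const_mul,
    integral_const_mul] at h1
  nlinarith [min_le_left (∫ x, m x) (∫ x, n x), min_le_right (∫ x, m x) (∫ x, n x),
    sq_nonneg α, sq_nonneg β]

end Eigen

/-- The set whose infimum is the second Dirichlet eigenvalue. -/
def eigSet (Ω : Set Pl) : Set ℝ := { r : ℝ | ∃ E : Submodule ℝ (Pl → ℝ),
    Module.finrank ℝ E = 2 ∧
    (∀ u ∈ E, ContDiff ℝ (⊤ : ℕ∞) u ∧ HasCompactSupport u ∧ tsupport u ⊆ Ω) ∧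
    r = sSup { q : ℝ | ∃ u ∈ E, u ≠ (0 : Pl → ℝ) ∧
        q = (∫ x in Ω, ‖gradient u x‖ ^ 2) / (∫ x in Ω, (u x) ^ 2) } }

lemma dirichletEig_two (Ω : Set Pl) : dirichletEig Ω 2 = sInf (eigSet Ω) := rfl

lemma eigSet_nonneg {Ω : Set Pl} {r : ℝ} (hr : r ∈ eigSet Ω) : 0 ≤ r := by
  obtain ⟨E, -, -, rfl⟩ := hr
  refine Real.sSup_nonneg fun q hq => ?_
  obtain ⟨u, -, -, rfl⟩ := hq
  exact div_nonneg (integral_nonneg fun x => sq_nonneg _) (integral_nonneg fun x => sq_nonneg _)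

lemma cutT_linear (ε α β t : ℝ) : cutT ε α β t = α * cutT ε 1 0 t + β * cutT ε 0 1 t := by
  simp only [cutT]
  ring

lemma Eigen.exists_mem_eigSet {Ω : Set Pl} {u : Pl → ℝ} (hu : Eigen Ω u) {p q : Pl} (hp : 0 < u p)
    (hq : u q < 0) {δ : ℝ} (hδ : 0 < δ) : ∃ r ∈ eigSet Ω, r ≤ 1 + δ := by
  obtain ⟨c0, hc0, ε0, hε0, hm⟩ := hu.exists_mass_bound hp hq
  obtain ⟨C, hC, he⟩ := hu.exists_energy_bound
  set ε := min ε0 (δ * c0 / (C + 1)) with hεd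
  have hε : 0 < ε := lt_min hε0 (by positivity)
  have hCε : C * ε ≤ δ * c0 := by
    have h1 : ε ≤ δ * c0 / (C + 1) := min_le_right _ _
    rw [le_div_iff₀ (by linarith)] at h1
    nlinarith
  set w1 : Pl → ℝ := fun x => cutT ε 1 0 (u x)
  set w2 : Pl → ℝ := fun x => cutT ε 0 1 (u x)
  have hw : ∀ α β : ℝ, α • w1 + β • w2 = fun x => cutT ε α β (u x) := fun α β => by
    funext x
    rw [cutT_linear]
    rfl
  have hli : LinearIndependent ℝ ![w1, w2] := by
    rw [LinearIndependent.pair_iff]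
    intro α β h
    rw [hw] at h
    have h1 := hm ε hε (min_le_left _ _) α β
    have h2 : ∀ x, cutT ε α β (u x) = 0 := fun x => congrFun h x
    simp only [h2] at h1
    norm_num at h1
    have h3 : α ^ 2 + β ^ 2 ≤ 0 := by
      by_contra hn
      have := mul_pos hc0 (not_le.1 hn)
      linarith
    constructor <;> nlinarith [sq_nonneg α, sq_nonneg β]
  refine ⟨_, ⟨Submodule.span ℝ {w1, w2}, ?_, fun f hf => ?_, rfl⟩, ?_⟩
  · have := finrank_span_eq_card hli
    rwa [Matrix.range_cons, Matrix.range_cons, Matrix.range_empty, union_empty, singleton_union,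
      Fintype.card_fin] at this
  · obtain ⟨α, β, rfl⟩ := Submodule.mem_span_pair.1 hf
    rw [hw]
    exact ⟨(hu.test_cutT hε α β).smooth, (hu.test_cutT hε α β).compact, (hu.test_cutT hε α β).sub⟩
  · refine Real.sSup_le (fun q hq => ?_) (by linarith)
    obtain ⟨f, hf, hf0, rfl⟩ := hq
    obtain ⟨α, β, rfl⟩ := Submodule.mem_span_pair.1 hf
    rw [hw] at hf0 ⊢
    have t := hu.test_cutT hε α β
    have hpos := t.integral_sq_pos hf0
    rw [t.setIntegral_gradient, t.setIntegral_sq, div_le_iff₀ hpos]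
    have h1 := (abs_le.1 (he ε hε α β)).2
    have h2 := hm ε hε (min_le_left _ _) α β
    have h3 := mul_le_mul_of_nonneg_right hCε (add_nonneg (sq_nonneg α) (sq_nonneg β))
    nlinarith

lemma rayleigh_bddAbove {Ω : Set Pl} {f g : Pl → ℝ} (hf : Test (⊤ : ℕ∞) Ω f)
    (hg : Test (⊤ : ℕ∞) Ω g) (hli : ∀ α β : ℝ, α • f + β • g = 0 → α = 0 ∧ β = 0) :
    ∃ K, ∀ α β : ℝ, ∫ x, ‖gradient (α • f + β • g) x‖ ^ 2 ≤ K * ∫ x, (α • f + β • g) x ^ 2 := by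
  have i1 := integrable_sq hf.smooth.continuous hf.compact
  have i2 := integrable_sq hg.smooth.continuous hg.compact
  have i3 : Integrable fun x => f x * g x :=
    (hf.smooth.continuous.mul hg.smooth.continuous).integrable_of_hasCompactSupport
      hf.compact.mul_right
  have j1 := integrable_norm_gradient_sq hf.of_le_one hf.compact
  have j2 := integrable_norm_gradient_sq hg.of_le_one hg.compact
  have ht : ∀ α β : ℝ, Test (⊤ : ℕ∞) Ω (α • f + β • g) := fun α β => by
    have t0 : Test (⊤ : ℕ∞) Ω fun _ => 0 :=
      ⟨contDiff_const, HasCompactSupport.zero, by simp⟩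
    have := (t0.add_mul hf α).add_mul hg β
    simp only [zero_add] at this
    exact this
  have hM : ∀ α β : ℝ, ∫ x, (α • f + β • g) x ^ 2 =
      α ^ 2 * (∫ x, f x ^ 2) + 2 * α * β * (∫ x, f x * g x) + β ^ 2 * ∫ x, g x ^ 2 := fun α β => by
    have k := (i1.const_mul (α ^ 2)).add (i3.const_mul (2 * α * β))
    rw [← integral_const_mul, ← integral_const_mul, ← integral_const_mul,
      ← integral_add (i1.const_mul _) (i3.const_mul _), ← integral_add (by exact k)
        (i2.const_mul _)]
    refine integral_congr_ae (Eventually.of_forall fun x => ?_)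
    simp only [Pi.add_apply, Pi.smul_apply, smul_eq_mul]
    ring
  have hD : ∀ α β : ℝ, ∫ x, ‖gradient (α • f + β • g) x‖ ^ 2 ≤
      2 * α ^ 2 * (∫ x, ‖gradient f x‖ ^ 2) + 2 * β ^ 2 * ∫ x, ‖gradient g x‖ ^ 2 := fun α β => by
    rw [← integral_const_mul, ← integral_const_mul, ← integral_add (j1.const_mul _)
      (j2.const_mul _)]
    refine integral_mono (integrable_norm_gradient_sq (ht α β).of_le_one (ht α β).compact)
      ((j1.const_mul _).add (j2.const_mul _)) fun x => ?_
    have df := hf.of_le_one.differentiable one_ne_zero x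
    have dg := hg.of_le_one.differentiable one_ne_zero x
    have e : ∀ i, pd i (α • f + β • g) x = α * pd i f x + β * pd i g x := fun i => by
      rw [← pd_const_mul α df, ← pd_const_mul β dg, ← pd_add (df.const_mul α) (dg.const_mul β)]
      rfl
    simp only [norm_gradient_sq', e]
    nlinarith [sq_nonneg (α * pd 0 f x - β * pd 0 g x), sq_nonneg (α * pd 1 f x - β * pd 1 g x)]
  have hp : ∀ α β : ℝ, (α ≠ 0 ∨ β ≠ 0) → 0 < ∫ x, (α • f + β • g) x ^ 2 := fun α β h => by
    refine (ht α β).integral_sq_pos fun h0 => ?_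
    obtain ⟨h1, h2⟩ := hli α β h0
    tauto
  have hA : 0 < ∫ x, f x ^ 2 := by simpa using hp 1 0 (by norm_num)
  have hCC : 0 < ∫ x, g x ^ 2 := by simpa using hp 0 1 (by norm_num)
  have hD1 : 0 ≤ ∫ x, ‖gradient f x‖ ^ 2 := integral_nonneg fun x => sq_nonneg _
  have hD2 : 0 ≤ ∫ x, ‖gradient g x‖ ^ 2 := integral_nonneg fun x => sq_nonneg _
  have hB := hp (∫ x, f x * g x) (-∫ x, f x ^ 2) (Or.inr (neg_ne_zero.2 hA.ne'))
  rw [hM] at hB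
  simp only [hM]
  generalize (∫ x, f x ^ 2) = A at *
  generalize (∫ x, g x ^ 2) = C at *
  generalize (∫ x, f x * g x) = B at *
  generalize (∫ x, ‖gradient f x‖ ^ 2) = D1 at *
  generalize (∫ x, ‖gradient g x‖ ^ 2) = D2 at *
  have hdet : 0 < A * C - B ^ 2 := by
    have : 0 < A * (A * C - B ^ 2) := by nlinarith
    exact (mul_pos_iff_of_pos_left hA).1 this
  refine ⟨2 * (D1 + D2) * (A + C) / (A * C - B ^ 2), fun α β => (hD α β).trans ?_⟩
  rw [div_mul_eq_mul_div, le_div_iff₀ hdet]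
  have h1 : (A * C - B ^ 2) * (α ^ 2 + β ^ 2) ≤
      (A + C) * (α ^ 2 * A + 2 * α * β * B + β ^ 2 * C) := by
    nlinarith [sq_nonneg (A * α + B * β), sq_nonneg (B * α + C * β)]
  have h2 : 2 * α ^ 2 * D1 + 2 * β ^ 2 * D2 ≤ 2 * (D1 + D2) * (α ^ 2 + β ^ 2) := by
    nlinarith [mul_nonneg (sq_nonneg α) hD2, mul_nonneg (sq_nonneg β) hD1]
  calc _ ≤ 2 * (D1 + D2) * (α ^ 2 + β ^ 2) * (A * C - B ^ 2) :=
        mul_le_mul_of_nonneg_right h2 hdet.le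
    _ = 2 * (D1 + D2) * ((A * C - B ^ 2) * (α ^ 2 + β ^ 2)) := by ring
    _ ≤ 2 * (D1 + D2) * ((A + C) * (α ^ 2 * A + 2 * α * β * B + β ^ 2 * C)) :=
        mul_le_mul_of_nonneg_left h1 (by linarith)
    _ = _ := by ring

lemma Eigen.bil_nonneg {Ω : Set Pl} {u : Pl → ℝ} (hu : Eigen Ω u) {ρ1 ρ2 : ℝ}
    (h1 : ∀ θ, u (pol ρ1 θ) < 0) (h2 : ∀ θ, 0 < u (pol ρ2 θ))
    (heart : ∀ h : Pl → ℝ, Test (⊤ : ℕ∞) Ω h → circ ρ1 h = 0 → circ ρ2 h = 0 →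
      ∫ x, h x ^ 2 ≤ ∫ x, ‖gradient h x‖ ^ 2) {f : Pl → ℝ} (hf : Test (⊤ : ℕ∞) Ω f)
    (hΛ : circ ρ2 u * circ ρ1 f = circ ρ1 u * circ ρ2 f) : 0 ≤ bil f f := by
  obtain ⟨c1, hc1, hb1⟩ := exists_circle_bound hu.cont.neg (ρ := ρ1) fun θ => neg_pos.2 (h1 θ)
  obtain ⟨c2, hc2, hb2⟩ := exists_circle_bound hu.cont h2
  have hl1 : circ ρ1 u < 0 := by
    have := circ_pos hu.cont.neg (ρ := ρ1) fun θ => neg_pos.2 (h1 θ)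
    simp only [circ, Pi.neg_apply, intervalIntegral.integral_neg] at this
    rw [circ]
    linarith
  set c := -circ ρ1 f / circ ρ1 u with hc
  have hcu : c * circ ρ1 u = -circ ρ1 f := div_mul_cancel₀ _ hl1.ne
  obtain ⟨C1, hC1, he1⟩ := hu.exists_bil_bound hf
  obtain ⟨C2, hC2, he2⟩ := hu.exists_energy_bound
  have key : ∀ᶠ ε in 𝓝[>] (0 : ℝ), -(2 * |c| * C1 + c ^ 2 * (C2 * 2)) * ε ≤ bil f f := by
    filter_upwards [Ioo_mem_nhdsGT (show (0 : ℝ) < min c1 c2 / 2 from half_pos (lt_min hc1 hc2))]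
      with ε hε
    have hε0 := hε.1
    have t := hu.test_cutT hε0 1 (-1)
    have th := hf.add_mul t c
    have k1 : circ ρ1 (fun x => cutT ε 1 (-1) (u x)) = circ ρ1 u := by
      refine intervalIntegral.integral_congr fun θ _ => ?_
      have := hb1 θ
      rw [Pi.neg_apply] at this
      have h4 := min_le_left c1 c2
      simp only
      rw [cutT_of_le hε0 (by linarith [hε.2])]
      ring
    have k2 : circ ρ2 (fun x => cutT ε 1 (-1) (u x)) = circ ρ2 u := by
      refine intervalIntegral.integral_congr fun θ _ => ?_
      have := hb2 θ
      have h4 := min_le_right c1 c2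
      simp only
      rw [cutT_of_ge hε0 (by linarith [hε.2])]
      ring
    have := heart _ th (by
      rw [circ_add_mul hf.smooth.continuous t.smooth.continuous, k1, hcu]
      ring) (by
      rw [circ_add_mul hf.smooth.continuous t.smooth.continuous, k2]
      apply mul_left_cancel₀ hl1.ne
      linear_combination -hΛ + circ ρ2 u * hcu)
    have hh : 0 ≤ bil _ _ := (sub_nonneg.2 this).trans_eq
      (bil_self th.of_le_one th.compact).symm
    rw [bil_add_self hf.of_le_one hf.compact t.of_le_one t.compact,
      bil_self t.of_le_one t.compact] at hh
    have a1 := he1 ε hε0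
    have a2 := (abs_le.1 (he2 ε hε0 1 (-1))).2
    have a3 : c * bil f (fun x => cutT ε 1 (-1) (u x)) ≤ |c| * (C1 * ε) :=
      (le_abs_self _).trans (by rw [abs_mul]; exact mul_le_mul_of_nonneg_left a1 (abs_nonneg c))
    have a4 := mul_le_mul_of_nonneg_left a2 (sq_nonneg c)
    norm_num at a4
    linarith
  have lim : Tendsto (fun ε : ℝ => -(2 * |c| * C1 + c ^ 2 * (C2 * 2)) * ε) (𝓝[>] 0) (𝓝 0) := by
    have : Tendsto (fun ε : ℝ => -(2 * |c| * C1 + c ^ 2 * (C2 * 2)) * ε) (𝓝 0) (𝓝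
      (-(2 * |c| * C1 + c ^ 2 * (C2 * 2)) * 0)) := tendsto_id.const_mul _
    rw [mul_zero] at this
    exact this.mono_left nhdsWithin_le_nhds
  exact le_of_tendsto_of_tendsto lim tendsto_const_nhds key

theorem Eigen.dirichletEig_eq {Ω : Set Pl} {u : Pl → ℝ} (hu : Eigen Ω u) {ρ1 ρ2 : ℝ}
    (h1 : ∀ θ, u (pol ρ1 θ) < 0) (h2 : ∀ θ, 0 < u (pol ρ2 θ))
    (heart : ∀ h : Pl → ℝ, Test (⊤ : ℕ∞) Ω h → circ ρ1 h = 0 → circ ρ2 h = 0 →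
      ∫ x, h x ^ 2 ≤ ∫ x, ‖gradient h x‖ ^ 2) : dirichletEig Ω 2 = 1 := by
  rw [dirichletEig_two]
  have hex := fun {δ : ℝ} (hδ : 0 < δ) => hu.exists_mem_eigSet (h2 0) (h1 0) hδ
  apply le_antisymm
  · refine le_of_forall_pos_le_add fun δ hδ => ?_
    obtain ⟨r, hr, hr1⟩ := hex hδ
    exact (csInf_le ⟨0, fun r hr => eigSet_nonneg hr⟩ hr).trans hr1
  · obtain ⟨r0, hr0, -⟩ := hex one_pos
    refine le_csInf ⟨r0, hr0⟩ ?_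
    rintro r ⟨E, hE, hT, rfl⟩
    have hT' : ∀ f ∈ E, Test (⊤ : ℕ∞) Ω f := fun f hf => ⟨(hT f hf).1, (hT f hf).2.1, (hT f hf).2.2⟩
    have : Module.Finite ℝ E := Module.finite_of_finrank_pos (by omega)
    set b := Module.finBasisOfFinrankEq ℝ E hE
    set f : Pl → ℝ := (b 0).1
    set g : Pl → ℝ := (b 1).1
    have hf : Test (⊤ : ℕ∞) Ω f := hT' f (b 0).2
    have hg : Test (⊤ : ℕ∞) Ω g := hT' g (b 1).2
    have hli : ∀ α β : ℝ, α • f + β • g = 0 → α = 0 ∧ β = 0 := fun α β h => by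
      have h0 : α • b 0 + β • b 1 = 0 := Subtype.ext h
      have := Fintype.linearIndependent_iff.1 b.linearIndependent ![α, β] (by simpa using h0)
      exact ⟨this 0, this 1⟩
    have hspan : ∀ h ∈ E, ∃ α β : ℝ, h = α • f + β • g := fun h hh => by
      have := b.sum_repr ⟨h, hh⟩
      rw [Fin.sum_univ_two] at this
      exact ⟨_, _, (congrArg Subtype.val this).symm⟩
    obtain ⟨K, hK⟩ := rayleigh_bddAbove hf hg hli
    obtain ⟨α, β, hαβ, hΛ⟩ : ∃ α β : ℝ, (α ≠ 0 ∨ β ≠ 0) ∧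
        circ ρ2 u * (α * circ ρ1 f + β * circ ρ1 g) =
          circ ρ1 u * (α * circ ρ2 f + β * circ ρ2 g) := by
      by_cases hz : circ ρ2 u * circ ρ1 f - circ ρ1 u * circ ρ2 f = 0
      · exact ⟨1, 0, by norm_num, by linear_combination hz⟩
      · exact ⟨circ ρ2 u * circ ρ1 g - circ ρ1 u * circ ρ2 g,
          -(circ ρ2 u * circ ρ1 f - circ ρ1 u * circ ρ2 f), Or.inr (neg_ne_zero.2 hz), by ring⟩
    have hw : α • f + β • g ∈ E := E.add_mem (E.smul_mem _ (b 0).2) (E.smul_mem _ (b 1).2)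
    have tw := hT' _ hw
    have hw0 : α • f + β • g ≠ 0 := fun h0 => by
      obtain ⟨h3, h4⟩ := hli α β h0
      tauto
    have ec : ∀ ρ, circ ρ (α • f + β • g) = α * circ ρ f + β * circ ρ g := fun ρ => by
      have := circ_add_mul (hf.smooth.continuous.const_mul α) hg.smooth.continuous ρ β
      have e2 := circ_add_mul (f := fun _ => 0) continuous_const hf.smooth.continuous ρ α
      simp only [zero_add] at e2
      rw [e2] at this
      simp only [circ, intervalIntegral.integral_zero, zero_add] at this ⊢
      exact this
    have hq := hu.bil_nonneg h1 h2 heart tw (by rw [ec, ec]; exact hΛ)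
    rw [bil_self tw.of_le_one tw.compact] at hq
    refine le_csSup_of_le ⟨K, ?_⟩ ⟨_, hw, hw0, rfl⟩ ?_
    · rintro _ ⟨h, hh, hh0, rfl⟩
      have th := hT' h hh
      rw [th.setIntegral_gradient, th.setIntegral_sq, div_le_iff₀ (th.integral_sq_pos hh0)]
      obtain ⟨a, c, rfl⟩ := hspan h hh
      exact hK a c
    · rw [tw.setIntegral_gradient, tw.setIntegral_sq, le_div_iff₀ (tw.integral_sq_pos hw0)]
      linarith

lemma pd_norm_sub_sq (i : Fin 2) (x y : Pl) : pd i (fun x => ‖x - y‖ ^ 2) x = 2 * (x i - y i) := by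
  have h := ((hasFDerivAt_id (𝕜 := ℝ) x).sub_const y).norm_sq
  have h' : HasFDerivAt (fun x : Pl => ‖x - y‖ ^ 2) _ x := h
  rw [pd, h'.fderiv]
  simp [EuclideanSpace.inner_single_right]

lemma contDiff_norm_sub_sq (y : Pl) : ContDiff ℝ (⊤ : ℕ∞) fun x : Pl => ‖x - y‖ ^ 2 :=
  (contDiff_id.sub contDiff_const).norm_sq ℝ

lemma lap_radial {φ φ1 : ℝ → ℝ} {φ2 : ℝ} {x y : Pl}
    (h1 : ∀ᶠ s in 𝓝 (‖x - y‖ ^ 2), HasDerivAt φ (φ1 s) s) (h2 : HasDerivAt φ1 φ2 (‖x - y‖ ^ 2)) :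
    lap (fun x => φ (‖x - y‖ ^ 2)) x = 4 * (‖x - y‖ ^ 2 * φ2 + φ1 (‖x - y‖ ^ 2)) := by
  have dq : ∀ z, DifferentiableAt ℝ (fun x : Pl => ‖x - y‖ ^ 2) z := fun z =>
    (contDiff_norm_sub_sq y).differentiable (by simp) z
  have e1 : ∀ i, pd i (fun x => φ (‖x - y‖ ^ 2)) =ᶠ[𝓝 x]
      fun z => φ1 (‖z - y‖ ^ 2) * (2 * (z i - y i)) := fun i => by
    have hc : Tendsto (fun z : Pl => ‖z - y‖ ^ 2) (𝓝 x) (𝓝 (‖x - y‖ ^ 2)) :=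
      (contDiff_norm_sub_sq y).continuous.continuousAt
    filter_upwards [hc.eventually h1] with z hz
    rw [pd_comp hz (dq z), pd_norm_sub_sq]
  have e2 : ∀ i, pd i (pd i (fun x => φ (‖x - y‖ ^ 2))) x =
      φ1 (‖x - y‖ ^ 2) * 2 + φ2 * (2 * (x i - y i)) * (2 * (x i - y i)) := fun i => by
    have hl : HasFDerivAt (fun z : Pl => 2 * (z i - y i))
        ((2 : ℝ) • (EuclideanSpace.proj i : Pl →L[ℝ] ℝ)) x :=
      ((EuclideanSpace.proj i : Pl →L[ℝ] ℝ).hasFDerivAt.sub_const (y i)).const_mul 2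
    have hp : pd i (fun z : Pl => 2 * (z i - y i)) x = 2 := by
      rw [pd, hl.fderiv]
      simp
    rw [pd_congr (e1 i), pd_mul (f := fun z => φ1 (‖z - y‖ ^ 2))
      (h2.differentiableAt.comp x (dq x)) hl.differentiableAt, hp,
      pd_comp h2 (dq x), pd_norm_sub_sq]
  have hn : ‖x - y‖ ^ 2 = (x 0 - y 0) ^ 2 + (x 1 - y 1) ^ 2 := by
    rw [EuclideanSpace.norm_sq_eq, Fin.sum_univ_two]
    simp
  rw [lap_eq, e2, e2]
  linear_combination (-4 * φ2) * hn

/-- The function `f` is smooth near `x` and satisfies `-Δ f = f` at `x`. -/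
structure Sol (f : Pl → ℝ) (x : Pl) : Prop where
  smooth : ContDiffAt ℝ (⊤ : ℕ∞) f x
  eq : lap f x = -f x

lemma Sol.add_mul {f g : Pl → ℝ} {x : Pl} (hf : Sol f x) (hg : Sol g x) (c : ℝ) :
    Sol (fun y => f y + c * g y) x := by
  refine ⟨hf.smooth.add (contDiffAt_const.mul hg.smooth), ?_⟩
  have d : ∀ {f : Pl → ℝ}, Sol f x → ContDiffAt ℝ 2 f x := fun h =>
    h.smooth.of_le (natCast_le_top 2)
  have dd : ∀ {f : Pl → ℝ}, Sol f x → ∀ᶠ y in 𝓝 x, DifferentiableAt ℝ f y := fun h => by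
    filter_upwards [(d h).eventually (by simp)] with y hy using hy.differentiableAt (by norm_num)
  have d2 : ∀ {f : Pl → ℝ}, Sol f x → ∀ i, DifferentiableAt ℝ (pd i f) x := fun h i =>
    (contDiffAt_pd (m := 1) (d h) (by norm_num)).differentiableAt (by norm_num)
  have e : ∀ i, pd i (pd i fun y => f y + c * g y) x =
      pd i (pd i f) x + c * pd i (pd i g) x := fun i => by
    have : pd i (fun y => f y + c * g y) =ᶠ[𝓝 x] fun y => pd i f y + c * pd i g y := by
      filter_upwards [dd hf, dd hg] with y h1 h2
      rw [pd_add h1 (h2.const_mul c), pd_const_mul c h2]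
    rw [pd_congr this, pd_add (d2 hf i) ((d2 hg i).const_mul c), pd_const_mul c (d2 hg i)]
  have h1 := hf.eq
  have h2 := hg.eq
  rw [lap_eq] at h1 h2 ⊢
  rw [e, e]
  linear_combination h1 + c * h2

lemma sol_zero (x : Pl) : Sol (fun _ => 0) x :=
  ⟨contDiffAt_const, by simp [lap]⟩

lemma Sol.sum {ι : Type*} (s : Finset ι) {f : ι → Pl → ℝ} {x : Pl} (h : ∀ i ∈ s, Sol (f i) x) :
    Sol (fun y => ∑ i ∈ s, f i y) x := by
  classical
  induction s using Finset.induction_on with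
  | empty => simpa using sol_zero x
  | insert a s ha ih =>
    have := (h a (Finset.mem_insert_self a s)).add_mul
      (ih fun i hi => h i (Finset.mem_insert_of_mem hi)) 1
    simpa [Finset.sum_insert ha] using this

lemma sol_fa (x : Pl) : Sol (fun y => fa (‖y‖ ^ 2)) x := by
  have hd : HasDerivAt fa1 (deriv fa1 (‖x - 0‖ ^ 2)) (‖x - 0‖ ^ 2) :=
    (contDiff_fa1.differentiable (by simp) _).hasDerivAt
  have h := lap_radial (x := x) (y := 0) (Eventually.of_forall fun s => hasDerivAt_fa s) hd
  have h2 := ((hasDerivAt_id _).mul hd).unique (hasDerivAt_mul_fa1 (‖x - 0‖ ^ 2))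
  simp only [sub_zero, id] at h h2
  refine ⟨contDiff_fa.contDiffAt.comp x ((contDiff_id.norm_sq ℝ).contDiffAt), ?_⟩
  rw [h]
  linarith

lemma sol_ph {x y : Pl} (hxy : x ≠ y) : Sol (fun x => ph (‖x - y‖ ^ 2)) x := by
  have h0 : ‖x - y‖ ^ 2 ≠ 0 := pow_ne_zero 2 (norm_ne_zero_iff.2 (sub_ne_zero.2 hxy))
  have hd := hasDerivAt_ph1 h0
  have h := lap_radial (x := x) (y := y) (φ := ph) (φ1 := ph1) (by
    filter_upwards [isOpen_ne.mem_nhds h0] with s hs using hasDerivAt_ph hs) hd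
  have h2 := ((hasDerivAt_id _).mul hd).unique (hasDerivAt_mul_ph1 h0)
  have hs := (contDiffAt_ph h0).comp (f := fun x : Pl => ‖x - y‖ ^ 2) x
    (contDiff_norm_sub_sq y).contDiffAt
  refine ⟨hs, ?_⟩
  rw [h]
  linarith

/-- The points at which the solution is singular. -/
noncomputable def pts (R : ℝ) (N : ℕ) (j : ℕ) : Pl := pol R (2 * π * j / N)

/-- A multi-pole solution of `-Δ v = v`. -/
noncomputable def vv (R : ℝ) (N : ℕ) (c : ℝ) (x : Pl) : ℝ :=
  (∑ j ∈ Finset.range N, ph (‖x - pts R N j‖ ^ 2)) + -c * fa (‖x‖ ^ 2)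

lemma sol_vv {R : ℝ} {N : ℕ} {x : Pl} (hx : ∀ j ∈ Finset.range N, x ≠ pts R N j) (c : ℝ) :
    Sol (vv R N c) x :=
  (Sol.sum _ fun j hj => sol_ph (hx j hj)).add_mul (sol_fa x) (-c)

/-- The point of the complex plane corresponding to a point of the Euclidean plane. -/
noncomputable def toC (x : Pl) : ℂ := (x 0 : ℂ) + (x 1 : ℂ) * Complex.I

lemma continuous_toC : Continuous toC := by
  unfold toC
  fun_prop

lemma toC_re (x : Pl) : (toC x).re = x 0 := by simp [toC]
lemma toC_im (x : Pl) : (toC x).im = x 1 := by simp [toC]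

lemma norm_toC_sub (x y : Pl) : ‖toC x - toC y‖ = ‖x - y‖ := by
  rw [← sq_eq_sq₀ (norm_nonneg _) (norm_nonneg _), ← Complex.normSq_eq_norm_sq,
    EuclideanSpace.norm_sq_eq, Complex.normSq_apply, Fin.sum_univ_two]
  simp only [Complex.sub_re, Complex.sub_im, toC_re, toC_im, PiLp.sub_apply, norm_eq_abs, sq_abs]
  ring

lemma norm_toC (x : Pl) : ‖toC x‖ = ‖x‖ := by
  have := norm_toC_sub x 0
  have h : toC 0 = 0 := by simp [toC]
  rwa [h, sub_zero, sub_zero] at this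

lemma toC_injective : Injective toC := fun x y h => by
  rw [← sub_eq_zero, ← norm_eq_zero, ← norm_toC_sub, h, sub_self, norm_zero]

lemma toC_pol (r θ : ℝ) : toC (pol r θ) = circleMap 0 r θ := by
  apply Complex.ext
  · rw [toC_re, circleMap_zero, pol, Complex.re_ofReal_mul, Complex.exp_ofReal_mul_I_re]
    simp
  · rw [toC_im, circleMap_zero, pol, Complex.im_ofReal_mul, Complex.exp_ofReal_mul_I_im]
    simp

lemma toC_pts (R : ℝ) (N j : ℕ) : toC (pts R N j) = pt R N j := toC_pol _ _

lemma exists_eq_pol (x : Pl) : ∃ θ, x = pol ‖x‖ θ :=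
  ⟨(toC x).arg, toC_injective (by
    rw [toC_pol, circleMap_zero, ← norm_toC, Complex.norm_mul_exp_arg_mul_I])⟩

lemma EE_nonneg (R N r θ : ℝ) : 0 ≤ EE R N r θ := by
  rw [EE]
  linarith [one_le_cosh (N * Real.log (r / R)), cos_le_one (N * θ)]

lemma norm_pow_sub_sq {R r : ℝ} (hR : 0 < R) (hr : 0 < r) (N : ℕ) (θ : ℝ) :
    ‖circleMap 0 r θ ^ N - (R : ℂ) ^ N‖ ^ 2 = (r * R) ^ N * EE R N r θ := by
  have e1 : circleMap 0 r θ ^ N - (R : ℂ) ^ N =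
      ((r ^ N * cos (N * θ) - R ^ N : ℝ) : ℂ) + ((r ^ N * sin (N * θ) : ℝ) : ℂ) * Complex.I := by
    rw [circleMap_zero, mul_pow, ← Complex.exp_nat_mul, ← mul_assoc]
    have : ((N : ℂ) * (θ : ℂ)) = ((N * θ : ℝ) : ℂ) := by push_cast; rfl
    rw [this, Complex.exp_mul_I]
    push_cast
    ring
  have e2 : rexp (N * Real.log (r / R)) = (r / R) ^ N := by
    rw [exp_nat_mul, exp_log (by positivity)]
  rw [e1, ← Complex.normSq_eq_norm_sq, Complex.normSq_add_mul_I, EE, cosh_eq, exp_neg, e2]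
  have h3 := sin_sq_add_cos_sq (N * θ)
  rw [mul_pow, div_pow]
  field_simp
  linear_combination ((r ^ N) ^ 3 * R ^ N) * h3

lemma pow_eq_of_EE_eq_zero {R r θ : ℝ} (hR : 0 < R) (hr : 0 < r) {N : ℕ} :
    EE R N r θ = 0 ↔ circleMap 0 r θ ^ N = (R : ℂ) ^ N := by
  have h := norm_pow_sub_sq hR hr N θ
  have hp : 0 < (r * R) ^ N := by positivity
  refine ⟨fun h0 => ?_, fun h0 => ?_⟩
  · rw [h0, mul_zero] at h
    exact sub_eq_zero.1 (norm_eq_zero.1 (pow_eq_zero_iff two_ne_zero |>.1 h))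
  · rw [h0, sub_self, norm_zero, zero_pow two_ne_zero] at h
    exact (mul_eq_zero.1 h.symm).resolve_left hp.ne'

lemma EE_pos {R r θ : ℝ} (hR : 0 < R) (hr : 0 < r) {N : ℕ} (hN : 0 < N)
    (h : ∀ j ∈ Finset.range N, pol r θ ≠ pts R N j) : 0 < EE R N r θ := by
  refine lt_of_le_of_ne (EE_nonneg _ _ _ _) fun h0 => ?_
  have h1 := (pow_eq_of_EE_eq_zero hR hr).1 h0.symm
  rw [← sub_eq_zero, ← prod_sub_pt R hN, Finset.prod_eq_zero_iff] at h1
  obtain ⟨j, hj, hz⟩ := h1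
  refine h j hj (toC_injective ?_)
  rw [toC_pol, toC_pts]
  exact sub_eq_zero.1 hz

/-- The leading part of the multi-pole solution. -/
noncomputable def lead (R : ℝ) (N : ℕ) (B r θ : ℝ) : ℝ :=
  N * Phi R (max r R) - B * jj r + Real.log (EE R N r θ) / 2 - N * |Real.log (r / R)| / 2

lemma exists_vv_bound {R : ℝ} (hR : 0 < R) (R' : ℝ) : ∃ C, ∀ N : ℕ, 0 < N → ∀ B r θ : ℝ, 0 < r →
    r ≤ R' → 0 < EE R N r θ → |vv R N (N * gg R + B) (pol r θ) - lead R N B r θ| ≤ C := by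
  obtain ⟨C, hC⟩ := exists_sum_bound hR R'
  refine ⟨C, fun N hN B r θ hr hr' hE => ?_⟩
  have hz : circleMap 0 r θ ^ N ≠ (R : ℂ) ^ N := fun h =>
    hE.ne' ((pow_eq_of_EE_eq_zero hR hr).2 h)
  have hn : ‖circleMap 0 r θ‖ = r := by rw [norm_circleMap_zero, abs_of_pos hr]
  have hb := hC N hN (circleMap 0 r θ) (by rw [hn]; exact hr') hz
  have e1 : Real.log ‖circleMap 0 r θ ^ N - (R : ℂ) ^ N‖ =
      N / 2 * (Real.log r + Real.log R) + Real.log (EE R N r θ) / 2 := by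
    have := congrArg Real.log (norm_pow_sub_sq hR hr N θ)
    rw [Real.log_pow, Real.log_mul (by positivity) hE.ne', Real.log_pow,
      Real.log_mul hr.ne' hR.ne'] at this
    push_cast at this
    linarith
  have e2 : ∀ j, ‖pol r θ - pts R N j‖ = ‖circleMap 0 r θ - pt R N j‖ := fun j => by
    rw [← norm_toC_sub, toC_pol, toC_pts]
  have e3 : N * meanK R r + (N / 2 * (Real.log r + Real.log R) + Real.log (EE R N r θ) / 2) +
      -(N * gg R + B) * jj r = lead R N B r θ := by
    rw [lead, meanK, Real.log_div hr.ne' hR.ne']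
    rcases le_total r R with h | h
    · rw [max_eq_right h, min_eq_left h, Phi_self,
        abs_of_nonpos (sub_nonpos.2 (Real.log_le_log hr h))]
      ring
    · rw [max_eq_left h, min_eq_right h, Phi,
        abs_of_nonneg (sub_nonneg.2 (Real.log_le_log hR h))]
      ring
  have e4 : vv R N (N * gg R + B) (pol r θ) = (∑ j ∈ Finset.range N,
      ph (‖circleMap 0 r θ - pt R N j‖ ^ 2)) + -(N * gg R + B) * jj r := by
    rw [vv, norm_pol, sq_abs, jj]
    simp only [e2]
  rw [hn, e1] at hb
  rw [e4, ← e3]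
  convert hb using 2
  ring

lemma exp_mul_EE (R : ℝ) (N : ℕ) (r θ : ℝ) : rexp (-(N * |Real.log (r / R)|)) * EE R N r θ =
    1 + rexp (-(N * |Real.log (r / R)|)) ^ 2 -
      2 * rexp (-(N * |Real.log (r / R)|)) * cos (N * θ) := by
  have : cosh (N * Real.log (r / R)) = cosh (N * |Real.log (r / R)|) := by
    rw [← cosh_abs (N * Real.log (r / R)), abs_mul, Nat.abs_cast]
  rw [EE, this, cosh_eq, exp_neg]
  have := (exp_pos (N * |Real.log (r / R)|)).ne'
  field_simp

lemma lead_eq {R : ℝ} {N : ℕ} {B r θ : ℝ} (hE : 0 < EE R N r θ) :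
    lead R N B r θ = N * Phi R (max r R) - B * jj r +
      Real.log (1 + rexp (-(N * |Real.log (r / R)|)) ^ 2 -
        2 * rexp (-(N * |Real.log (r / R)|)) * cos (N * θ)) / 2 := by
  rw [← exp_mul_EE, Real.log_mul (exp_pos _).ne' hE.ne', Real.log_exp, lead]
  ring

/-- Away from the singular circle the logarithmic term of `lead` is bounded. -/
lemma eventually_lead_bound {R r : ℝ} (hR : 0 < R) (hr : 0 < r) (hne : r ≠ R) :
    ∀ᶠ N : ℕ in atTop, ∀ B θ, 0 < EE R N r θ ∧
      |lead R N B r θ - (N * Phi R (max r R) - B * jj r)| ≤ 1 := by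
  have ht : 0 < |Real.log (r / R)| := by
    rw [abs_pos, Real.log_div hr.ne' hR.ne', sub_ne_zero]
    exact fun h => hne (Real.log_injOn_pos hr hR h)
  have h1 : Tendsto (fun N : ℕ => rexp (-(N * |Real.log (r / R)|))) atTop (𝓝 0) :=
    tendsto_exp_neg_atTop_nhds_zero.comp (tendsto_natCast_atTop_atTop.atTop_mul_const ht)
  filter_upwards [h1.eventually (gt_mem_nhds (show (0 : ℝ) < 1 / 2 by norm_num))] with N hN B θ
  have h0 := exp_pos (-(N * |Real.log (r / R)|))
  have hEE := exp_mul_EE R N r θ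
  have hc1 := cos_le_one (N * θ)
  have hc2 := neg_one_le_cos (N * θ)
  have hle := fun hE => lead_eq (R := R) (N := N) (B := B) (r := r) (θ := θ) hE
  set ρ := rexp (-(N * |Real.log (r / R)|))
  have hlow : 1 / 4 ≤ 1 + ρ ^ 2 - 2 * ρ * cos (N * θ) := by nlinarith
  have hup : 1 + ρ ^ 2 - 2 * ρ * cos (N * θ) ≤ 4 := by nlinarith
  have hE : 0 < EE R N r θ := by
    have : 0 < ρ * EE R N r θ := by rw [hEE]; linarith
    exact (mul_pos_iff_of_pos_left h0).1 this
  refine ⟨hE, ?_⟩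
  rw [hle hE, add_sub_cancel_left]
  have l4 : Real.log 4 ≤ 2 := by
    have : Real.log 4 = 2 * Real.log 2 := by
      rw [show (4 : ℝ) = 2 ^ 2 by norm_num, Real.log_pow]
      norm_num
    linarith [Real.log_two_lt_d9]
  have a1 := Real.log_le_log (by norm_num) hlow
  have a2 := Real.log_le_log (by linarith) hup
  rw [one_div, Real.log_inv] at a1
  rw [abs_le]
  constructor <;> linarith

lemma exists_Phi_le {R r2 : ℝ} (hR : 0 < R) (h : R < r2) :
    ∃ K, 0 ≤ K ∧ ∀ r ∈ Icc R r2, Phi R r ≤ K * Real.log (r / R) := by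
  have hpos : ∀ r ∈ Icc R r2, 0 < r := fun r hr => hR.trans_le hr.1
  obtain ⟨K, hK⟩ := isCompact_Icc.exists_bound_of_continuousOn (continuousOn_XPhi (R := R) hpos)
  have hK0 : 0 ≤ K := (norm_nonneg _).trans (hK R ⟨le_rfl, h.le⟩)
  refine ⟨K, hK0, fun r hr => ?_⟩
  have hanti : AntitoneOn (fun r => Phi R r - K * Real.log (r / R)) (Icc R r2) := by
    have hd : ∀ r ∈ Icc R r2, HasDerivAt (fun r => Phi R r - K * Real.log (r / R))
        (XPhi R r / r - K * (1 / r)) r := fun r hr => by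
      have h0 := (hpos r hr).ne'
      have hl : HasDerivAt (fun r => Real.log (r / R)) (1 / r) r := by
        refine (((hasDerivAt_id r).div_const R).log (by simp; exact ⟨h0, hR.ne'⟩)).congr_deriv ?_
        simp only [id]
        field_simp
      exact (hasDerivAt_Phi R h0).sub (hl.const_mul K)
    refine antitoneOn_of_deriv_nonpos (convex_Icc R r2)
      (fun r hr => (hd r hr).continuousAt.continuousWithinAt)
      (fun r hr => (hd r (interior_subset hr)).differentiableAt.differentiableWithinAt)
      fun r hr => ?_
    have hr' := interior_subset hr
    rw [(hd r hr').deriv, ← mul_one_div (XPhi R r), ← sub_mul]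
    refine mul_nonpos_of_nonpos_of_nonneg ?_ (one_div_nonneg.2 (hpos r hr').le)
    linarith [(le_abs_self _).trans (hK r hr')]
  have := hanti ⟨le_rfl, h.le⟩ hr hr.1
  simp only [Phi_self, div_self hR.ne', Real.log_one] at this
  linarith

/-- The sign pattern of a multi-pole solution. -/
structure Signs {κ : ℝ} (d : Data κ) (A0 : ℝ) (N : ℕ) (v : Pl → ℝ) : Prop where
  N_pos : 0 < N
  sol : ∀ x, (∀ j ∈ Finset.range N, x ≠ pts d.R N j) → Sol v x
  neg_r1 : ∀ θ, v (pol d.r1 θ) < 0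
  pos_s : ∀ θ, 0 < v (pol d.s θ)
  pos_r2 : ∀ θ, 0 < v (pol d.r2 θ)
  neg_R3 : ∀ θ, v (pol d.R3 θ) < 0
  pos_ray : ∀ r ∈ Icc d.s d.r2, 0 < EE d.R N r (π / N) ∧ 0 < v (pol r (π / N))
  nonpos : ∀ r ∈ Icc d.s d.r2, ∀ θ, 0 < EE d.R N r θ → EE d.R N r θ ≤ rexp (-2 * A0) →
    v (pol r θ) ≤ 0

lemma Data.R_pos {κ : ℝ} (d : Data κ) : 0 < d.R :=
  d.r1_pos.trans (d.r1_lt.trans d.s_lt)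

lemma Data.s_pos {κ : ℝ} (d : Data κ) : 0 < d.s := d.r1_pos.trans d.r1_lt

lemma one_add_sq_div_two_le_cosh (x : ℝ) : 1 + x ^ 2 / 2 ≤ cosh x := by
  have h1 : |x| / 2 ≤ sinh (|x| / 2) := self_le_sinh_iff.2 (by positivity)
  have h2 : cosh |x| = cosh (|x| / 2) ^ 2 + sinh (|x| / 2) ^ 2 := by
    rw [← cosh_two_mul]
    congr 1
    ring
  rw [← cosh_abs x, h2, cosh_sq, ← sq_abs x]
  have h3 := abs_nonneg x
  nlinarith

lemma abs_le_one_of_EE_le_one {R r θ : ℝ} {N : ℕ} (h : EE R N r θ ≤ 1) :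
    N * |Real.log (r / R)| ≤ 1 := by
  have h1 := one_add_sq_div_two_le_cosh (N * Real.log (r / R))
  have h2 := cos_le_one (N * θ)
  rw [EE] at h
  have h3 : (N * |Real.log (r / R)|) ^ 2 ≤ 1 := by
    rw [mul_pow, sq_abs, ← mul_pow]
    linarith
  exact (sq_le_one_iff₀ (by positivity)).1 h3

lemma exists_signs {κ : ℝ} (d : Data κ) : ∃ A0, 0 ≤ A0 ∧ ∃ B, ∀ᶠ N : ℕ in atTop,
    Signs d A0 N (vv d.R N (N * gg d.R + B)) := by
  have hR := d.R_pos
  have hs := d.s_pos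
  have h2 := d.R_lt
  have h3 := d.r2_lt
  have h1 := d.r1_lt
  have h0 := d.s_lt
  have hr1 := d.r1_pos
  obtain ⟨C, hC⟩ := exists_vv_bound hR d.R3
  have hC0 : 0 ≤ |C| := abs_nonneg C
  have hCle := le_abs_self C
  obtain ⟨K, hK0, hK⟩ := exists_Phi_le hR h2
  have hne : (Icc d.s d.r2).Nonempty := ⟨d.s, le_rfl, by linarith⟩
  obtain ⟨ra, hra, hmax⟩ := isCompact_Icc.exists_isMaxOn hne continuous_jj.continuousOn
  obtain ⟨rb, hrb, hmin⟩ := isCompact_Icc.exists_isMinOn hne continuous_jj.continuousOn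
  have hm := d.jj_neg ra hra
  have hM := d.jj_neg rb hrb
  have hj1 := d.jj_r1
  set B := (|C| + 2) / jj d.r1 + (|C| + 2) / -jj ra with hB
  have t1 : 0 < (|C| + 2) / jj d.r1 := by positivity
  have t2 : 0 < (|C| + 2) / -jj ra := div_pos (by linarith) (by linarith)
  have hB0 : 0 < B := by positivity
  have hB1 : |C| + 2 ≤ B * jj d.r1 := by
    rw [hB, add_mul, div_mul_cancel₀ _ hj1.ne']
    have := mul_pos t2 hj1
    linarith
  have hB2 : ∀ r ∈ Icc d.s d.r2, B * jj r ≤ -(|C| + 2) := fun r hr => by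
    have h4 : B * jj r ≤ B * jj ra := mul_le_mul_of_nonneg_left (hmax hr) hB0.le
    have h5 : (|C| + 2) / -jj ra * -jj ra = |C| + 2 := div_mul_cancel₀ _ (by linarith)
    have h6 : B * jj ra = (|C| + 2) / jj d.r1 * jj ra - (|C| + 2) / -jj ra * -jj ra := by
      rw [hB]
      ring
    have := mul_neg_of_pos_of_neg t1 hm
    linarith
  have hB3 : ∀ r ∈ Icc d.s d.r2, -(B * jj r) ≤ -(B * jj rb) := fun r hr =>
    neg_le_neg (mul_le_mul_of_nonneg_left (hmin hr) hB0.le)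
  have hBM : 0 ≤ -(B * jj rb) := by nlinarith
  have hPhi0 : ∀ r ∈ Icc d.s d.r2, 0 ≤ Phi d.R (max r d.R) := fun r hr => by
    rcases le_or_gt r d.R with h | h
    · rw [max_eq_right h, Phi_self]
    · rw [max_eq_left h.le]
      exact (d.Phi_pos r ⟨h, hr.2⟩).le
  refine ⟨K + -(B * jj rb) + |C|, by linarith, B, ?_⟩
  have hlim : Tendsto (fun N : ℕ => (N : ℝ) * Phi d.R d.R3) atTop atBot :=
    tendsto_natCast_atTop_atTop.atTop_mul_const_of_neg d.Phi_R3
  filter_upwards [eventually_gt_atTop 0, eventually_lead_bound hR hr1 (by linarith),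
    eventually_lead_bound hR hs h0.ne, eventually_lead_bound hR (by linarith) h2.ne',
    eventually_lead_bound (r := d.R3) hR (by linarith) (by linarith),
    hlim.eventually (eventually_lt_atBot (B * jj d.R3 - (|C| + 1)))] with N hN e1 e2 e3 e4 e5
  refine ⟨hN, fun x hx => sol_vv hx _, fun θ => ?_, fun θ => ?_, fun θ => ?_, fun θ => ?_,
    fun r hr => ?_, fun r hr θ hE hE' => ?_⟩
  · obtain ⟨hE, hl⟩ := e1 B θ
    have hb := hC N hN B d.r1 θ hr1 (by linarith) hE
    rw [max_eq_right (by linarith), Phi_self] at hl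
    rw [abs_le] at hl hb
    linarith
  · obtain ⟨hE, hl⟩ := e2 B θ
    have hb := hC N hN B d.s θ hs (by linarith) hE
    rw [max_eq_right h0.le, Phi_self] at hl
    rw [abs_le] at hl hb
    have := hB2 d.s ⟨le_rfl, by linarith⟩
    linarith
  · obtain ⟨hE, hl⟩ := e3 B θ
    have hb := hC N hN B d.r2 θ (by linarith) h3.le hE
    rw [abs_le] at hl hb
    have hr2 : d.r2 ∈ Icc d.s d.r2 := ⟨by linarith, le_rfl⟩
    have := hB2 d.r2 hr2
    have : 0 ≤ N * Phi d.R (max d.r2 d.R) := mul_nonneg (Nat.cast_nonneg N) (hPhi0 _ hr2)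
    linarith
  · obtain ⟨hE, hl⟩ := e4 B θ
    have hb := hC N hN B d.R3 θ (by linarith) le_rfl hE
    rw [max_eq_left (by linarith)] at hl
    rw [abs_le] at hl hb
    linarith
  · have hN' : (N : ℝ) ≠ 0 := by exact_mod_cast hN.ne'
    have hcos : cos (N * (π / N)) = -1 := by rw [mul_div_cancel₀ _ hN', cos_pi]
    have hE : 0 < EE d.R N r (π / N) := by
      rw [EE, hcos]
      linarith [one_le_cosh (N * Real.log (r / d.R))]
    refine ⟨hE, ?_⟩
    have hb := hC N hN B r (π / N) (hs.trans_le hr.1) (by linarith [hr.2]) hE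
    have hp := exp_pos (-(N * |Real.log (r / d.R)|))
    rw [lead_eq hE, hcos, abs_le] at hb
    have hl : 0 ≤ Real.log (1 + rexp (-(N * |Real.log (r / d.R)|)) ^ 2 -
        2 * rexp (-(N * |Real.log (r / d.R)|)) * -1) := Real.log_nonneg (by nlinarith)
    have := hB2 r hr
    have : 0 ≤ N * Phi d.R (max r d.R) := mul_nonneg (Nat.cast_nonneg N) (hPhi0 r hr)
    linarith
  · have hb := hC N hN B r θ (hs.trans_le hr.1) (by linarith [hr.2]) hE
    have hlog := (Real.log_le_log hE hE').trans_eq (Real.log_exp _)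
    have ht := abs_le_one_of_EE_le_one (hE'.trans (exp_le_one_iff.2 (by linarith)))
    have hN0 : (0 : ℝ) ≤ N := Nat.cast_nonneg N
    have hPhi : N * Phi d.R (max r d.R) ≤ K := by
      rcases le_or_gt r d.R with h | h
      · rw [max_eq_right h, Phi_self, mul_zero]
        exact hK0
      · rw [max_eq_left h.le]
        have h4 : Phi d.R r ≤ K * |Real.log (r / d.R)| := (hK r ⟨h.le, hr.2⟩).trans
          (mul_le_mul_of_nonneg_left (le_abs_self _) hK0)
        calc N * Phi d.R r ≤ N * (K * |Real.log (r / d.R)|) := mul_le_mul_of_nonneg_left h4 hN0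
          _ = K * (N * |Real.log (r / d.R)|) := by ring
          _ ≤ K * 1 := mul_le_mul_of_nonneg_left ht hK0
          _ = K := mul_one K
    have h5 : 0 ≤ N * |Real.log (r / d.R)| := by positivity
    rw [abs_le, lead] at hb
    have := hB3 r hr
    linarith

/-- The open set on which the multi-pole solution is admissible. -/
def adm {κ : ℝ} (d : Data κ) (N : ℕ) (v : Pl → ℝ) : Set Pl :=
  {x | ‖x‖ < d.R3 ∧ (∀ j ∈ Finset.range N, x ≠ pts d.R N j) ∧ (‖x‖ < d.s ∨ 0 < v x)}

/-- The domain: the component of the origin in the admissible set. -/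
def dom {κ : ℝ} (d : Data κ) (N : ℕ) (v : Pl → ℝ) : Set Pl :=
  connectedComponentIn (adm d N v) 0

lemma norm_pts {κ : ℝ} (d : Data κ) (N j : ℕ) : ‖pts d.R N j‖ = d.R := by
  rw [pts, norm_pol, abs_of_pos d.R_pos]

lemma ne_pts_of_norm_ne {κ : ℝ} {d : Data κ} {x : Pl} (h : ‖x‖ ≠ d.R) (N j : ℕ) :
    x ≠ pts d.R N j := fun h' => h (h' ▸ norm_pts d N j)

lemma toC_pts_pow (R : ℝ) {N j : ℕ} (hj : j ∈ Finset.range N) :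
    toC (pts R N j) ^ N = (R : ℂ) ^ N := by
  have hN : 0 < N := Nat.zero_lt_of_lt (Finset.mem_range.1 hj)
  rw [← sub_eq_zero, ← prod_sub_pt R hN, toC_pts]
  exact Finset.prod_eq_zero hj (sub_self _)

lemma dom_subset {κ : ℝ} (d : Data κ) (N : ℕ) (v : Pl → ℝ) : dom d N v ⊆ adm d N v :=
  connectedComponentIn_subset _ _

lemma dom_extend {κ : ℝ} {d : Data κ} {N : ℕ} {v : Pl → ℝ} {S : Set Pl} (hS : IsPreconnected S)
    (hSW : S ⊆ adm d N v) {x : Pl} (hx : x ∈ S) (hxd : x ∈ dom d N v) : S ⊆ dom d N v := by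
  rw [dom, connectedComponentIn_eq hxd]
  exact hS.subset_connectedComponentIn hx hSW

namespace Signs

variable {κ : ℝ} {d : Data κ} {A0 : ℝ} {N : ℕ} {v : Pl → ℝ}

lemma continuousAt (hv : Signs d A0 N v) {x : Pl} (hx : ∀ j ∈ Finset.range N, x ≠ pts d.R N j) :
    ContinuousAt v x := (hv.sol x hx).smooth.continuousAt

lemma isOpen_adm (hv : Signs d A0 N v) : IsOpen (adm d N v) := by
  rw [isOpen_iff_mem_nhds]
  rintro x ⟨h1, h2, h3⟩
  have e1 : ∀ᶠ y : Pl in 𝓝 x, ‖y‖ < d.R3 := continuous_norm.continuousAt.eventually_lt_const h1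
  have e2 : ∀ᶠ y in 𝓝 x, ∀ j ∈ Finset.range N, y ≠ pts d.R N j :=
    (Finset.eventually_all _).2 fun j hj => eventually_ne_nhds (h2 j hj)
  have e3 : ∀ᶠ y in 𝓝 x, ‖y‖ < d.s ∨ 0 < v y := by
    rcases h3 with h3 | h3
    · exact (continuous_norm.continuousAt.eventually_lt_const h3).mono fun _ => Or.inl
    · exact ((hv.continuousAt h2).eventually_const_lt h3).mono fun _ => Or.inr
  filter_upwards [e1, e2, e3] with y h1 h2 h3 using ⟨h1, h2, h3⟩

lemma isOpen_dom (hv : Signs d A0 N v) : IsOpen (dom d N v) :=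
  hv.isOpen_adm.connectedComponentIn

lemma exp_lt_EE (hv : Signs d A0 N v) {x : Pl} (hx : x ∈ adm d N v) (hs : d.s ≤ ‖x‖)
    (h2 : ‖x‖ ≤ d.r2) {θ : ℝ} (hθ : x = pol ‖x‖ θ) : rexp (-2 * A0) < EE d.R N ‖x‖ θ := by
  by_contra! h
  have hE : 0 < EE d.R N ‖x‖ θ :=
    EE_pos d.R_pos (d.s_pos.trans_le hs) hv.N_pos (by rw [← hθ]; exact hx.2.1)
  have h3 := hv.nonpos ‖x‖ ⟨hs, h2⟩ θ hE h
  rw [← hθ] at h3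
  exact (hx.2.2.resolve_left hs.not_gt).not_ge h3

lemma pts_notMem_closure (hv : Signs d A0 N v) {j : ℕ} (hj : j ∈ Finset.range N) :
    pts d.R N j ∉ closure (adm d N v) := by
  rw [mem_closure_iff_frequently, not_frequently]
  have hR := d.R_pos
  have hn := norm_pts d N j
  have hc : ContinuousAt (fun x : Pl => ‖toC x ^ N - (d.R : ℂ) ^ N‖ ^ 2 / (‖x‖ * d.R) ^ N)
      (pts d.R N j) := by
    refine ContinuousAt.div (((continuous_toC.pow N).sub continuous_const).norm.pow 2).continuousAt
      ((continuous_norm.mul continuous_const).pow N).continuousAt ?_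
    rw [hn]
    positivity
  have e1 := hc.eventually_lt_const (u := rexp (-2 * A0)) (by
    beta_reduce
    rw [toC_pts_pow _ hj, sub_self, norm_zero]
    simp only [ne_eq, OfNat.ofNat_ne_zero, not_false_eq_true, zero_pow, zero_div]
    exact exp_pos _)
  have e2 : ∀ᶠ x : Pl in 𝓝 (pts d.R N j), d.s < ‖x‖ :=
    continuous_norm.continuousAt.eventually_const_lt (d.s_lt.trans_eq hn.symm)
  have e3 : ∀ᶠ x : Pl in 𝓝 (pts d.R N j), ‖x‖ < d.r2 :=
    continuous_norm.continuousAt.eventually_lt_const (hn.trans_lt d.R_lt)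
  filter_upwards [e1, e2, e3] with x h1 h2 h3 hx
  obtain ⟨θ, hθ⟩ := exists_eq_pol x
  have hx0 : 0 < ‖x‖ := d.s_pos.trans h2
  have h4 := norm_pow_sub_sq hR hx0 N θ
  have h5 : toC x = circleMap 0 ‖x‖ θ := by rw [← toC_pol, ← hθ]
  rw [h5, h4, mul_div_cancel_left₀ _ (by positivity)] at h1
  exact (hv.exp_lt_EE hx h2.le h3.le hθ).not_gt h1

lemma mem_dom_of_mem_closure {x : Pl} (h0 : (0 : Pl) ∈ dom d N v)
    (hx : x ∈ closure (dom d N v)) (hW : x ∈ adm d N v) : x ∈ dom d N v := by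
  have h1 : IsPreconnected (insert x (dom d N v)) :=
    isPreconnected_connectedComponentIn.subset_closure (subset_insert _ _)
      (insert_subset hx subset_closure)
  exact dom_extend h1 (insert_subset hW (dom_subset d N v)) (mem_insert_of_mem _ h0) h0
    (mem_insert _ _)

lemma closedBall_subset (hv : Signs d A0 N v) : Metric.closedBall 0 d.s ⊆ dom d N v := by
  refine (convex_closedBall (0 : Pl) d.s).isPreconnected.subset_connectedComponentIn
    (Metric.mem_closedBall_self d.s_pos.le) fun x hx => ?_
  rw [mem_closedBall_zero_iff] at hx
  have h1 := d.s_lt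
  have h2 := d.R_lt
  have h3 := d.r2_lt
  refine ⟨by linarith, fun j _ => ne_pts_of_norm_ne (by linarith) N j, ?_⟩
  rcases hx.lt_or_eq with h | h
  · exact Or.inl h
  · obtain ⟨θ, hθ⟩ := exists_eq_pol x
    rw [hθ, h]
    exact Or.inr (hv.pos_s θ)

lemma zero_mem (hv : Signs d A0 N v) : (0 : Pl) ∈ dom d N v :=
  hv.closedBall_subset (Metric.mem_closedBall_self d.s_pos.le)

lemma pol_s_mem (hv : Signs d A0 N v) (θ : ℝ) : pol d.s θ ∈ dom d N v :=
  hv.closedBall_subset (by rw [mem_closedBall_zero_iff, norm_pol, abs_of_pos d.s_pos])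

lemma pol_r1_mem (hv : Signs d A0 N v) (θ : ℝ) : pol d.r1 θ ∈ dom d N v :=
  hv.closedBall_subset (by
    rw [mem_closedBall_zero_iff, norm_pol, abs_of_pos d.r1_pos]
    exact d.r1_lt.le)

lemma pol_ray_mem (hv : Signs d A0 N v) : pol d.r2 (π / N) ∈ dom d N v := by
  have h1 := d.s_lt
  have h2 := d.R_lt
  have h3 := d.r2_lt
  have hS : IsPreconnected ((fun r => pol r (π / N)) '' Icc d.s d.r2) :=
    isPreconnected_Icc.image _ (continuous_pol.comp
      (continuous_id.prodMk continuous_const)).continuousOn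
  refine dom_extend hS ?_ ⟨d.s, ⟨le_rfl, by linarith⟩, rfl⟩ (hv.pol_s_mem _)
    ⟨d.r2, ⟨by linarith, le_rfl⟩, rfl⟩
  rintro _ ⟨r, hr, rfl⟩
  have hr0 : 0 < r := d.s_pos.trans_le hr.1
  obtain ⟨hE, hp⟩ := hv.pos_ray r hr
  refine ⟨?_, fun j hj h => ?_, Or.inr hp⟩
  · rw [norm_pol, abs_of_pos hr0]
    exact hr.2.trans_lt h3
  · refine hE.ne' ((pow_eq_of_EE_eq_zero d.R_pos hr0).2 ?_)
    rw [← toC_pol, show pol r (π / N) = pts d.R N j from h, toC_pts_pow _ hj]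

lemma pol_r2_mem (hv : Signs d A0 N v) (θ : ℝ) : pol d.r2 θ ∈ dom d N v := by
  have h1 := d.s_lt
  have h2 := d.R_lt
  have h3 := d.r2_lt
  have h0 : 0 < d.r2 := d.R_pos.trans h2
  have hS : IsPreconnected (range fun θ => pol d.r2 θ) :=
    isPreconnected_range (continuous_pol.comp (continuous_const.prodMk continuous_id))
  refine dom_extend hS ?_ ⟨π / N, rfl⟩ hv.pol_ray_mem ⟨θ, rfl⟩
  rintro _ ⟨φ, rfl⟩
  have hn : ‖pol d.r2 φ‖ = d.r2 := by rw [norm_pol, abs_of_pos h0]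
  exact ⟨hn.trans_lt h3, fun j _ => ne_pts_of_norm_ne (by rw [hn]; exact h2.ne') N j,
    Or.inr (hv.pos_r2 φ)⟩

lemma isConnected_dom (hv : Signs d A0 N v) : IsConnected (dom d N v) :=
  ⟨⟨0, hv.zero_mem⟩, isPreconnected_connectedComponentIn⟩

lemma isBounded_dom : Bornology.IsBounded (dom d N v) :=
  (Metric.isBounded_closedBall (x := (0 : Pl)) (r := d.R3)).subset fun x hx => by
    rw [mem_closedBall_zero_iff]
    exact (dom_subset d N v hx).1.le

lemma of_mem_closure (hv : Signs d A0 N v) {x : Pl} (hx : x ∈ closure (dom d N v))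
    (hn : x ∉ dom d N v) : ContinuousAt v x ∧ v x = 0 := by
  have h1 := d.s_lt
  have h2 := d.R_lt
  have h3 := d.r2_lt
  have hp : ∀ j ∈ Finset.range N, x ≠ pts d.R N j := fun j hj h =>
    hv.pts_notMem_closure hj (h ▸ closure_mono (dom_subset d N v) hx)
  have hc := hv.continuousAt hp
  have hW : x ∉ adm d N v := fun h => hn (mem_dom_of_mem_closure hv.zero_mem hx h)
  have hs : d.s < ‖x‖ := by
    by_contra! h
    exact hn (hv.closedBall_subset (mem_closedBall_zero_iff.2 h))
  have hR : ‖x‖ ≤ d.R3 := by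
    have : closure (dom d N v) ⊆ Metric.closedBall 0 d.R3 :=
      closure_minimal (fun y hy => mem_closedBall_zero_iff.2 (dom_subset d N v hy).1.le)
        Metric.isClosed_closedBall
    exact mem_closedBall_zero_iff.1 (this hx)
  have h0 : 0 ≤ v x := by
    by_contra! h
    have e1 := hc.eventually_lt_const h
    have e2 : ∀ᶠ y : Pl in 𝓝 x, d.s < ‖y‖ := continuous_norm.continuousAt.eventually_const_lt hs
    obtain ⟨y, hy, hy1, hy2⟩ := ((mem_closure_iff_frequently.1 hx).and_eventually
      (e1.and e2)).exists
    exact ((dom_subset d N v hy).2.2.resolve_left hy2.not_gt).not_gt hy1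
  refine ⟨hc, le_antisymm ?_ h0⟩
  by_contra! h
  refine hW ⟨lt_of_le_of_ne hR fun h' => ?_, hp, Or.inr h⟩
  obtain ⟨θ, hθ⟩ := exists_eq_pol x
  rw [hθ, h'] at h
  exact (hv.neg_R3 θ).not_gt h

/-- The eigenfunction. -/
lemma eigen (hv : Signs d A0 N v) : Eigen (dom d N v) ((dom d N v).indicator v) := by
  have hev : ∀ x ∈ dom d N v, (dom d N v).indicator v =ᶠ[𝓝 x] v := fun x hx =>
    (hv.isOpen_dom.eventually_mem hx).mono fun y hy => indicator_of_mem hy v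
  have hsol : ∀ x ∈ dom d N v, Sol v x := fun x hx => hv.sol x (dom_subset d N v hx).2.1
  refine ⟨hv.isOpen_dom, isBounded_dom, ?_, fun x hx => indicator_of_notMem hx v,
    fun x hx => (hsol x hx).smooth.congr_of_eventuallyEq (hev x hx), fun x hx => ?_⟩
  · rw [continuous_iff_continuousAt]
    intro x
    by_cases hx : x ∈ dom d N v
    · exact (hsol x hx).smooth.continuousAt.congr (hev x hx).symm
    by_cases hx' : x ∈ closure (dom d N v)
    · obtain ⟨hc, h0⟩ := hv.of_mem_closure hx' hx
      rw [ContinuousAt, indicator_of_notMem hx]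
      have hz := hc.norm.tendsto
      rw [h0, norm_zero] at hz
      exact squeeze_zero_norm (fun y => norm_indicator_le_norm_self v y) hz
    · refine continuousAt_const (y := (0 : ℝ)) |>.congr ?_
      filter_upwards [isClosed_closure.isOpen_compl.mem_nhds hx'] with y hy
      rw [indicator_of_notMem fun h => hy (subset_closure h)]
  · rw [lap_congr (hev x hx), (hsol x hx).eq, indicator_of_mem hx]

lemma nodal_subset (hv : Signs d A0 N v) :
    closure {x ∈ dom d N v | (dom d N v).indicator v x = 0} ⊆ dom d N v := by
  refine (closure_minimal (fun x hx => ?_) Metric.isClosed_closedBall).trans hv.closedBall_subset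
  obtain ⟨hx, h0⟩ := hx
  rw [indicator_of_mem hx] at h0
  rw [mem_closedBall_zero_iff]
  exact ((dom_subset d N v hx).2.2.resolve_right h0.not_gt).le

end Signs

lemma not_simplyConnectedSpace {Ω : Set Pl} (hΩ : IsOpen Ω) {ρ : ℝ}
    (hc : ∀ θ, pol ρ θ ∈ Ω) {x : Pl} (hx : x ∉ Ω) (hxρ : ‖x‖ < ρ) : ¬SimplyConnectedSpace Ω := by
  intro h
  have hρ : 0 < ρ := (norm_nonneg x).trans_lt hxρ
  obtain ⟨f, hf, hfg⟩ := Complex.exists_continuousOn_eqOn_exp_comp (U := Ω)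
    (show IsSimplyConnected Ω from h) hΩ
    (g := fun y => toC y - toC x) (continuous_toC.sub continuous_const).continuousOn (by
      rintro ⟨y, hy, h0⟩
      exact hx (toC_injective (sub_eq_zero.1 h0) ▸ hy))
  have hz : ∀ θ, circleMap 0 ρ θ ≠ 0 := fun θ => circleMap_ne_center hρ.ne'
  have hlt : ∀ θ, ‖-(toC x / circleMap 0 ρ θ)‖ < 1 := fun θ => by
    rw [norm_neg, norm_div, norm_toC, norm_circleMap_zero, abs_of_pos hρ, div_lt_one hρ]
    exact hxρ
  have hsl : ∀ θ, 1 + -(toC x / circleMap 0 ρ θ) ∈ Complex.slitPlane := fun θ =>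
    Complex.mem_slitPlane_of_norm_lt_one (hlt θ)
  set G : ℝ → ℂ := fun θ => f (pol ρ θ) - Complex.log (1 + -(toC x / circleMap 0 ρ θ)) -
    θ * Complex.I with hG
  have hGc : Continuous G := by
    refine ((hf.comp_continuous (continuous_pol.comp
      (continuous_const.prodMk continuous_id)) hc).sub (Continuous.clog ?_ hsl)).sub
      (Complex.continuous_ofReal.mul continuous_const)
    exact continuous_const.add ((continuous_const.div (continuous_circleMap 0 ρ) hz).neg)
  have hexp : ∀ θ, Complex.exp (G θ) = (ρ : ℂ) := fun θ => by
    have h1 : Complex.exp (f (pol ρ θ)) = circleMap 0 ρ θ - toC x := by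
      rw [← toC_pol]
      exact hfg (hc θ)
    have h2 := hz θ
    have h3 := Complex.slitPlane_ne_zero (hsl θ)
    rw [hG]
    beta_reduce
    rw [Complex.exp_sub, Complex.exp_sub, Complex.exp_log h3, h1]
    have h4 : circleMap 0 ρ θ - toC x =
        circleMap 0 ρ θ * (1 + -(toC x / circleMap 0 ρ θ)) := by
      field_simp
      ring
    rw [h4, mul_div_cancel_right₀ _ h3, circleMap_zero, mul_div_cancel_right₀ _ (Complex.exp_ne_zero _)]
  have hcos : ∀ θ, 0 < cos (G θ).im := fun θ => by
    have h1 := congrArg Complex.re (hexp θ)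
    rw [Complex.exp_re, Complex.ofReal_re] at h1
    exact (mul_pos_iff_of_pos_left (exp_pos (G θ).re)).1 (h1 ▸ hρ)
  have hper : (G (2 * π)).im = (G 0).im - 2 * π := by
    have h1 : pol ρ (2 * π) = pol ρ 0 := by simp [pol]
    have h2 : circleMap 0 ρ (2 * π) = circleMap 0 ρ 0 := by
      rw [← toC_pol, ← toC_pol, h1]
    rw [hG]
    beta_reduce
    rw [h1, h2]
    simp
  have hmem : (G 0).im - π ∈ Icc (G (2 * π)).im (G 0).im :=
    ⟨by linarith [pi_pos], by linarith [pi_pos]⟩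
  obtain ⟨θ, -, hθ⟩ := intermediate_value_Icc' (by positivity : (0 : ℝ) ≤ 2 * π)
    (Complex.continuous_im.comp hGc).continuousOn hmem
  have h1 := hcos θ
  rw [show (G θ).im = (G 0).im - π from hθ, cos_sub_pi] at h1
  linarith [hcos 0]

/-- A planar domain with a second Dirichlet eigenfunction whose nodal line is closed. -/
theorem exists_closed_nodal_line :
    ∃ (Ω : Set (EuclideanSpace ℝ (Fin 2))) (u : EuclideanSpace ℝ (Fin 2) → ℝ),
      IsOpen Ω ∧ IsConnected Ω ∧ Bornology.IsBounded Ω ∧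
      ¬ SimplyConnectedSpace ↥Ω ∧
      ContDiffOn ℝ 2 u Ω ∧ ContinuousOn u (closure Ω) ∧
      (∃ x ∈ Ω, u x ≠ 0) ∧
      (∀ x ∈ Ω, - lap u x = dirichletEig Ω 2 * u x) ∧
      (∀ x ∈ frontier Ω, u x = 0) ∧
      closure {x ∈ Ω | u x = 0} ⊆ Ω := by
  obtain ⟨d⟩ := exists_data (κ := 1 / (4 * π ^ 2)) (by positivity)
  obtain ⟨A0, hA0, B, hsig⟩ := exists_signs d
  obtain ⟨N, hv, hray⟩ := (hsig.and (eventually_rayleigh d hA0)).exists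
  set v := vv d.R N (N * gg d.R + B)
  have hu := hv.eigen
  have hmem : ∀ {x}, x ∈ dom d N v → (dom d N v).indicator v x = v x := fun hx =>
    Set.indicator_of_mem hx v
  have hj : 0 ∈ Finset.range N := Finset.mem_range.2 hv.N_pos
  have heig : dirichletEig (dom d N v) 2 = 1 := by
    refine hu.dirichletEig_eq (ρ1 := d.r1) (ρ2 := d.r2)
      (fun θ => (hmem (hv.pol_r1_mem θ)).trans_lt (hv.neg_r1 θ))
      (fun θ => (hv.pos_r2 θ).trans_eq (hmem (hv.pol_r2_mem θ)).symm) fun h hh h1 h2 => ?_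
    refine hray h (hh.smooth.of_le (natCast_le_top 1)) (fun x hx => ?_) h1 h2 fun r hr θ hx => ?_
    · by_contra h0
      exact (dom_subset d N v (hh.sub (subset_tsupport h h0))).1.not_ge hx
    · have hn : ‖pol r θ‖ = r := by rw [norm_pol, abs_of_pos (d.s_pos.trans hr.1)]
      have h3 := hv.exp_lt_EE (dom_subset d N v (hh.sub hx)) (θ := θ) (by rw [hn]; exact hr.1.le)
        (by rw [hn]; exact hr.2.le) (by rw [hn])
      rwa [hn] at h3
  refine ⟨dom d N v, (dom d N v).indicator v, hu.isOpen, hv.isConnected_dom, hu.bdd,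
    not_simplyConnectedSpace hu.isOpen hv.pol_r2_mem (x := pts d.R N 0)
      (fun h => (dom_subset d N v h).2.1 0 hj rfl) ((norm_pts d N 0).trans_lt d.R_lt),
    fun x hx => ((hu.smooth x hx).of_le (natCast_le_top 2)).contDiffWithinAt,
    hu.cont.continuousOn, ⟨pol d.r1 0, hv.pol_r1_mem 0, ?_⟩, fun x hx => ?_, fun x hx => ?_,
    hv.nodal_subset⟩
  · rw [hmem (hv.pol_r1_mem 0)]
    exact (hv.neg_r1 0).ne
  · rw [heig, hu.eq x hx, neg_neg, one_mul]
  · refine hu.zero x fun h => ?_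
    rw [hu.isOpen.frontier_eq] at hx
    exact hx.2 h

end Payne

/-- counterexample to Payne's nodal line conjecture: there exists a bounded,
connected, non-simply connected planar domain on which the nodal line of a second Dirichlet
eigenfunction is closed and does not touch the boundary. -/
theorem payne_nodal_line_counterexample :
    ∃ (Ω : Set (EuclideanSpace ℝ (Fin 2))) (u : EuclideanSpace ℝ (Fin 2) → ℝ),
      IsOpen Ω ∧ IsConnected Ω ∧ Bornology.IsBounded Ω ∧
      ¬ SimplyConnectedSpace ↥Ω ∧
      ContDiffOn ℝ 2 u Ω ∧ ContinuousOn u (closure Ω) ∧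
      (∃ x ∈ Ω, u x ≠ 0) ∧
      (∀ x ∈ Ω, - lap u x = dirichletEig Ω 2 * u x) ∧
      (∀ x ∈ frontier Ω, u x = 0) ∧
      closure {x ∈ Ω | u x = 0} ⊆ Ω :=
  Payne.exists_closed_nodal_line
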